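/- arXiv:1905.06895 — 3 statements merged into one kernel-verified Lean document; each statement's English description precedes it below -/
import Mathlib

section
/- Let G = (V, E) and H = (V, F) be any two labeled Eulerian simple graphs on the same vertex set V with |E| = |F| = m. Then there is a finite sequence (G = G_0, G_1, ..., G_ℓ = H) of labeled simple graphs on V such that each graph G_i is Eulerian and, for every i, G_{i+1} can be obtained from G_i by a 2-switch. -/
open SimpleGraph Finset
open scoped Classical

/-- A simple graph is Eulerian if it is connected and every vertex has even degree. -/
def IsEulerianGraph {V : Type*} [Fintype V] (G : SimpleGraph V) : Prop :=
  G.Connected ∧ ∀ v : V, Even (G.degree v)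

/-- A `k`-switch on a simple graph `G`: remove `k` edges from `G` and add `k` edges, obtaining
a simple graph `G'` on the same vertex set with the same number of edges. -/
def IsKSwitch {V : Type*} [Fintype V] (k : ℕ) (G G' : SimpleGraph V) : Prop :=
  ∃ R A : Finset (Sym2 V), R.card = k ∧ A.card = k ∧ R ⊆ G.edgeFinset ∧
    G'.edgeFinset = (G.edgeFinset \ R) ∪ A ∧ G'.edgeFinset.card = G.edgeFinset.card

set_option linter.unusedSectionVars false
set_option linter.unusedVariables false

namespace EulSw

variable {V : Type*} [Fintype V]

/-- indicator -/
noncomputable def io (p : Prop) : ℕ := if p then 1 else 0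

/-- degree -/
noncomputable def dg (G : SimpleGraph V) (x : V) : ℕ := (univ.filter (fun y => G.Adj x y)).card

/-- twice the number of edges -/
noncomputable def tot (G : SimpleGraph V) : ℕ := ∑ x, dg G x

/-- the pair `x y` is an edge of the 4-cycle `a b c d` -/
def C4 (a b c d x y : V) : Prop :=
  (x = a ∧ y = b) ∨ (x = b ∧ y = a) ∨ (x = b ∧ y = c) ∨ (x = c ∧ y = b) ∨
  (x = c ∧ y = d) ∨ (x = d ∧ y = c) ∨ (x = d ∧ y = a) ∨ (x = a ∧ y = d)

/-- toggle the edges of a 4-cycle -/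
def tog (G : SimpleGraph V) (a b c d : V) : SimpleGraph V where
  Adj x y := x ≠ y ∧ ¬ (G.Adj x y ↔ C4 a b c d x y)
  symm := ⟨by
    intro x y h
    refine ⟨h.1.symm, ?_⟩
    rw [G.adj_comm y x]
    have : C4 a b c d y x ↔ C4 a b c d x y := by unfold C4; grind
    rw [this]; exact h.2⟩
  loopless := ⟨fun x h => h.1 rfl⟩

/-- symmetric difference -/
def sd (G H : SimpleGraph V) : SimpleGraph V where
  Adj x y := ¬ (G.Adj x y ↔ H.Adj x y)
  symm := ⟨by
    intro x y h
    rw [G.adj_comm y x, H.adj_comm y x]; exact h⟩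
  loopless := ⟨fun x h => h (by simp)⟩

/-- four distinct points -/
def Dst (a b c d : V) : Prop := a ≠ b ∧ a ≠ c ∧ a ≠ d ∧ b ≠ c ∧ b ≠ d ∧ c ≠ d

lemma tog_adj {G : SimpleGraph V} {a b c d : V} (x y : V) : (tog G a b c d).Adj x y ↔
    x ≠ y ∧ ¬ (G.Adj x y ↔ C4 a b c d x y) := Iff.rfl

lemma sd_adj {G H : SimpleGraph V} (x y : V) : (sd G H).Adj x y ↔
    ¬ (G.Adj x y ↔ H.Adj x y) := Iff.rfl

lemma tog_rot (G : SimpleGraph V) (a b c d : V) : tog G a b c d = tog G b c d a := by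
  ext x y
  rw [tog_adj, tog_adj]
  have : C4 a b c d x y ↔ C4 b c d a x y := by unfold C4; grind
  rw [this]

lemma tog_tog (G : SimpleGraph V) (a b c d : V) : tog (tog G a b c d) a b c d = G := by
  ext x y
  rw [tog_adj, tog_adj]
  have := G.ne_of_adj (a := x) (b := y)
  tauto

lemma sd_tog (G H : SimpleGraph V) (a b c d : V) : sd (tog G a b c d) H = tog (sd G H) a b c d := by
  ext x y
  rw [sd_adj, tog_adj, tog_adj, sd_adj]
  have := G.ne_of_adj (a := x) (b := y)
  have := H.ne_of_adj (a := x) (b := y)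
  tauto

lemma sd_comm (G H : SimpleGraph V) : sd G H = sd H G := by
  ext x y
  rw [sd_adj, sd_adj]; tauto

/-- the number of edges of the 4-cycle in `G` -/
noncomputable def cnt (G : SimpleGraph V) (a b c d : V) : ℕ :=
  io (G.Adj a b) + io (G.Adj b c) + io (G.Adj c d) + io (G.Adj d a)

lemma dg_eq (G : SimpleGraph V) (x : V) : dg G x = ∑ y, io (G.Adj x y) := by
  unfold dg io; rw [Finset.card_filter]

lemma dg_tog (G : SimpleGraph V) {a b c d : V} (h : Dst a b c d) :
    dg (tog G a b c d) a + 2 * (io (G.Adj a b) + io (G.Adj a d)) = dg G a + 2 := by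
  obtain ⟨h1, h2, h3, h4, h5, h6⟩ := h
  have key : ∀ y, io ((tog G a b c d).Adj a y) +
      ((if y = b then 2 * io (G.Adj a b) else 0) + (if y = d then 2 * io (G.Adj a d) else 0))
      = io (G.Adj a y) + ((if y = b then 1 else 0) + (if y = d then 1 else 0)) := by
    intro y
    have e : (tog G a b c d).Adj a y ↔ a ≠ y ∧ ¬ (G.Adj a y ↔ (y = b ∨ y = d)) := by
      rw [tog_adj]
      have : C4 a b c d a y ↔ (y = b ∨ y = d) := by
        unfold C4; grind
      rw [this]
    unfold io
    rw [if_congr e rfl rfl]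
    by_cases hb : y = b
    · subst hb
      by_cases hg : G.Adj a y <;> simp [hg, h1, h5]
    · by_cases hd : y = d
      · subst hd
        by_cases hg : G.Adj a y <;> simp [hg, h3, hb]
      · by_cases hg : G.Adj a y
        · simp [hg, hb, hd, G.ne_of_adj hg]
        · simp [hg, hb, hd]
  have := Finset.sum_congr (rfl : (univ : Finset V) = univ) (fun y _ => key y)
  simp only [Finset.sum_add_distrib, Finset.sum_ite_eq', Finset.mem_univ, if_true] at this
  rw [dg_eq, dg_eq]; omega

lemma dg_tog_other (G : SimpleGraph V) {a b c d x : V} (ha : x ≠ a) (hb : x ≠ b) (hc : x ≠ c)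
    (hd : x ≠ d) : dg (tog G a b c d) x = dg G x := by
  unfold dg
  congr 1
  ext y
  simp only [Finset.mem_filter, Finset.mem_univ, true_and]
  rw [tog_adj]
  have : ¬ C4 a b c d x y := by unfold C4; grind
  have := G.ne_of_adj (a := x) (b := y)
  tauto

lemma Dst.rot {a b c d : V} (h : Dst a b c d) : Dst b c d a := by
  unfold Dst at *; tauto

lemma dg_tog_all (G : SimpleGraph V) {a b c d : V} (h : Dst a b c d) (x : V) :
    dg (tog G a b c d) x + 2 *
      ((if x = a then io (G.Adj a b) + io (G.Adj d a) else 0) +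
       (if x = b then io (G.Adj b c) + io (G.Adj a b) else 0) +
       (if x = c then io (G.Adj c d) + io (G.Adj b c) else 0) +
       (if x = d then io (G.Adj d a) + io (G.Adj c d) else 0))
      = dg G x + 2 * ((if x = a then 1 else 0) + (if x = b then 1 else 0) +
        (if x = c then 1 else 0) + (if x = d then 1 else 0)) := by
  have A := dg_tog G h
  have B := dg_tog G h.rot
  have C := dg_tog G h.rot.rot
  have D := dg_tog G h.rot.rot.rot
  rw [← tog_rot] at B
  rw [← tog_rot, ← tog_rot] at C
  rw [← tog_rot, ← tog_rot, ← tog_rot] at D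
  rw [G.adj_comm a d] at A
  rw [G.adj_comm b a] at B
  rw [G.adj_comm c b] at C
  rw [G.adj_comm d c] at D
  obtain ⟨h1, h2, h3, h4, h5, h6⟩ := h
  by_cases ha : x = a
  · subst ha; simp [h1, h2, h3]; omega
  by_cases hb : x = b
  · subst hb; simp [ha, h4, h5]; omega
  by_cases hc : x = c
  · subst hc; simp [ha, hb, h6]; omega
  by_cases hd : x = d
  · subst hd; simp [ha, hb, hc]; omega
  simp [ha, hb, hc, hd, dg_tog_other G ha hb hc hd]

lemma tot_tog (G : SimpleGraph V) {a b c d : V} (h : Dst a b c d) :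
    tot (tog G a b c d) + 4 * cnt G a b c d = tot G + 8 := by
  have := Finset.sum_congr (rfl : (univ : Finset V) = univ) (fun x _ => dg_tog_all G h x)
  simp only [Finset.sum_add_distrib, Finset.sum_ite_eq', Finset.mem_univ, if_true,
    ← Finset.mul_sum] at this
  unfold tot cnt; omega

/-- all degrees even -/
def Ev (G : SimpleGraph V) : Prop := ∀ x, Even (dg G x)

lemma even_tog (G : SimpleGraph V) {a b c d : V} (h : Dst a b c d) (x : V) :
    Even (dg (tog G a b c d) x) ↔ Even (dg G x) := by
  have := dg_tog_all G h x
  rw [Nat.even_iff, Nat.even_iff]; omega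

/-- one move: toggling a 4-cycle, half of whose edges are present. -/
def Mv (G G' : SimpleGraph V) : Prop :=
  ∃ a b c d, Dst a b c d ∧ G' = tog G a b c d ∧
    ((G.Adj a b ∧ G.Adj b c ∧ ¬ G.Adj c d ∧ ¬ G.Adj d a) ∨
     (G.Adj a b ∧ G.Adj c d ∧ ¬ G.Adj b c ∧ ¬ G.Adj d a))

lemma mv_of_cnt {G : SimpleGraph V} {a b c d : V} (h : Dst a b c d) (hc : cnt G a b c d = 2) :
    Mv G (tog G a b c d) := by
  have r1 := tog_rot G a b c d
  have r2 := tog_rot G b c d a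
  have r3 := tog_rot G c d a b
  have d1 := h.rot
  have d2 := d1.rot
  have d3 := d2.rot
  unfold cnt io at hc
  by_cases h1 : G.Adj a b <;> by_cases h2 : G.Adj b c <;> by_cases h3 : G.Adj c d <;>
    by_cases h4 : G.Adj d a <;> simp [h1, h2, h3, h4] at hc
  · exact ⟨a, b, c, d, h, rfl, by tauto⟩
  · exact ⟨a, b, c, d, h, rfl, by tauto⟩
  · exact ⟨d, a, b, c, d3, by rw [r1, r2, r3], by tauto⟩
  · exact ⟨b, c, d, a, d1, r1, by tauto⟩
  · exact ⟨b, c, d, a, d1, r1, by tauto⟩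
  · exact ⟨c, d, a, b, d2, by rw [r1, r2], by tauto⟩

lemma Mv.cnt {G G' : SimpleGraph V} (h : Mv G G') :
    ∃ a b c d, Dst a b c d ∧ G' = tog G a b c d ∧ cnt G a b c d = 2 := by
  obtain ⟨a, b, c, d, h, rfl, h1 | h1⟩ := h
  · exact ⟨a, b, c, d, h, rfl, by unfold EulSw.cnt io; simp [h1]⟩
  · exact ⟨a, b, c, d, h, rfl, by unfold EulSw.cnt io; simp [h1]⟩

lemma Mv.tot {G G' : SimpleGraph V} (h : Mv G G') : tot G' = tot G := by
  obtain ⟨a, b, c, d, hd, rfl, h1⟩ := h.cnt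
  have := tot_tog G hd
  omega

lemma Mv.even {G G' : SimpleGraph V} (h : Mv G G') (x : V) : Even (dg G' x) ↔ Even (dg G x) := by
  obtain ⟨a, b, c, d, h, rfl, h1⟩ := h
  exact even_tog G h x

lemma cnt_tog {G : SimpleGraph V} {a b c d : V} (h : Dst a b c d) :
    EulSw.cnt (tog G a b c d) a b c d + EulSw.cnt G a b c d = 4 := by
  obtain ⟨h1, h2, h3, h4, h5, h6⟩ := h
  unfold EulSw.cnt io
  have e1 : (tog G a b c d).Adj a b ↔ ¬ G.Adj a b := by rw [tog_adj]; unfold C4; grind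
  have e2 : (tog G a b c d).Adj b c ↔ ¬ G.Adj b c := by rw [tog_adj]; unfold C4; grind
  have e3 : (tog G a b c d).Adj c d ↔ ¬ G.Adj c d := by rw [tog_adj]; unfold C4; grind
  have e4 : (tog G a b c d).Adj d a ↔ ¬ G.Adj d a := by
    rw [tog_adj]; unfold C4; grind
  simp only [e1, e2, e3, e4]
  split_ifs <;> simp_all

lemma Mv.symm {G G' : SimpleGraph V} (h : Mv G G') : Mv G' G := by
  obtain ⟨a, b, c, d, hd, rfl, h1⟩ := h.cnt
  have := mv_of_cnt (G := tog G a b c d) hd (by have := cnt_tog (G := G) hd; omega)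
  rwa [tog_tog] at this

lemma tot_eq (G : SimpleGraph V) : tot G = 2 * G.edgeFinset.card := by
  rw [← G.sum_degrees_eq_twice_card_edges]
  unfold tot dg
  refine Finset.sum_congr rfl fun x _ => ?_
  rw [← SimpleGraph.card_neighborFinset_eq_degree]
  congr 1
  ext y; simp

end EulSw

namespace EulSw

variable {V : Type*} [Fintype V]

open Relation

lemma dg_le {K : SimpleGraph V} {x : V} {S : Finset V} (h : ∀ y, K.Adj x y → y ∈ S) :
    dg K x ≤ S.card := by
  unfold dg
  exact Finset.card_le_card (fun y hy => h y (by simpa using hy))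

lemma le_dg {K : SimpleGraph V} {x : V} {S : Finset V} (h : ∀ y ∈ S, K.Adj x y) :
    S.card ≤ dg K x := by
  unfold dg
  exact Finset.card_le_card (fun y hy => by simpa using h y hy)

lemma sum_le_tot (K : SimpleGraph V) (Q : Finset V) : ∑ x ∈ Q, dg K x ≤ tot K :=
  Finset.sum_le_sum_of_subset (Finset.subset_univ Q)

lemma tot_eq_sum {K : SimpleGraph V} {Q : Finset V} (h : ∀ x y, K.Adj x y → x ∈ Q) :
    tot K = ∑ x ∈ Q, dg K x := by
  unfold tot
  symm
  apply Finset.sum_subset (Finset.subset_univ Q)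
  intro x _ hx
  have := dg_le (K := K) (x := x) (S := ∅) (fun y hy => absurd (h x y hy) hx)
  simpa using this

lemma even_other {K : SimpleGraph V} {x y : V} (he : Even (dg K x)) (h : K.Adj x y) :
    ∃ z, z ≠ y ∧ K.Adj x z := by
  by_contra hc
  push Not at hc
  have h1 := dg_le (K := K) (x := x) (S := {y}) (fun z hz => by
    by_contra h2; exact hc z (by simpa using h2) hz)
  have h2 := le_dg (K := K) (x := x) (S := {y}) (fun z hz => by
    rw [Finset.mem_singleton] at hz; subst hz; exact h)
  simp at h1 h2
  have : dg K x = 1 := by omega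
  rw [this] at he
  exact absurd he (by decide)

lemma dg_sdiff (G H : SimpleGraph V) (x : V) : dg G x + dg (H \ G) x = dg H x + dg (G \ H) x := by
  simp only [dg_eq, ← Finset.sum_add_distrib]
  refine Finset.sum_congr rfl fun y _ => ?_
  simp only [io, SimpleGraph.sdiff_adj]
  by_cases h1 : G.Adj x y <;> by_cases h2 : H.Adj x y <;> simp [h1, h2]

lemma dg_sd (G H : SimpleGraph V) (x : V) : dg (sd G H) x = dg (H \ G) x + dg (G \ H) x := by
  simp only [dg_eq, ← Finset.sum_add_distrib]
  refine Finset.sum_congr rfl fun y _ => ?_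
  simp only [io, SimpleGraph.sdiff_adj, sd_adj]
  by_cases h1 : G.Adj x y <;> by_cases h2 : H.Adj x y <;> simp [h1, h2]

/-- same degree parities and same number of edges -/
def Pre (G H : SimpleGraph V) : Prop := (∀ x, (Even (dg G x) ↔ Even (dg H x))) ∧ tot G = tot H

lemma Pre.symm {G H : SimpleGraph V} (h : Pre G H) : Pre H G :=
  ⟨fun x => (h.1 x).symm, h.2.symm⟩

lemma Pre.mv {G G' H : SimpleGraph V} (h : Pre G H) (m : Mv G G') : Pre G' H :=
  ⟨fun x => (m.even x).trans (h.1 x), m.tot.trans h.2⟩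

lemma Pre.tots {G H : SimpleGraph V} (h : Pre G H) : tot (G \ H) = tot (H \ G) := by
  have := Finset.sum_congr (rfl : (univ : Finset V) = univ) (fun x _ => dg_sdiff G H x)
  simp only [Finset.sum_add_distrib] at this
  have h2 := h.2
  unfold tot at *
  omega

lemma Pre.even {G H : SimpleGraph V} (h : Pre G H) (x : V) : Even (dg (sd G H) x) := by
  have h1 := dg_sd G H x
  have h2 := dg_sdiff G H x
  have h3 := h.1 x
  rw [Nat.even_iff, Nat.even_iff] at h3
  rw [Nat.even_iff]
  omega

lemma rtg_symm {α : Type*} {r : α → α → Prop} (hr : ∀ x y, r x y → r y x) {a b : α}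
    (h : ReflTransGen r a b) : ReflTransGen r b a := by
  induction h with
  | refl => exact ReflTransGen.refl
  | tail _ h2 ih => exact ReflTransGen.head (hr _ _ h2) ih

/-- minimal counterexample -/
def Bad (G H : SimpleGraph V) : Prop :=
  Pre G H ∧ ¬ ReflTransGen Mv G H ∧
    ∀ G' H' : SimpleGraph V, Pre G' H' → tot (sd G' H') < tot (sd G H) → ReflTransGen Mv G' H'

lemma Bad.swap {G H : SimpleGraph V} (h : Bad G H) : Bad H G := by
  refine ⟨h.1.symm, fun h1 => h.2.1 (rtg_symm (fun _ _ => Mv.symm) h1), ?_⟩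
  rw [sd_comm]; exact h.2.2

lemma Bad.f1 {G H : SimpleGraph V} (h : Bad G H) {a b c d : V} (hd : Dst a b c d)
    (h2 : cnt G a b c d = 2) : cnt (sd G H) a b c d ≤ 2 := by
  by_contra hc
  have m := mv_of_cnt hd h2
  have h3 := tot_tog (sd G H) hd
  rw [← sd_tog] at h3
  exact h.2.1 (ReflTransGen.head m (h.2.2 _ _ (h.1.mv m) (by omega)))

lemma Bad.f2 {G H : SimpleGraph V} (h : Bad G H) {a b c d : V} (hd : Dst a b c d)
    (h2 : cnt G a b c d = 2) (h3 : cnt (sd G H) a b c d = 2) : Bad (tog G a b c d) H := by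
  have m := mv_of_cnt hd h2
  have h4 := tot_tog (sd G H) hd
  rw [← sd_tog] at h4
  refine ⟨h.1.mv m, fun h5 => h.2.1 (ReflTransGen.head m h5), fun G' H' p q => h.2.2 G' H' p ?_⟩
  omega

/-- red edge -/
def Rd (G H : SimpleGraph V) (x y : V) : Prop := G.Adj x y ∧ ¬ H.Adj x y

lemma Rd.symm {G H : SimpleGraph V} {x y : V} (h : Rd G H x y) : Rd G H y x :=
  ⟨h.1.symm, fun h1 => h.2 h1.symm⟩

lemma Rd.ne {G H : SimpleGraph V} {x y : V} (h : Rd G H x y) : x ≠ y := G.ne_of_adj h.1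

lemma Rd.d {G H : SimpleGraph V} {x y : V} (h : Rd G H x y) : (sd G H).Adj x y := by
  rw [sd_adj]; unfold Rd at h; tauto

lemma Rd.d' {G H : SimpleGraph V} {x y : V} (h : Rd H G x y) : (sd G H).Adj x y := by
  rw [sd_adj]; unfold Rd at h; tauto

lemma d_cases {G H : SimpleGraph V} {x y : V} (h : (sd G H).Adj x y) : Rd G H x y ∨ Rd H G x y := by
  rw [sd_adj] at h; unfold Rd; tauto

/-- adjacent red and blue edges on a 4-cycle -/
lemma Bad.adj {G H : SimpleGraph V} (h : Bad G H) {a b c d : V} (hd : Dst a b c d)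
    (h1 : Rd G H a b) (h2 : Rd H G b c) (h3 : (sd G H).Adj c d ∨ (sd G H).Adj d a) :
    (Rd G H c d ∧ Rd G H d a) ∨ (Rd H G c d ∧ Rd H G d a) := by
  have f := h.f1 hd
  have g := h.swap.f1 hd
  unfold Rd at *
  unfold cnt io at f g
  simp only [sd_adj] at f g h3
  obtain ⟨p1, p2⟩ := h1
  obtain ⟨p3, p4⟩ := h2
  simp only [p1, p2, p3, p4] at f g ⊢
  by_cases q1 : G.Adj c d <;> by_cases q2 : H.Adj c d <;> by_cases q3 : G.Adj d a <;>
    by_cases q4 : H.Adj d a <;> simp [q1, q2, q3, q4] at f g h3 ⊢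

/-- no D-connection -/
def NR (G H : SimpleGraph V) (x y : V) : Prop := ¬ ReflTransGen (sd G H).Adj x y

lemma rtg_sd_symm {G H : SimpleGraph V} {x y : V} (h : ReflTransGen (sd G H).Adj x y) :
    ReflTransGen (sd G H).Adj y x := rtg_symm (fun _ _ h => h.symm) h

lemma C4_not {a b c d x y : V} (h1 : x ≠ a ∨ (y ≠ b ∧ y ≠ d)) (h2 : x ≠ b ∨ (y ≠ a ∧ y ≠ c))
    (h3 : x ≠ c ∨ (y ≠ b ∧ y ≠ d)) (h4 : x ≠ d ∨ (y ≠ a ∧ y ≠ c)) : ¬ C4 a b c d x y := by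
  unfold C4; tauto

lemma tog_of_not {G : SimpleGraph V} {a b c d x y : V} (h : ¬ C4 a b c d x y) :
    (tog G a b c d).Adj x y ↔ G.Adj x y := by
  rw [tog_adj]
  have := G.ne_of_adj (a := x) (b := y)
  tauto

lemma tog_of {G : SimpleGraph V} {a b c d x y : V} (hn : x ≠ y) (h : C4 a b c d x y) :
    (tog G a b c d).Adj x y ↔ ¬ G.Adj x y := by
  rw [tog_adj]
  tauto

/-- Lemma X, first case -/
lemma Bad.x1 {G H : SimpleGraph V} (h : Bad G H) {a b c x y z : V}
    (h1 : Rd G H a b) (h2 : Rd G H b c) (hac : a ≠ c) (h3 : Rd H G x y)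
    (hyz : (sd G H).Adj y z) (hzx : z ≠ x)
    (nab : ∀ u ∈ ({a, b, c} : Finset V), ∀ w ∈ ({x, y, z} : Finset V), u ≠ w ∧ ¬ (sd G H).Adj u w)
    (he : G.Adj a x ↔ G.Adj c x) : False := by
  simp only [Finset.mem_insert, Finset.mem_singleton, forall_eq_or_imp, forall_eq] at nab
  obtain ⟨⟨ax, ay, az⟩, ⟨bx, bY, bz⟩, ⟨cx, cy, cz⟩⟩ := nab
  have hab := h1.ne
  have hbc := h2.ne
  have hxy := h3.ne
  have hyz' := (sd G H).ne_of_adj hyz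
  have dst : Dst a b c x := ⟨hab, hac, ax.1, hbc, bx.1, cx.1⟩
  have dst2 : Dst a x y z := ⟨ax.1, ay.1, az.1, hxy, hzx.symm, hyz'⟩
  have e1 : C4 a b c x a x := by simp [C4]
  have e2 : ¬ C4 a b c x x y := C4_not (by grind) (by grind) (by grind) (by grind)
  have e3 : ¬ C4 a b c x y z := C4_not (by grind) (by grind) (by grind) (by grind)
  have e4 : ¬ C4 a b c x z a := C4_not (by grind) (by grind) (by grind) (by grind)
  have cD : cnt (sd G H) a b c x = 2 := by
    unfold cnt io
    rw [if_pos h1.d, if_pos h2.d, if_neg cx.2, if_neg (fun h => ax.2 h.symm)]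
  have ax2 := ax.2; have cx2 := cx.2; have az2 := az.2
  rw [sd_adj] at ax2 cx2 az2 hyz
  unfold Rd at h1 h2 h3
  by_cases hg : G.Adj a x
  · have hb : Bad H G := h.swap
    have c2 : cnt H a b c x = 2 := by
      unfold cnt io
      rw [if_neg h1.2, if_neg h2.2, if_pos (by grind), if_pos (SimpleGraph.Adj.symm (by grind))]
    rw [sd_comm] at cD
    have b2 := (hb.f2 dst c2 cD).swap
    have := b2.adj dst2 ?_ ?_ (Or.inl ?_)
    · unfold Rd at this
      rw [tog_of_not e3, tog_of_not e4] at this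
      have := G.adj_comm z a; have := H.adj_comm z a; grind
    · unfold Rd; rw [tog_of ax.1 e1]; grind
    · unfold Rd; rw [tog_of_not e2]; grind
    · rw [sd_adj, tog_of_not e3]; exact hyz
  · have c2 : cnt G a b c x = 2 := by
      unfold cnt io
      rw [if_pos h1.1, if_pos h2.1, if_neg (by grind), if_neg (fun h => hg (h.symm))]
    have b2 := h.f2 dst c2 cD
    have := b2.adj dst2 ?_ ?_ (Or.inl ?_)
    · unfold Rd at this
      rw [tog_of_not e3, tog_of_not e4] at this
      have := G.adj_comm z a; have := H.adj_comm z a; grind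
    · unfold Rd; rw [tog_of ax.1 e1]; grind
    · unfold Rd; rw [tog_of_not e2]; grind
    · rw [sd_adj, tog_of_not e3]; exact hyz

/-- Lemma X, second case -/
lemma Bad.x2 {G H : SimpleGraph V} (h : Bad G H) {a b c x y z : V}
    (h1 : Rd G H a b) (h2 : Rd G H b c) (hac : a ≠ c) (h3 : Rd H G x y)
    (hyz : (sd G H).Adj y z) (hzx : z ≠ x)
    (nab : ∀ u ∈ ({a, b, c} : Finset V), ∀ w ∈ ({x, y, z} : Finset V), u ≠ w ∧ ¬ (sd G H).Adj u w) :
    G.Adj c x ↔ G.Adj b y := by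
  simp only [Finset.mem_insert, Finset.mem_singleton, forall_eq_or_imp, forall_eq] at nab
  obtain ⟨⟨ax, ay, az⟩, ⟨bx, bY, bz⟩, ⟨cx, cy, cz⟩⟩ := nab
  have hab := h1.ne
  have hbc := h2.ne
  have hxy := h3.ne
  have hyz' := (sd G H).ne_of_adj hyz
  by_contra he
  have dst : Dst b c x y := ⟨hbc, bx.1, bY.1, cx.1, cy.1, hxy⟩
  have dst2 : Dst a b y z := ⟨hab, ay.1, az.1, bY.1, bz.1, hyz'⟩
  have e1 : ¬ C4 b c x y a b := C4_not (by grind) (by grind) (by grind) (by grind)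
  have e2 : C4 b c x y b y := by simp [C4]
  have e3 : ¬ C4 b c x y y z := C4_not (by grind) (by grind) (by grind) (by grind)
  have e4 : ¬ C4 b c x y z a := C4_not (by grind) (by grind) (by grind) (by grind)
  have cD : cnt (sd G H) b c x y = 2 := by
    unfold cnt io
    rw [if_pos h2.d, if_neg cx.2, if_pos h3.d', if_neg (fun h => bY.2 h.symm)]
  have by2 := bY.2; have cx2 := cx.2; have az2 := az.2
  rw [sd_adj] at by2 cx2 az2 hyz
  unfold Rd at h1 h2 h3
  have sy1 := G.adj_comm y b
  have sy2 := H.adj_comm y b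
  have sy3 := G.adj_comm z a
  have sy4 := H.adj_comm z a
  have c1 : cnt G b c x y = 2 := by
    unfold cnt io
    by_cases hc : G.Adj c x
    · rw [if_pos h2.1, if_pos hc, if_neg h3.2, if_neg (by grind)]
    · rw [if_pos h2.1, if_neg hc, if_neg h3.2, if_pos (by grind)]
  have c2 : cnt H b c x y = 2 := by
    unfold cnt io
    by_cases hc : G.Adj c x
    · rw [if_neg h2.2, if_pos (by grind), if_pos h3.1, if_neg (by grind)]
    · rw [if_neg h2.2, if_neg (by grind), if_pos h3.1, if_pos (by grind)]
  by_cases hg : G.Adj b y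
  · have b2 := h.f2 dst c1 cD
    have := b2.adj dst2 ?_ ?_ (Or.inl ?_)
    · unfold Rd at this
      rw [tog_of_not e3, tog_of_not e4] at this
      grind
    · unfold Rd; rw [tog_of_not e1]; grind
    · unfold Rd; rw [tog_of bY.1 e2]; grind
    · rw [sd_adj, tog_of_not e3]; exact hyz
  · have hb : Bad H G := h.swap
    rw [sd_comm] at cD
    have b2 := (hb.f2 dst c2 cD).swap
    have := b2.adj dst2 ?_ ?_ (Or.inl ?_)
    · unfold Rd at this
      rw [tog_of_not e3, tog_of_not e4] at this
      grind
    · unfold Rd; rw [tog_of_not e1]; grind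
    · unfold Rd; rw [tog_of bY.1 e2]; grind
    · rw [sd_adj, tog_of_not e3]; exact hyz

lemma Bad.x {G H : SimpleGraph V} (h : Bad G H) {a b c x y : V}
    (h1 : Rd G H a b) (h2 : Rd G H b c) (hac : a ≠ c) (h3 : Rd H G x y)
    (hr : NR G H b x) : False := by
  obtain ⟨z, hzx, hyz⟩ := even_other (h.1.even y) h3.d'.symm
  have key : ∀ u w, ReflTransGen (sd G H).Adj b u → ReflTransGen (sd G H).Adj x w →
      u ≠ w ∧ ¬ (sd G H).Adj u w := by
    intro u w hu hw
    refine ⟨?_, fun hd => hr ((hu.tail hd).trans (rtg_sd_symm hw))⟩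
    rintro rfl
    exact hr (hu.trans (rtg_sd_symm hw))
  have ra : ReflTransGen (sd G H).Adj b a := ReflTransGen.single h1.d.symm
  have rc : ReflTransGen (sd G H).Adj b c := ReflTransGen.single h2.d
  have ry : ReflTransGen (sd G H).Adj x y := ReflTransGen.single h3.d'
  have nab : ∀ u ∈ ({a, b, c} : Finset V), ∀ w ∈ ({x, y, z} : Finset V),
      u ≠ w ∧ ¬ (sd G H).Adj u w := by
    intro u hu w hw
    apply key
    · simp only [Finset.mem_insert, Finset.mem_singleton] at hu
      rcases hu with rfl | rfl | rfl
      exacts [ra, ReflTransGen.refl, rc]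
    · simp only [Finset.mem_insert, Finset.mem_singleton] at hw
      rcases hw with rfl | rfl | rfl
      exacts [ReflTransGen.refl, ry, ry.tail hyz]
  have nab' : ∀ u ∈ ({c, b, a} : Finset V), ∀ w ∈ ({x, y, z} : Finset V),
      u ≠ w ∧ ¬ (sd G H).Adj u w := by
    intro u hu; apply nab; simp only [Finset.mem_insert, Finset.mem_singleton] at hu ⊢; tauto
  have e1 := h.x2 h1 h2 hac h3 hyz hzx nab
  have e2 := h.x2 h2.symm h1.symm hac.symm h3 hyz hzx nab'
  exact h.x1 h1 h2 hac h3 hyz hzx nab (e2.trans e1.symm)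

lemma NR.swap {G H : SimpleGraph V} {x y : V} (h : NR G H x y) : NR H G x y := by
  unfold NR at *; rwa [sd_comm]

lemma NR.symm {G H : SimpleGraph V} {x y : V} (h : NR G H x y) : NR G H y x :=
  fun h1 => h (rtg_sd_symm h1)

lemma NR.step {G H : SimpleGraph V} {x y z : V} (h : NR G H x y) (h1 : (sd G H).Adj x z) :
    NR G H z y := fun h2 => h (ReflTransGen.head h1 h2)

/-- all red and blue edges lie in one component -/
lemma Bad.conn {G H : SimpleGraph V} (h : Bad G H) {p q x y : V}
    (h1 : Rd G H p q) (h3 : Rd H G x y) : ReflTransGen (sd G H).Adj p x := by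
  by_contra hr
  change NR G H p x at hr
  obtain ⟨p', hp, hpp⟩ := even_other (h.1.even p) h1.d
  obtain ⟨q', hq, hqq⟩ := even_other (h.1.even q) h1.d.symm
  obtain ⟨x', hx, hxx⟩ := even_other (h.1.even x) h3.d'
  have bp : Rd H G p p' := by
    rcases d_cases hpp with h4 | h4
    · exact (h.x h4.symm h1 hp h3 hr).elim
    · exact h4
  have bq : Rd H G q q' := by
    rcases d_cases hqq with h4 | h4
    · exact (h.x h4.symm h1.symm hq h3 (hr.step h1.d)).elim
    · exact h4
  have bx : Rd G H x x' := by
    rcases d_cases hxx with h4 | h4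
    · exact h4
    · exact (h.swap.x h4.symm h3 hx h1 hr.symm.swap).elim
  have hpq := h1.ne
  by_cases e : p' = q'
  · subst e
    exact h.swap.x bp bq.symm hpq bx (hr.step hpp).swap
  · have := h.adj (a := p) (b := q) (c := q') (d := p')
      ⟨hpq, hq.symm, bp.ne, bq.ne, hp.symm, fun h => e h.symm⟩ h1 bq (Or.inr hpp.symm)
    rcases this with h5 | h5
    · exact h5.2.symm.2 bp.1
    · exact h.swap.x bp h5.1.symm hq.symm bx (hr.step hpp).swap

lemma sum4 {a b c d : V} (h : Dst a b c d) (f : V → ℕ) :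
    ∑ x ∈ ({a, b, c, d} : Finset V), f x = f a + f b + f c + f d := by
  obtain ⟨h1, h2, h3, h4, h5, h6⟩ := h
  rw [Finset.sum_insert (by simp [h1, h2, h3]), Finset.sum_insert (by simp [h4, h5]),
    Finset.sum_insert (by simp [h6]), Finset.sum_singleton]
  omega

end EulSw

namespace EulSw

variable {V : Type*} [Fintype V]

open Relation

lemma Dst.of {a b c d : V} (h1 : a ≠ b) (h2 : a ≠ c) (h3 : a ≠ d) (h4 : b ≠ c) (h5 : b ≠ d)
    (h6 : c ≠ d) : Dst a b c d := ⟨h1, h2, h3, h4, h5, h6⟩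

lemma Rd.not {G H : SimpleGraph V} {x y : V} (h : Rd G H x y) (h' : Rd H G x y) : False :=
  h.2 h'.1

lemma Bad.adjR {G H : SimpleGraph V} (h : Bad G H) {a b c d : V} (hd : Dst a b c d)
    (h1 : Rd G H a b) (h2 : Rd H G b c) (h3 : Rd G H d a) : Rd G H c d := by
  rcases h.adj hd h1 h2 (Or.inr h3.d) with h4 | h4
  · exact h4.1
  · exact (h3.not h4.2).elim

lemma Bad.adjB {G H : SimpleGraph V} (h : Bad G H) {a b c d : V} (hd : Dst a b c d)
    (h1 : Rd G H a b) (h2 : Rd H G b c) (h3 : Rd H G d a) : Rd H G c d := by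
  rcases h.adj hd h1 h2 (Or.inr h3.d') with h4 | h4
  · exact (h3.not h4.2).elim
  · exact h4.1

lemma Bad.adjR' {G H : SimpleGraph V} (h : Bad G H) {a b c d : V} (hd : Dst a b c d)
    (h1 : Rd G H a b) (h2 : Rd H G b c) (h3 : Rd G H c d) : Rd G H d a := by
  rcases h.adj hd h1 h2 (Or.inl h3.d) with h4 | h4
  · exact h4.2
  · exact (h3.not h4.1).elim

lemma Bad.adjB' {G H : SimpleGraph V} (h : Bad G H) {a b c d : V} (hd : Dst a b c d)
    (h1 : Rd G H a b) (h2 : Rd H G b c) (h3 : Rd H G c d) : Rd H G d a := by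
  rcases h.adj hd h1 h2 (Or.inl h3.d') with h4 | h4
  · exact (h3.not h4.1).elim
  · exact h4.2

/-- no blue edge between `Q` and the outside -/
lemma Bad.q1 {G H : SimpleGraph V} (h : Bad G H) {a b c d : V} (hd : Dst a b c d)
    (hab : Rd G H a b) (hbc : Rd G H b c) (hcd : Rd H G c d) (hda : Rd G H d a) {e : V}
    (he : e ≠ a ∧ e ≠ b ∧ e ≠ c ∧ e ≠ d) :
    ¬ Rd H G e a ∧ ¬ Rd H G e b ∧ ¬ Rd H G e c ∧ ¬ Rd H G e d := by
  obtain ⟨e1, e2, e3, e4⟩ := he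
  obtain ⟨d1, d2, d3, d4, d5, d6⟩ := hd
  have nc : ¬ Rd H G e c := by
    intro hc
    have r1 := h.adjR (a := b) (b := c) (c := e) (d := a) (by unfold Dst; grind) hbc hc.symm hab
    have r2 := h.adjR (a := c) (b := b) (c := a) (d := e)
    have r3 := h.adj (a := a) (b := d) (c := c) (d := e) (by unfold Dst; grind) hda.symm hcd.symm
      (Or.inl hc.d'.symm)
    rcases r3 with r | r
    · exact hc.symm.not r.1
    · exact r1.not r.2
  have nd : ¬ Rd H G e d := by
    intro hc
    have r1 := h.adjR (a := a) (b := d) (c := e) (d := b) (by unfold Dst; grind) hda.symm hc.symm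
      hab.symm
    have r3 := h.adj (a := b) (b := c) (c := d) (d := e) (by unfold Dst; grind) hbc hcd
      (Or.inl hc.d'.symm)
    rcases r3 with r | r
    · exact hc.symm.not r.1
    · exact r1.not r.2
  refine ⟨fun hc => ?_, fun hc => ?_, nc, nd⟩
  · exact nc (h.adjB (a := a) (b := d) (c := c) (d := e) (by unfold Dst; grind)
      hda.symm hcd.symm hc).symm
  · exact nd (h.adjB (a := b) (b := c) (c := d) (d := e) (by unfold Dst; grind)
      hbc hcd hc).symm

/-- if `e` outside is joined in D to `Q`, no blue edge at `e`. -/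
lemma Bad.q2 {G H : SimpleGraph V} (h : Bad G H) {a b c d : V} (hd : Dst a b c d)
    (hab : Rd G H a b) (hbc : Rd G H b c) (hcd : Rd H G c d) (hda : Rd G H d a) {e x : V}
    (he : e ≠ a ∧ e ≠ b ∧ e ≠ c ∧ e ≠ d) (hx : x = a ∨ x = b ∨ x = c ∨ x = d)
    (hex : (sd G H).Adj e x) (f : V) : ¬ Rd H G e f := by
  have q := h.q1 hd hab hbc hcd hda he
  have hd' := hd
  obtain ⟨d1, d2, d3, d4, d5, d6⟩ := hd'
  have hex' : Rd G H e x := by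
    rcases d_cases hex with h1 | h1
    · exact h1
    · rcases hx with rfl | rfl | rfl | rfl
      exacts [(q.1 h1).elim, (q.2.1 h1).elim, (q.2.2.1 h1).elim, (q.2.2.2 h1).elim]
  have hh : Rd G H e c ∨ Rd G H e d := by
    rcases hx with rfl | rfl | rfl | rfl
    · exact Or.inl (h.adjR (a := x) (b := d) (c := c) (d := e) (by unfold Dst; grind)
        hda.symm hcd.symm hex').symm
    · exact Or.inr (h.adjR (a := x) (b := c) (c := d) (d := e) (by unfold Dst; grind)
        hbc hcd hex').symm
    · exact Or.inl hex'
    · exact Or.inr hex'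
  intro hf
  have hf' : f ≠ a ∧ f ≠ b ∧ f ≠ c ∧ f ≠ d := by
    refine ⟨?_, ?_, ?_, ?_⟩ <;> rintro rfl <;> tauto
  have qf := h.q1 hd hab hbc hcd hda hf'
  have := hf.ne
  rcases hh with r | r
  · exact qf.2.2.2 (h.adjB (a := c) (b := e) (c := f) (d := d) (by unfold Dst; grind)
      r.symm hf hcd.symm)
  · exact qf.2.2.1 (h.adjB (a := d) (b := e) (c := f) (d := c) (by unfold Dst; grind)
      r.symm hf hcd)

lemma Bad.q {G H : SimpleGraph V} (h : Bad G H) {a b c d : V} (hd : Dst a b c d)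
    (hab : Rd G H a b) (hbc : Rd G H b c) (hcd : Rd H G c d) (hda : Rd G H d a) : False := by
  set Q : V → Prop := fun x => x = a ∨ x = b ∨ x = c ∨ x = d with hQ
  have nq : ∀ e, ¬ Q e → e ≠ a ∧ e ≠ b ∧ e ≠ c ∧ e ≠ d := by
    intro e he; simp only [hQ] at he; tauto
  have q1 : ∀ e x, ¬ Q e → Q x → ¬ Rd H G e x := by
    intro e x he hx
    have := h.q1 hd hab hbc hcd hda (nq e he)
    rcases hx with rfl | rfl | rfl | rfl
    exacts [this.1, this.2.1, this.2.2.1, this.2.2.2]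
  have q2 : ∀ e x, ¬ Q e → Q x → (sd G H).Adj e x → ∀ f, ¬ Rd H G e f := fun e x he hx hex f =>
    h.q2 hd hab hbc hcd hda (nq e he) hx hex f
  have inv : ∀ x, ReflTransGen (sd G H).Adj a x →
      Q x ∨ ((∀ f, ¬ Rd H G x f) ∧ ∀ u, ¬ Q u → (sd G H).Adj x u → ∀ f, ¬ Rd H G u f) := by
    intro x hx
    induction hx with
    | refl => exact Or.inl (Or.inl rfl)
    | @tail x w _ hxw ih =>
      by_cases hw : Q w
      · exact Or.inl hw
      right
      by_cases hqx : Q x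
      · have bw := q2 w x hw hqx hxw.symm
        refine ⟨bw, fun u hu hwu f hf => ?_⟩
        have rwu : Rd G H w u := (d_cases hwu).resolve_right (bw u)
        have rwx : Rd G H w x := (d_cases hxw.symm).resolve_right (bw x)
        have hqf : ¬ Q f := fun hqf => q1 u f hu hqf hf
        have := h.adjR (a := w) (b := u) (c := f) (d := x)
          (Dst.of rwu.ne (by rintro rfl; exact bw u hf.symm) (by rintro rfl; exact hw hqx)
            hf.ne (by rintro rfl; exact hu hqx) (by rintro rfl; exact hqf hqx)) rwu hf rwx.symm
        exact q2 f x hqf hqx this.d u hf.symm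
      · rcases ih with ih | ⟨ih1, ih2⟩
        · exact (hqx ih).elim
        have bw := ih2 w hw hxw
        refine ⟨bw, fun u hu hwu f hf => ?_⟩
        have rwu : Rd G H w u := (d_cases hwu).resolve_right (bw u)
        have rxw : Rd G H x w := (d_cases hxw).resolve_right (ih1 w)
        have hqf : ¬ Q f := fun hqf => q1 u f hu hqf hf
        have := h.adjR (a := w) (b := u) (c := f) (d := x)
          (Dst.of rwu.ne (by rintro rfl; exact bw u hf.symm) (by rintro rfl; exact rxw.ne rfl)
            hf.ne (by rintro rfl; exact ih1 f hf) (by rintro rfl; exact ih1 u hf.symm))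
            rwu hf rxw
        exact ih2 f hqf this.d.symm u hf.symm
  have ball : ∀ x y, Rd H G x y → Q x := by
    intro x y hxy
    have r := h.conn hab hxy
    rcases inv x r with h1 | h1
    · exact h1
    · exact (h1.1 y hxy).elim
  have hd' := hd
  obtain ⟨d1, d2, d3, d4, d5, d6⟩ := hd'
  have hlow : 6 ≤ tot (G \ H) := by
    have s := sum_le_tot (G \ H) {a, b, c, d}
    rw [sum4 hd] at s
    have l1 := le_dg (K := G \ H) (x := a) (S := {b, d}) (by
      simp only [Finset.mem_insert, Finset.mem_singleton, SimpleGraph.sdiff_adj]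
      rintro y (rfl | rfl); exacts [hab, hda.symm])
    have l2 := le_dg (K := G \ H) (x := b) (S := {a, c}) (by
      simp only [Finset.mem_insert, Finset.mem_singleton, SimpleGraph.sdiff_adj]
      rintro y (rfl | rfl); exacts [hab.symm, hbc])
    have l3 := le_dg (K := G \ H) (x := c) (S := {b}) (by
      simp only [Finset.mem_singleton, SimpleGraph.sdiff_adj]
      rintro y rfl; exact hbc.symm)
    have l4 := le_dg (K := G \ H) (x := d) (S := {a}) (by
      simp only [Finset.mem_singleton, SimpleGraph.sdiff_adj]
      rintro y rfl; exact hda)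
    rw [Finset.card_pair d5] at l1
    rw [Finset.card_pair d2] at l2
    rw [Finset.card_singleton] at l3 l4
    omega
  have hup : tot (H \ G) ≤ 4 := by
    rw [tot_eq_sum (Q := {a, b, c, d}) (by
      intro x y hxy
      rw [SimpleGraph.sdiff_adj] at hxy
      have := ball x y hxy
      simpa using this), sum4 hd]
    have nba : ¬ Rd H G b a := fun hh => hab.symm.not hh
    have nbc : ¬ Rd H G b c := fun hh => hbc.not hh
    have nad : ¬ Rd H G a d := fun hh => hda.symm.not hh
    have qq : ∀ x y, (H \ G).Adj x y → Q y ∧ Rd H G x y ∧ x ≠ y := by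
      intro x y hxy
      have hh : Rd H G x y := by rwa [SimpleGraph.sdiff_adj] at hxy
      exact ⟨ball y x hh.symm, hh, hh.ne⟩
    by_cases hac : Rd H G a c
    · have hbd : ¬ Rd H G b d := by
        intro hh
        exact (h.adjR' (a := d) (b := a) (c := c) (d := b) (by unfold Dst; grind)
          hda hac hbc.symm).not hh
      have u1 := dg_le (K := H \ G) (x := a) (S := {c}) (by
        intro y hy
        obtain ⟨h1 | h1 | h1 | h1, h2, h3⟩ := qq _ _ hy <;> subst h1
        · exact (h3 rfl).elim
        · exact (nba h2.symm).elim
        · simp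
        · exact (nad h2).elim)
      have u2 := dg_le (K := H \ G) (x := b) (S := ∅) (by
        intro y hy
        obtain ⟨h1 | h1 | h1 | h1, h2, h3⟩ := qq _ _ hy <;> subst h1
        · exact (nba h2).elim
        · exact (h3 rfl).elim
        · exact (nbc h2).elim
        · exact (hbd h2).elim)
      have u3 := dg_le (K := H \ G) (x := c) (S := {a, d}) (by
        intro y hy
        obtain ⟨h1 | h1 | h1 | h1, h2, h3⟩ := qq _ _ hy <;> subst h1
        · simp
        · exact (nbc h2.symm).elim
        · exact (h3 rfl).elim
        · simp)
      have u4 := dg_le (K := H \ G) (x := d) (S := {c}) (by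
        intro y hy
        obtain ⟨h1 | h1 | h1 | h1, h2, h3⟩ := qq _ _ hy <;> subst h1
        · exact (nad h2.symm).elim
        · exact (hbd h2.symm).elim
        · simp
        · exact (h3 rfl).elim)
      rw [Finset.card_pair d3] at u3
      rw [Finset.card_singleton] at u1 u4
      rw [Finset.card_empty] at u2
      omega
    · have u1 := dg_le (K := H \ G) (x := a) (S := ∅) (by
        intro y hy
        obtain ⟨h1 | h1 | h1 | h1, h2, h3⟩ := qq _ _ hy <;> subst h1
        · exact (h3 rfl).elim
        · exact (nba h2.symm).elim
        · exact (hac h2).elim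
        · exact (nad h2).elim)
      have u2 := dg_le (K := H \ G) (x := b) (S := {d}) (by
        intro y hy
        obtain ⟨h1 | h1 | h1 | h1, h2, h3⟩ := qq _ _ hy <;> subst h1
        · exact (nba h2).elim
        · exact (h3 rfl).elim
        · exact (nbc h2).elim
        · simp)
      have u3 := dg_le (K := H \ G) (x := c) (S := {d}) (by
        intro y hy
        obtain ⟨h1 | h1 | h1 | h1, h2, h3⟩ := qq _ _ hy <;> subst h1
        · exact (hac h2.symm).elim
        · exact (nbc h2.symm).elim
        · exact (h3 rfl).elim
        · simp)
      have u4 := dg_le (K := H \ G) (x := d) (S := {b, c}) (by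
        intro y hy
        obtain ⟨h1 | h1 | h1 | h1, h2, h3⟩ := qq _ _ hy <;> subst h1
        · exact (nad h2.symm).elim
        · simp
        · simp
        · exact (h3 rfl).elim)
      rw [Finset.card_pair d4] at u4
      rw [Finset.card_singleton] at u2 u3
      rw [Finset.card_empty] at u1
      omega
  have := h.1.tots
  omega

/-- Case i -/
lemma Bad.c1 {G H : SimpleGraph V} (h : Bad G H) {a b c d : V} (hd : Dst a b c d)
    (hbc : Rd G H b c) (hcd : Rd H G c d) (hab : (sd G H).Adj a b) : False := by
  have hd' := hd
  obtain ⟨d1, d2, d3, d4, d5, d6⟩ := hd'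
  rcases h.adj hd.rot hbc hcd (Or.inr hab) with ⟨r1, r2⟩ | ⟨r1, r2⟩
  · exact h.q hd r2 hbc hcd r1
  · exact h.swap.q (a := a) (b := d) (c := c) (d := b) (Dst.of d3 d2 d1 d6.symm d5.symm d4.symm)
      r1.symm hcd.symm hbc.symm r2.symm

/-- neighbours of `b` -/
lemma Bad.c1' {G H : SimpleGraph V} (h : Bad G H) {b c d : V} (hbd : b ≠ d)
    (hbc : Rd G H b c) (hcd : Rd H G c d) (y : V) (hy : (sd G H).Adj b y) : y = c ∨ y = d := by
  by_contra hc
  push Not at hc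
  exact h.c1 (a := y) (Dst.of ((sd G H).ne_of_adj hy).symm hc.1 hc.2 hbc.ne hbd hcd.ne)
    hbc hcd hy.symm

lemma Bad.tri {G H : SimpleGraph V} (h : Bad G H) {b c d : V}
    (hbc : Rd G H b c) (hcd : Rd H G c d) (hbd : Rd G H b d) : False := by
  have nb := h.c1' hbd.ne hbc hcd
  have nd : ∀ y, (sd G H).Adj d y → y = c ∨ y = b := by
    have := h.swap.c1' hbd.ne.symm hcd.symm hbc.symm
    rwa [sd_comm] at this
  have nc : ∀ y, (sd G H).Adj c y → y = d ∨ y = b := by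
    have := h.swap.c1' hbc.ne.symm hcd hbd.symm
    rwa [sd_comm] at this
  have inv : ∀ x, ReflTransGen (sd G H).Adj b x → x = b ∨ x = c ∨ x = d := by
    intro x hx
    induction hx with
    | refl => exact Or.inl rfl
    | tail _ h2 ih =>
      rcases ih with rfl | rfl | rfl
      · have := nb _ h2; tauto
      · have := nc _ h2; tauto
      · have := nd _ h2; tauto
  have hlow : 3 ≤ tot (G \ H) := by
    have s := sum_le_tot (G \ H) {b, c}
    rw [Finset.sum_pair hbc.ne] at s
    have l1 := le_dg (K := G \ H) (x := b) (S := {c, d}) (by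
      simp only [Finset.mem_insert, Finset.mem_singleton, SimpleGraph.sdiff_adj]
      rintro y (rfl | rfl); exacts [hbc, hbd])
    have l2 := le_dg (K := G \ H) (x := c) (S := {b}) (by
      simp only [Finset.mem_singleton, SimpleGraph.sdiff_adj]
      rintro y rfl; exact hbc.symm)
    rw [Finset.card_pair hcd.ne] at l1
    rw [Finset.card_singleton] at l2
    omega
  have hup : tot (H \ G) ≤ 2 := by
    have ball : ∀ x y, Rd H G x y → x = c ∨ x = d := by
      intro x y hxy
      rcases inv x (h.conn hbc hxy) with rfl | h1 | h1
      · rcases nb y hxy.d' with rfl | rfl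
        · exact (hbc.not hxy).elim
        · exact (hbd.not hxy).elim
      · exact Or.inl h1
      · exact Or.inr h1
    rw [tot_eq_sum (Q := {c, d}) (by
      intro x y hxy
      rw [SimpleGraph.sdiff_adj] at hxy
      simpa using ball x y hxy), Finset.sum_pair hcd.ne]
    have u1 := dg_le (K := H \ G) (x := c) (S := {d}) (by
        intro y hy
        rw [SimpleGraph.sdiff_adj] at hy
        have hy : Rd H G c y := hy
        rcases ball y c hy.symm with rfl | rfl
        · exact (hy.ne rfl).elim
        · simp)
    have u2 := dg_le (K := H \ G) (x := d) (S := {c}) (by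
        intro y hy
        rw [SimpleGraph.sdiff_adj] at hy
        have hy : Rd H G d y := hy
        rcases ball y d hy.symm with rfl | rfl
        · simp
        · exact (hy.ne rfl).elim)
    rw [Finset.card_singleton] at u1 u2
    omega
  have := h.1.tots
  omega

lemma exists_adj_of_tot {K : SimpleGraph V} (h : tot K ≠ 0) : ∃ x y, K.Adj x y := by
  by_contra hc
  push Not at hc
  apply h
  rw [tot_eq_sum (Q := ∅) (fun x y hxy => (hc x y hxy).elim)]
  rfl

lemma tot_ne_zero {K : SimpleGraph V} {x y : V} (h : K.Adj x y) : tot K ≠ 0 := by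
  have s := sum_le_tot K {x}
  have := le_dg (K := K) (x := x) (S := {y}) (by simpa using h)
  simp at s this
  omega

lemma not_bad {G H : SimpleGraph V} (h : Bad G H) : False := by
  have ex : tot (G \ H) ≠ 0 := by
    intro h0
    have h1 := h.1.tots
    rw [h0] at h1
    apply h.2.1
    have : G = H := by
      ext x y
      by_contra hc
      rcases d_cases (G := G) (H := H) hc with h2 | h2
      · exact tot_ne_zero (K := G \ H) (x := x) (y := y) (by rw [SimpleGraph.sdiff_adj]; exact h2) h0
      · exact tot_ne_zero (K := H \ G) (x := x) (y := y) (by rw [SimpleGraph.sdiff_adj]; exact h2)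
          h1.symm
    rw [this]
  obtain ⟨p, q, hpq⟩ := exists_adj_of_tot ex
  obtain ⟨x, y, hxy⟩ := exists_adj_of_tot (K := H \ G) (by rw [← h.1.tots]; exact ex)
  rw [SimpleGraph.sdiff_adj] at hpq hxy
  have hpq : Rd G H p q := hpq
  have hxy : Rd H G x y := hxy
  have mixed : ∃ c b d, Rd G H b c ∧ Rd H G c d := by
    by_contra hc
    push Not at hc
    have inv : ∀ z, ReflTransGen (sd G H).Adj p z → ∃ w, Rd G H z w := by
      intro z hz
      induction hz with
      | refl => exact ⟨q, hpq⟩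
      | @tail z u _ h2 ih =>
        obtain ⟨w, hw⟩ := ih
        rcases d_cases h2 with h3 | h3
        · exact ⟨z, h3.symm⟩
        · exact (hc z w u hw.symm h3).elim
    obtain ⟨w, hw⟩ := inv x (h.conn hpq hxy)
    exact hc x w y hw.symm hxy
  obtain ⟨c, b, d, hbc, hcd⟩ := mixed
  have hbd : b ≠ d := by rintro rfl; exact hbc.symm.not hcd
  obtain ⟨z, hz, hbz⟩ := even_other (h.1.even b) hbc.d
  rcases h.c1' hbd hbc hcd z hbz with rfl | rfl
  · exact hz rfl
  rcases d_cases hbz with h1 | h1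
  · exact h.tri hbc hcd h1
  · exact h.swap.tri hcd.symm hbc.symm h1.symm

theorem reach_all (G H : SimpleGraph V) (h : Pre G H) : ReflTransGen Mv G H := by
  have key : ∀ n, ∀ G H : SimpleGraph V, Pre G H → tot (sd G H) = n → ReflTransGen Mv G H := by
    intro n
    induction n using Nat.strong_induction_on with
    | _ n ih =>
      intro G H hp hn
      by_contra hc
      exact not_bad ⟨hp, hc, fun G' H' hp' hlt => ih _ (hn ▸ hlt) G' H' hp' rfl⟩
  exact key _ G H h rfl

end EulSw

namespace EulSw

variable {V : Type*} [Fintype V]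

open Relation

/-- connectedness via cuts -/
def Cn (G : SimpleGraph V) : Prop :=
  ∀ X : V → Prop, (∃ x, X x) → (∃ y, ¬ X y) → ∃ x y, X x ∧ ¬ X y ∧ G.Adj x y

/-- Eulerian graphs -/
def Eul (G : SimpleGraph V) : Prop := Cn G ∧ Ev G

/-- a move between Eulerian graphs -/
def Step (G G' : SimpleGraph V) : Prop := Mv G G' ∧ Eul G ∧ Eul G'

def Reach (G G' : SimpleGraph V) : Prop := ReflTransGen Step G G'

lemma Step.symm {G G' : SimpleGraph V} (h : Step G G') : Step G' G := ⟨h.1.symm, h.2.2, h.2.1⟩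

lemma Reach.symm {G G' : SimpleGraph V} (h : Reach G G') : Reach G' G :=
  rtg_symm (fun _ _ h => Step.symm h) h

lemma Reach.trans {G G' G'' : SimpleGraph V} (h : Reach G G') (h' : Reach G' G'') : Reach G G'' :=
  ReflTransGen.trans h h'

lemma Reach.refl (G : SimpleGraph V) : Reach G G := ReflTransGen.refl

lemma Step.reach {G G' : SimpleGraph V} (h : Step G G') : Reach G G' := ReflTransGen.single h

lemma Reach.tot {G G' : SimpleGraph V} (h : Reach G G') : tot G' = tot G := by
  induction h with
  | refl => rfl
  | tail _ h2 ih => rw [h2.1.tot, ih]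

lemma Reach.eul {G G' : SimpleGraph V} (h : Reach G G') (hG : Eul G) : Eul G' := by
  induction h with
  | refl => exact hG
  | tail _ h2 ih => exact h2.2.2

lemma Mv.ev {G G' : SimpleGraph V} (h : Mv G G') (hG : Ev G) : Ev G' :=
  fun x => (h.even x).2 (hG x)

/-- crossing pairs -/
noncomputable def cr (G : SimpleGraph V) (X : V → Prop) : Finset (V × V) :=
  univ.filter (fun p => X p.1 ∧ ¬ X p.2 ∧ G.Adj p.1 p.2)

lemma mem_cr {G : SimpleGraph V} {X : V → Prop} {x y : V} :
    (x, y) ∈ cr G X ↔ X x ∧ ¬ X y ∧ G.Adj x y := by simp [cr]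

/-- restriction of G to X -/
def rst (G : SimpleGraph V) (X : V → Prop) : SimpleGraph V where
  Adj x y := G.Adj x y ∧ X x ∧ X y
  symm := ⟨fun x y h => ⟨h.1.symm, h.2.2, h.2.1⟩⟩
  loopless := ⟨fun x h => G.ne_of_adj h.1 rfl⟩

lemma even_cr {G : SimpleGraph V} (hG : Ev G) (X : V → Prop) : Even (cr G X).card := by
  have h1 : (cr G X).card = ∑ x, ∑ y, io (X x ∧ ¬ X y ∧ G.Adj x y) := by
    unfold cr
    rw [Finset.card_filter, ← Finset.univ_product_univ, Finset.sum_product]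
    refine Finset.sum_congr rfl fun x _ => Finset.sum_congr rfl fun y _ => ?_
    unfold io
    congr
  have h2 : ∑ x, (if X x then dg G x else 0) = tot (rst G X) + (cr G X).card := by
    rw [h1]; unfold tot
    rw [← Finset.sum_add_distrib]
    refine Finset.sum_congr rfl fun x _ => ?_
    rw [dg_eq (rst G X), ← Finset.sum_add_distrib]
    by_cases hx : X x
    · rw [if_pos hx, dg_eq]
      refine Finset.sum_congr rfl fun y _ => ?_
      have : (rst G X).Adj x y ↔ G.Adj x y ∧ X x ∧ X y := Iff.rfl
      simp only [io, this]
      by_cases hy : X y <;> by_cases hg : G.Adj x y <;> simp [hx, hy, hg]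
    · rw [if_neg hx]
      symm
      apply Finset.sum_eq_zero
      intro y _
      have : (rst G X).Adj x y ↔ G.Adj x y ∧ X x ∧ X y := Iff.rfl
      simp [io, this, hx]
  have h3 : Even (∑ x, (if X x then dg G x else 0)) := by
    apply Finset.even_sum
    intro x _
    split_ifs
    · exact hG x
    · exact Even.zero
  rw [h2, tot_eq, Nat.even_iff] at h3
  rw [Nat.even_iff]
  omega

lemma cut_other {G : SimpleGraph V} (hG : Ev G) {X : V → Prop} {p q : V} (hp : X p) (hq : ¬ X q)
    (h : G.Adj p q) : ∃ p' q', X p' ∧ ¬ X q' ∧ G.Adj p' q' ∧ ¬ (p' = p ∧ q' = q) := by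
  by_contra hc
  push Not at hc
  have : cr G X = {(p, q)} := by
    ext ⟨x, y⟩
    rw [mem_cr, Finset.mem_singleton, Prod.mk.injEq]
    constructor
    · rintro ⟨h1, h2, h3⟩; exact hc x y h1 h2 h3
    · rintro ⟨rfl, rfl⟩; exact ⟨hp, hq, h⟩
  have h2 := even_cr hG X
  rw [this, Finset.card_singleton] at h2
  exact absurd h2 (by decide)

lemma rtg_cross {α : Type*} {r : α → α → Prop} {X : α → Prop} {p q : α} (h : ReflTransGen r p q)
    (hp : X p) (hq : ¬ X q) : ∃ x y, X x ∧ ¬ X y ∧ r x y := by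
  induction h with
  | refl => exact (hq hp).elim
  | @tail b c _ h2 ih =>
    by_cases hb : X b
    · exact ⟨b, c, hb, hq, h2⟩
    · exact ih hb

lemma cn_of {G G' : SimpleGraph V} (hG : Cn G)
    (h : ∀ p q, G.Adj p q → ReflTransGen G'.Adj p q) : Cn G' := by
  intro X hx hy
  obtain ⟨x, y, h1, h2, h3⟩ := hG X hx hy
  exact rtg_cross (h x y h3) h1 h2

lemma cn_of_root {G : SimpleGraph V} (r : V) (h : ∀ x, ReflTransGen G.Adj r x) : Cn G := by
  rintro X ⟨x, hx⟩ ⟨y, hy⟩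
  have : ReflTransGen G.Adj x y := (rtg_symm (fun _ _ h => h.symm) (h x)).trans (h y)
  exact rtg_cross this hx hy

lemma cnt_path {G : SimpleGraph V} {a b c d : V}
    (h1 : G.Adj a b) (h2 : G.Adj b c) (h3 : ¬ G.Adj c d) (h4 : ¬ G.Adj d a) :
    cnt G a b c d = 2 := by
  unfold cnt io; rw [if_pos h1, if_pos h2, if_neg h3, if_neg h4]

lemma cnt_alt {G : SimpleGraph V} {a b c d : V}
    (h1 : G.Adj a b) (h2 : ¬ G.Adj b c) (h3 : G.Adj c d) (h4 : ¬ G.Adj d a) :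
    cnt G a b c d = 2 := by
  unfold cnt io; rw [if_pos h1, if_neg h2, if_pos h3, if_neg h4]

lemma step_of {G : SimpleGraph V} {a b c d : V} (hG : Eul G) (hd : Dst a b c d)
    (hc : cnt G a b c d = 2) (hn : Cn (tog G a b c d)) : Step G (tog G a b c d) :=
  ⟨mv_of_cnt hd hc, hG, hn, (mv_of_cnt hd hc).ev hG.2⟩

lemma cn_tog {G : SimpleGraph V} {a b c d : V} (hG : Cn G)
    (h1 : G.Adj a b → ReflTransGen (tog G a b c d).Adj a b)
    (h2 : G.Adj b c → ReflTransGen (tog G a b c d).Adj b c)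
    (h3 : G.Adj c d → ReflTransGen (tog G a b c d).Adj c d)
    (h4 : G.Adj d a → ReflTransGen (tog G a b c d).Adj d a) : Cn (tog G a b c d) := by
  apply cn_of hG
  intro p q hpq
  by_cases hc : C4 a b c d p q
  · have sy : ∀ {x y}, ReflTransGen (tog G a b c d).Adj x y →
        ReflTransGen (tog G a b c d).Adj y x := fun h => rtg_symm (fun _ _ h => h.symm) h
    unfold C4 at hc
    rcases hc with ⟨rfl, rfl⟩ | ⟨rfl, rfl⟩ | ⟨rfl, rfl⟩ | ⟨rfl, rfl⟩ | ⟨rfl, rfl⟩ | ⟨rfl, rfl⟩ |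
      ⟨rfl, rfl⟩ | ⟨rfl, rfl⟩
    exacts [h1 hpq, sy (h1 hpq.symm), h2 hpq, sy (h2 hpq.symm), h3 hpq, sy (h3 hpq.symm),
      h4 hpq, sy (h4 hpq.symm)]
  · exact ReflTransGen.single ((tog_of_not hc).2 hpq)

lemma stepP {G : SimpleGraph V} {a b c d : V} (hG : Eul G) (hd : Dst a b c d)
    (h1 : G.Adj a b) (h2 : G.Adj b c) (h3 : ¬ G.Adj c d) (h4 : ¬ G.Adj d a)
    (r1 : ReflTransGen (tog G a b c d).Adj a b) (r2 : ReflTransGen (tog G a b c d).Adj b c) :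
    Step G (tog G a b c d) :=
  step_of hG hd (cnt_path h1 h2 h3 h4) (cn_tog hG.1 (fun _ => r1) (fun _ => r2)
    (fun h => (h3 h).elim) (fun h => (h4 h).elim))

lemma stepA {G : SimpleGraph V} {a b c d : V} (hG : Eul G) (hd : Dst a b c d)
    (h1 : G.Adj a b) (h2 : ¬ G.Adj b c) (h3 : G.Adj c d) (h4 : ¬ G.Adj d a)
    (r1 : ReflTransGen (tog G a b c d).Adj a b) (r2 : ReflTransGen (tog G a b c d).Adj c d) :
    Step G (tog G a b c d) :=
  step_of hG hd (cnt_alt h1 h2 h3 h4) (cn_tog hG.1 (fun _ => r1) (fun h => (h2 h).elim)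
    (fun _ => r2) (fun h => (h4 h).elim))

/-- information from a bad shift -/
lemma bad_shift {G : SimpleGraph V} (hG : Eul G) {p b q y : V} (hd : Dst p b q y)
    (h1 : G.Adj b p) (h2 : G.Adj b q) (h3 : ¬ G.Adj p y) (h4 : ¬ G.Adj q y)
    (hn : ¬ Cn (tog G p b q y)) :
    ∃ X : V → Prop, X b ∧ ¬ X p ∧ ¬ X q ∧ ¬ X y ∧
      ∀ u w, X u → ¬ X w → G.Adj u w → u = b ∧ (w = p ∨ w = q) := by
  have key : ∃ X : V → Prop, X b ∧ (∃ z, ¬ X z) ∧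
      ∀ u w, X u → ¬ X w → ¬ (tog G p b q y).Adj u w := by
    unfold Cn at hn
    push Not at hn
    obtain ⟨X, hx, hy, hh⟩ := hn
    by_cases hb : X b
    · exact ⟨X, hb, hy, hh⟩
    · refine ⟨fun z => ¬ X z, hb, ?_, ?_⟩
      · obtain ⟨x, hx⟩ := hx; exact ⟨x, not_not.2 hx⟩
      · intro u w hu hw hadj
        exact hh w u (not_not.1 hw) hu hadj.symm
  obtain ⟨X, hb, ⟨z, hz⟩, hh⟩ := key
  have hdd := hd
  obtain ⟨d1, d2, d3, d4, d5, d6⟩ := hdd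
  have hqy : (tog G p b q y).Adj q y := (tog_of d6 (by simp [C4])).2 h4
  have hpy : (tog G p b q y).Adj p y := (tog_of d3 (by simp [C4])).2 h3
  have h3' : ¬ G.Adj y p := fun h => h3 h.symm
  have h4' : ¬ G.Adj y q := fun h => h4 h.symm
  have cross : ∀ u w, X u → ¬ X w → G.Adj u w →
      (u = b ∧ w = p) ∨ (u = p ∧ w = b) ∨ (u = b ∧ w = q) ∨ (u = q ∧ w = b) := by
    intro u w hu hw huw
    by_contra hc
    apply hh u w hu hw
    rw [tog_of_not]
    · exact huw
    · unfold C4; grind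
  have cross' : ∀ u w, X u → ¬ X w → G.Adj u w → u = b ∧ (w = p ∨ w = q) := by
    intro u w hu hw huw
    rcases cross u w hu hw huw with h | h | h | h <;> grind
  obtain ⟨u, w, hu, hw, huw⟩ := hG.1 X ⟨b, hb⟩ ⟨z, hz⟩
  obtain ⟨u', w', hu', hw', huw', hne⟩ := cut_other hG.2 hu hw huw
  obtain ⟨rfl, e1⟩ := cross' u w hu hw huw
  obtain ⟨rfl, e2⟩ := cross' u' w' hu' hw' huw'
  have hp : ¬ X p := by grind
  have hq : ¬ X q := by grind
  refine ⟨X, hb, hp, hq, fun hy => hh y q hy hq hqy.symm, cross'⟩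

lemma exists_third {S : Finset V} (h : 2 < S.card) (p q : V) : ∃ r ∈ S, r ≠ p ∧ r ≠ q := by
  by_contra hc
  push Not at hc
  have : S ⊆ {p, q} := by
    intro r hr
    by_cases h1 : r = p
    · simp [h1]
    · simp [hc r hr h1]
  have h1 := Finset.card_le_card this
  have h2 := Finset.card_le_two (a := p) (b := q)
  omega

lemma shift {G : SimpleGraph V} (hG : Eul G) {b y : V} (hby : b ≠ y) (hdeg : 4 ≤ dg G b)
    {p q : V} (hpq : p ≠ q) (hp : G.Adj b p) (hq : G.Adj b q) (hpy : p ≠ y) (hqy : q ≠ y)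
    (hp' : ¬ G.Adj p y) (hq' : ¬ G.Adj q y) :
    ∃ p q, p ≠ q ∧ G.Adj b p ∧ G.Adj b q ∧ p ≠ y ∧ q ≠ y ∧ ¬ G.Adj p y ∧ ¬ G.Adj q y ∧
      Dst p b q y ∧ Step G (tog G p b q y) := by
  have dst : Dst p b q y := ⟨(G.ne_of_adj hp).symm, hpq, hpy, G.ne_of_adj hq, hby, hqy⟩
  have sy : ∀ {x y}, ¬ G.Adj x y → ¬ G.Adj y x := fun h h' => h h'.symm
  by_cases hc : Cn (tog G p b q y)
  · exact ⟨p, q, hpq, hp, hq, hpy, hqy, hp', hq', dst,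
      step_of hG dst (cnt_path hp.symm hq hq' (sy hp')) hc⟩
  obtain ⟨X, xb, xp, xq, xy, hX⟩ := bad_shift hG dst hp hq hp' hq' hc
  obtain ⟨r, hr, rp, rq⟩ := exists_third (S := univ.filter (fun z => G.Adj b z))
    (by unfold dg at hdeg; omega) p q
  have hbr : G.Adj b r := by simpa using hr
  have xr : X r := by
    by_contra h
    have := hX b r xb h hbr
    grind
  have ry : r ≠ y := by rintro rfl; exact xy xr
  have hr' : ¬ G.Adj r y := by
    intro h
    have := (hX r y xr xy h).1
    exact G.ne_of_adj hbr this.symm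
  have dst' : Dst p b r y := ⟨(G.ne_of_adj hp).symm, rp.symm, hpy, G.ne_of_adj hbr, hby, ry⟩
  by_cases hc' : Cn (tog G p b r y)
  · exact ⟨p, r, rp.symm, hp, hbr, hpy, ry, hp', hr', dst',
      step_of hG dst' (cnt_path hp.symm hbr hr' (sy hp')) hc'⟩
  exfalso
  obtain ⟨X', xb', xp', xr', xy', hX'⟩ := bad_shift hG dst' hp hbr hp' hr' hc'
  have xq' : X' q := by
    by_contra h
    have := hX' b q xb' h hq
    grind
  obtain ⟨u, w, hu, hw, huw, hne⟩ := cut_other hG.2 (X := fun z => X' z ∧ ¬ X z) (p := q) (q := b)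
    ⟨xq', xq⟩ (fun h => h.2 xb) hq.symm
  by_cases hxw : X w
  · have := hX w u hxw hu.2 huw.symm
    rcases this with ⟨rfl, rfl | rfl⟩
    · exact xp' hu.1
    · exact hne ⟨rfl, rfl⟩
  · have hw' : ¬ X' w := fun h => hw ⟨h, hxw⟩
    have := (hX' u w hu.1 hw' huw).1
    subst this
    exact hu.2 xb

/-- common closed neighbours -/
noncomputable def cc (G : SimpleGraph V) (v y : V) : Finset V :=
  univ.filter (fun z => G.Adj v z ∧ (z = y ∨ G.Adj z y))

lemma dg_pos {G : SimpleGraph V} (hG : Eul G) {v y : V} (h : v ≠ y) : 2 ≤ dg G v := by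
  obtain ⟨x, w, hx, hw, hxw⟩ := hG.1 (fun z => z = v) ⟨v, rfl⟩ ⟨y, h.symm⟩
  subst hx
  have h1 := le_dg (K := G) (x := x) (S := {w}) (by simpa using hxw)
  have h2 := hG.2 x
  rw [Finset.card_singleton] at h1
  rw [Nat.even_iff] at h2
  omega

lemma d2 {v y : V} (hvy : v ≠ y) : ∀ (n : ℕ) (G : SimpleGraph V), dg G v = n → Eul G →
    (cc G v y).card ≤ 2 → ∃ G', Reach G G' ∧ dg G' v = 2 := by
  intro n
  induction n using Nat.strong_induction_on with
  | _ n ih =>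
    intro G hn hG hc
    have h2 := dg_pos hG hvy
    have hev := hG.2 v
    rw [Nat.even_iff] at hev
    by_cases h : dg G v = 2
    · exact ⟨G, Reach.refl G, h⟩
    have h4 : 4 ≤ dg G v := by omega
    have : 1 < ((univ.filter (fun z => G.Adj v z)) \ cc G v y).card := by
      have := Finset.le_card_sdiff (cc G v y) (univ.filter (fun z => G.Adj v z))
      unfold dg at h4
      omega
    obtain ⟨p, hp, q, hq, hpq⟩ := Finset.one_lt_card.1 this
    simp only [cc, Finset.mem_sdiff, Finset.mem_filter, Finset.mem_univ, true_and] at hp hq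
    obtain ⟨p, q, hpq, h1, h2, h3, h4, h5, h6, hd, hs⟩ := shift hG hvy h4 hpq hp.1 hq.1
      (fun h => hp.2 ⟨hp.1, Or.inl h⟩) (fun h => hq.2 ⟨hq.1, Or.inl h⟩)
      (fun h => hp.2 ⟨hp.1, Or.inr h⟩) (fun h => hq.2 ⟨hq.1, Or.inr h⟩)
    have hdg : dg (tog G p v q y) v + 2 = dg G v := by
      have := dg_tog G hd.rot
      rw [← tog_rot] at this
      unfold io at this
      rw [if_pos h2, if_pos h1] at this
      omega
    have hsub : cc (tog G p v q y) v y ⊆ cc G v y := by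
      intro z hz
      simp only [cc, Finset.mem_filter, Finset.mem_univ, true_and] at hz ⊢
      obtain ⟨d1, d2, d3, d4, d5, d6⟩ := hd
      have hzp : z ≠ p := by
        rintro rfl
        exact (tog_of d1.symm (by simp [C4])).1 hz.1 h1
      have hzq : z ≠ q := by
        rintro rfl
        exact (tog_of d4 (by simp [C4])).1 hz.1 h2
      have hv : G.Adj v z := by
        refine (tog_of_not ?_).1 hz.1
        unfold C4; grind
      refine ⟨hv, ?_⟩
      rcases hz.2 with h | h
      · exact Or.inl h
      · right
        refine (tog_of_not ?_).1 h
        unfold C4; grind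
    obtain ⟨G', r, e⟩ := ih (dg (tog G p v q y) v) (by omega) (tog G p v q y) rfl hs.2.2
      ((Finset.card_le_card hsub).trans hc)
    exact ⟨G', hs.reach.trans r, e⟩

lemma mv_cut {G G' : SimpleGraph V} (h : Mv G G') {X : V → Prop}
    (hX : ∀ x y, X x → ¬ X y → ¬ G'.Adj x y) : (cr G X).card ≤ 2 := by
  obtain ⟨a, b, c, d, hd, rfl, h1⟩ := h
  have key : ∀ x y, (x, y) ∈ cr G X → C4 a b c d x y ∧ X x ∧ ¬ X y ∧ G.Adj x y := by
    intro x y hxy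
    rw [mem_cr] at hxy
    refine ⟨?_, hxy⟩
    by_contra hc
    exact hX x y hxy.1 hxy.2.1 ((tog_of_not hc).2 hxy.2.2)
  have sy := fun x y => G.adj_comm x y
  rcases h1 with ⟨h1, h2, h3, h4⟩ | ⟨h1, h2, h3, h4⟩
  · refine (Finset.card_le_card (t := {if X a then (a, b) else (b, a),
      if X b then (b, c) else (c, b)}) ?_).trans Finset.card_le_two
    rintro ⟨x, y⟩ hxy
    obtain ⟨k, kx, ky, kg⟩ := key x y hxy
    simp only [Finset.mem_insert, Finset.mem_singleton]
    unfold C4 at k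
    rcases k with ⟨rfl, rfl⟩ | ⟨rfl, rfl⟩ | ⟨rfl, rfl⟩ | ⟨rfl, rfl⟩ | ⟨rfl, rfl⟩ | ⟨rfl, rfl⟩ |
      ⟨rfl, rfl⟩ | ⟨rfl, rfl⟩
    · left; rw [if_pos kx]
    · left; rw [if_neg ky]
    · right; rw [if_pos kx]
    · right; rw [if_neg ky]
    · exact (h3 kg).elim
    · exact (h3 kg.symm).elim
    · exact (h4 kg).elim
    · exact (h4 kg.symm).elim
  · refine (Finset.card_le_card (t := {if X a then (a, b) else (b, a),
      if X c then (c, d) else (d, c)}) ?_).trans Finset.card_le_two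
    rintro ⟨x, y⟩ hxy
    obtain ⟨k, kx, ky, kg⟩ := key x y hxy
    simp only [Finset.mem_insert, Finset.mem_singleton]
    unfold C4 at k
    rcases k with ⟨rfl, rfl⟩ | ⟨rfl, rfl⟩ | ⟨rfl, rfl⟩ | ⟨rfl, rfl⟩ | ⟨rfl, rfl⟩ | ⟨rfl, rfl⟩ |
      ⟨rfl, rfl⟩ | ⟨rfl, rfl⟩
    · left; rw [if_pos kx]
    · left; rw [if_neg ky]
    · exact (h3 kg).elim
    · exact (h3 kg.symm).elim
    · right; rw [if_pos kx]
    · right; rw [if_neg ky]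
    · exact (h4 kg).elim
    · exact (h4 kg.symm).elim

lemma cc_le {G : SimpleGraph V} {X : V → Prop} {v y : V} (hv : X v) (hy : ¬ X y)
    (h : (cr G X).card ≤ 2) : (cc G v y).card ≤ 2 := by
  refine (Finset.card_le_card_of_injOn (fun z => if X z then (z, y) else (v, z)) ?_ ?_).trans h
  · intro z hz
    simp only [cc, Finset.coe_filter, Finset.mem_univ, true_and, Set.mem_ofPred_eq] at hz
    show (if X z then (z, y) else (v, z)) ∈ (cr G X : Set (V × V))
    rw [Finset.mem_coe]
    split_ifs with hx
    · rw [mem_cr]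
      refine ⟨hx, hy, ?_⟩
      rcases hz.2 with rfl | h
      · exact (hy hx).elim
      · exact h
    · rw [mem_cr]
      exact ⟨hv, hx, hz.1⟩
  · intro z hz w hw hzw
    simp only [cc, Finset.coe_filter, Finset.mem_univ, true_and, Set.mem_ofPred_eq] at hz hw
    have n1 := G.ne_of_adj hz.1
    have n2 := G.ne_of_adj hw.1
    simp only at hzw
    split_ifs at hzw <;> simp only [Prod.mk.injEq] at hzw <;> grind

lemma nonrigid {G H : SimpleGraph V} (hG : Eul G) (hH : Eul H) (ht : tot G = tot H)
    (hn : ¬ Reach G H) (v : V) : ∃ G', Reach G G' ∧ dg G' v = 2 := by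
  by_cases hr : ∀ G1, Reach G G1 → ∀ G2, Mv G1 G2 → Cn G2
  · exfalso
    apply hn
    have key : ∀ K, ReflTransGen Mv G K → Reach G K := by
      intro K hK
      induction hK with
      | refl => exact Reach.refl G
      | tail _ h2 ih =>
        have e := ih.eul hG
        exact ih.trans (Step.reach ⟨h2, e, hr _ ih _ h2, h2.ev e.2⟩)
    exact key H (reach_all G H ⟨fun x => ⟨fun _ => hH.2 x, fun _ => hG.2 x⟩, ht⟩)
  · push Not at hr
    obtain ⟨G1, r, G2, m, hc⟩ := hr
    unfold Cn at hc
    push Not at hc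
    obtain ⟨X, ⟨x, hx⟩, ⟨y, hy⟩, hh⟩ := hc
    have e := r.eul hG
    have : ∃ w, v ≠ w ∧ (cc G1 v w).card ≤ 2 := by
      by_cases hv : X v
      · exact ⟨y, by rintro rfl; exact hy hv, cc_le hv hy (mv_cut m hh)⟩
      · refine ⟨x, by rintro rfl; exact hv hx, cc_le (X := fun z => ¬ X z) hv (not_not.2 hx)
          (mv_cut m ?_)⟩
        intro u w hu hw hadj
        exact hh w u (not_not.1 hw) hu hadj.symm
    obtain ⟨w, hw, hcc⟩ := this
    obtain ⟨G', r', e'⟩ := d2 hw _ G1 rfl e hcc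
    exact ⟨G', r.trans r', e'⟩

lemma reach_of_all_cn {G H : SimpleGraph V} (hG : Eul G) (hH : Eul H) (ht : tot G = tot H)
    (hn : ¬ Reach G H) : ∃ J : SimpleGraph V, Ev J ∧ ¬ Cn J ∧ tot J = tot G := by
  by_contra hc
  push Not at hc
  apply hn
  have key : ∀ K, ReflTransGen Mv G K → Reach G K := by
    intro K hK
    induction hK with
    | refl => exact Reach.refl G
    | tail _ h2 ih =>
      have e := ih.eul hG
      refine ih.trans (Step.reach ⟨h2, e, ?_, h2.ev e.2⟩)
      by_contra h
      exact hc _ (h2.ev e.2) h (by rw [h2.tot, ih.tot])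
  exact key H (reach_all G H ⟨fun x => ⟨fun _ => hH.2 x, fun _ => hG.2 x⟩, ht⟩)

end EulSw

namespace EulSw

variable {V : Type*} [Fintype V]

open Relation

/-- subdivide the edge `a c` by `v` -/
def Sub {v : V} (J : SimpleGraph {x : V // x ≠ v}) (a c : {x : V // x ≠ v}) : SimpleGraph V where
  Adj x y := (∃ hx : x ≠ v, ∃ hy : y ≠ v, J.Adj ⟨x, hx⟩ ⟨y, hy⟩ ∧
      ¬ (((⟨x, hx⟩ : {x : V // x ≠ v}) = a ∧ (⟨y, hy⟩ : {x : V // x ≠ v}) = c) ∨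
        ((⟨x, hx⟩ : {x : V // x ≠ v}) = c ∧ (⟨y, hy⟩ : {x : V // x ≠ v}) = a))) ∨
    (x = v ∧ (y = a.1 ∨ y = c.1)) ∨ (y = v ∧ (x = a.1 ∨ x = c.1))
  symm := ⟨by
    rintro x y (⟨hx, hy, h1, h2⟩ | h | h)
    · exact Or.inl ⟨hy, hx, h1.symm, by tauto⟩
    · exact Or.inr (Or.inr h)
    · exact Or.inr (Or.inl h)⟩
  loopless := ⟨by
    rintro x (⟨hx, hy, h1, h2⟩ | ⟨h, h1⟩ | ⟨h, h1⟩)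
    · exact J.ne_of_adj h1 rfl
    · have := a.2; have := c.2; rcases h1 with h1 | h1 <;> simp_all
    · have := a.2; have := c.2; rcases h1 with h1 | h1 <;> simp_all⟩

variable {v : V}

lemma sub_adj {J : SimpleGraph {x : V // x ≠ v}} {a c : {x : V // x ≠ v}}
    (x y : {x : V // x ≠ v}) : (Sub J a c).Adj x.1 y.1 ↔
      J.Adj x y ∧ ¬ ((x = a ∧ y = c) ∨ (x = c ∧ y = a)) := by
  constructor
  · rintro (⟨hx, hy, h1, h2⟩ | ⟨h, h1⟩ | ⟨h, h1⟩)
    · exact ⟨h1, h2⟩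
    · exact (x.2 h).elim
    · exact (y.2 h).elim
  · rintro ⟨h1, h2⟩
    exact Or.inl ⟨x.2, y.2, h1, h2⟩

lemma sub_v {J : SimpleGraph {x : V // x ≠ v}} {a c : {x : V // x ≠ v}}
    (y : {x : V // x ≠ v}) : (Sub J a c).Adj v y.1 ↔ y = a ∨ y = c := by
  constructor
  · rintro (⟨hx, hy, h1, h2⟩ | ⟨h, h1⟩ | ⟨h, h1⟩)
    · exact (hx rfl).elim
    · exact h1.imp Subtype.ext Subtype.ext
    · exact (y.2 h).elim
  · intro h
    exact Or.inr (Or.inl ⟨rfl, h.imp (congrArg _) (congrArg _)⟩)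

lemma ext_v {K K' : SimpleGraph V} (v : V)
    (h1 : ∀ x y : {x : V // x ≠ v}, K.Adj x.1 y.1 ↔ K'.Adj x.1 y.1)
    (h2 : ∀ y : {x : V // x ≠ v}, K.Adj v y.1 ↔ K'.Adj v y.1) : K = K' := by
  ext x y
  by_cases hx : x = v
  · subst hx
    by_cases hy : y = x
    · subst hy; simp
    · exact h2 ⟨y, hy⟩
  · by_cases hy : y = v
    · subst hy
      rw [K.adj_comm, K'.adj_comm]
      exact h2 ⟨x, hx⟩
    · exact h1 ⟨x, hx⟩ ⟨y, hy⟩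

lemma sub_comm (J : SimpleGraph {x : V // x ≠ v}) (a c : {x : V // x ≠ v}) :
    Sub J a c = Sub J c a := by
  apply ext_v v
  · intro x y; rw [sub_adj, sub_adj]; tauto
  · intro y; rw [sub_v, sub_v]; tauto

lemma dg_sub {J : SimpleGraph {x : V // x ≠ v}} {a c : {x : V // x ≠ v}} (hac : J.Adj a c)
    (x : {x : V // x ≠ v}) : dg (Sub J a c) x.1 = dg J x := by
  have hn := J.ne_of_adj hac
  rw [dg_eq, dg_eq, Fintype.sum_eq_add_sum_subtype_ne _ v]
  have e : ∀ y : {x : V // x ≠ v}, io ((Sub J a c).Adj x.1 y.1) +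
      ((if y = c then io (x = a) else 0) + (if y = a then io (x = c) else 0)) = io (J.Adj x y) := by
    intro y
    have hac' := hac.symm
    have e2 : io ((Sub J a c).Adj x.1 y.1) =
      io (J.Adj x y ∧ ¬ ((x = a ∧ y = c) ∨ (x = c ∧ y = a))) := by rw [sub_adj]
    rw [e2]
    unfold io
    by_cases h1 : x = a
    · subst h1
      by_cases h2 : y = c
      · subst h2; simp [hac, hn, hn.symm]
      · simp [h2, hn]
    · by_cases h3 : x = c
      · subst h3
        by_cases h2 : y = a
        · subst h2; simp [hac', hn, hn.symm]
        · simp [h2, h1]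
      · simp [h1, h3]
  have s := Finset.sum_congr (rfl : (univ : Finset {x : V // x ≠ v}) = univ) (fun y _ => e y)
  simp only [Finset.sum_add_distrib, Finset.sum_ite_eq', Finset.mem_univ, if_true] at s
  have e3 : io ((Sub J a c).Adj x.1 v) = io (x = a) + io (x = c) := by
    have : (Sub J a c).Adj x.1 v ↔ x = a ∨ x = c := by rw [SimpleGraph.adj_comm, sub_v]
    unfold io
    rw [if_congr this rfl rfl]
    by_cases h1 : x = a
    · subst h1; simp [hn]
    · simp [h1]
  rw [← s, e3]
  omega

lemma dg_sub_v {J : SimpleGraph {x : V // x ≠ v}} {a c : {x : V // x ≠ v}} (hac : J.Adj a c) :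
    dg (Sub J a c) v = 2 := by
  have hn : a.1 ≠ c.1 := fun h => J.ne_of_adj hac (Subtype.ext h)
  have h1 := dg_le (K := Sub J a c) (x := v) (S := {a.1, c.1}) (by
    rintro y (⟨hx, hy, h1, h2⟩ | ⟨h, h1⟩ | ⟨h, h1⟩)
    · exact (hx rfl).elim
    · simpa using h1
    · exact (h1.elim (fun h => a.2 h.symm) (fun h => c.2 h.symm)).elim)
  have h2 := le_dg (K := Sub J a c) (x := v) (S := {a.1, c.1}) (by
    intro y hy
    simp only [Finset.mem_insert, Finset.mem_singleton] at hy
    rcases hy with rfl | rfl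
    · exact (sub_v a).2 (Or.inl rfl)
    · exact (sub_v c).2 (Or.inr rfl))
  rw [Finset.card_pair hn] at h1 h2
  omega

lemma tot_sub {J : SimpleGraph {x : V // x ≠ v}} {a c : {x : V // x ≠ v}} (hac : J.Adj a c) :
    tot (Sub J a c) = tot J + 2 := by
  unfold tot
  rw [Fintype.sum_eq_add_sum_subtype_ne _ v, dg_sub_v hac, add_comm]
  congr 1
  exact Finset.sum_congr rfl fun x _ => dg_sub hac x

lemma ev_sub {J : SimpleGraph {x : V // x ≠ v}} {a c : {x : V // x ≠ v}} (hac : J.Adj a c) :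
    Ev (Sub J a c) ↔ Ev J := by
  constructor
  · intro h x
    rw [← dg_sub hac x]; exact h x.1
  · intro h x
    by_cases hx : x = v
    · subst hx; rw [dg_sub_v hac]; decide
    · have := dg_sub hac ⟨x, hx⟩
      simp only at this
      rw [this]; exact h _

lemma cn_sub {J : SimpleGraph {x : V // x ≠ v}} {a c : {x : V // x ≠ v}} (hac : J.Adj a c) :
    Cn (Sub J a c) ↔ Cn J := by
  constructor
  · intro h X ⟨x, hx⟩ ⟨y, hy⟩
    set Y : V → Prop := fun z => (z = v ∧ X a) ∨ (∃ h : z ≠ v, X ⟨z, h⟩) with hY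
    have Yc : ∀ z : {x : V // x ≠ v}, Y z.1 ↔ X z := by
      intro z
      constructor
      · rintro (h | ⟨_, h⟩)
        · exact (z.2 h.1).elim
        · exact h
      · intro h; exact Or.inr ⟨z.2, h⟩
    have Yv : Y v ↔ X a := by
      constructor
      · rintro (h | ⟨h, _⟩)
        · exact h.2
        · exact (h rfl).elim
      · intro h; exact Or.inl ⟨rfl, h⟩
    obtain ⟨p, q, hp, hq, hpq⟩ := h Y ⟨x.1, (Yc x).2 hx⟩ ⟨y.1, fun h => hy ((Yc y).1 h)⟩
    by_cases hpv : p = v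
    · subst hpv
      have hqp : q ≠ p := by rintro rfl; exact hq hp
      have : (⟨q, hqp⟩ : {x : V // x ≠ p}) = a ∨ (⟨q, hqp⟩ : {x : V // x ≠ p}) = c :=
        (sub_v ⟨q, hqp⟩).1 hpq
      have hq' := (not_congr (Yc ⟨q, hqp⟩)).1 hq
      rw [Yv] at hp
      rcases this with h | h
      · rw [h] at hq'; exact (hq' hp).elim
      · rw [h] at hq'; exact ⟨a, c, hp, hq', hac⟩
    · by_cases hqv : q = v
      · subst hqv
        have : (⟨p, hpv⟩ : {x : V // x ≠ q}) = a ∨ (⟨p, hpv⟩ : {x : V // x ≠ q}) = c :=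
          (sub_v ⟨p, hpv⟩).1 hpq.symm
        have hp' := (Yc ⟨p, hpv⟩).1 hp
        rw [Yv] at hq
        rcases this with h | h
        · rw [h] at hp'; exact (hq hp').elim
        · rw [h] at hp'; exact ⟨c, a, hp', hq, hac.symm⟩
      · exact ⟨⟨p, hpv⟩, ⟨q, hqv⟩, (Yc ⟨p, hpv⟩).1 hp, fun h => hq ((Yc ⟨q, hqv⟩).2 h),
          ((sub_adj ⟨p, hpv⟩ ⟨q, hqv⟩).1 hpq).1⟩
  · intro h X ⟨x, hx⟩ ⟨y, hy⟩
    have va : (Sub J a c).Adj v a.1 := (sub_v a).2 (Or.inl rfl)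
    have vc : (Sub J a c).Adj v c.1 := (sub_v c).2 (Or.inr rfl)
    by_cases h1 : ∃ x : {x : V // x ≠ v}, X x.1
    · by_cases h2 : ∃ y : {x : V // x ≠ v}, ¬ X y.1
      · obtain ⟨p, q, hp, hq, hpq⟩ := h (fun z => X z.1) h1 h2
        by_cases e : (p = a ∧ q = c) ∨ (p = c ∧ q = a)
        · by_cases hv : X v
          · refine ⟨v, q.1, hv, hq, (sub_v q).2 ?_⟩
            tauto
          · refine ⟨p.1, v, hp, hv, ((sub_v p).2 ?_).symm⟩
            tauto
        · exact ⟨p.1, q.1, hp, hq, (sub_adj p q).2 ⟨hpq, e⟩⟩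
      · push Not at h2
        have hyv : y = v := by
          by_contra hyv; exact hy (h2 ⟨y, hyv⟩)
        subst hyv
        exact ⟨a.1, y, h2 a, hy, va.symm⟩
    · push Not at h1
      have hxv : x = v := by
        by_contra hxv; exact h1 ⟨x, hxv⟩ hx
      subst hxv
      exact ⟨x, a.1, hx, h1 a, va⟩

lemma eul_sub {J : SimpleGraph {x : V // x ≠ v}} {a c : {x : V // x ≠ v}} (hac : J.Adj a c) :
    Eul (Sub J a c) ↔ Eul J := and_congr (cn_sub hac) (ev_sub hac)

lemma sub_r1 {J : SimpleGraph {x : V // x ≠ v}} {a c d : {x : V // x ≠ v}} (hJ : Eul J)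
    (hac : J.Adj a c) (hcd : J.Adj c d) (had : a ≠ d) : Step (Sub J a c) (Sub J c d) := by
  have nac := J.ne_of_adj hac
  have ncd := J.ne_of_adj hcd
  have nv : ∀ z : {x : V // x ≠ v}, z.1 ≠ v := fun z => z.2
  have inj : ∀ z w : {x : V // x ≠ v}, z ≠ w → z.1 ≠ w.1 := fun z w h h' => h (Subtype.ext h')
  have dst : Dst a.1 v d.1 c.1 := ⟨nv a, inj _ _ had, inj _ _ nac, (nv d).symm, (nv c).symm,
    inj _ _ ncd.symm⟩
  have e : Sub J c d = tog (Sub J a c) a.1 v d.1 c.1 := by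
    apply ext_v v
    · intro x y
      rw [tog_adj, sub_adj, sub_adj]
      have hc : C4 a.1 v d.1 c.1 x.1 y.1 ↔
        ((x = d ∧ y = c) ∨ (x = c ∧ y = d) ∨ (x = c ∧ y = a) ∨ (x = a ∧ y = c)) := by
        unfold C4
        simp only [Subtype.ext_iff]
        have := x.2; have := y.2
        grind
      rw [hc]
      have h1 : x.1 ≠ y.1 ↔ x ≠ y := by rw [Ne, Ne, Subtype.ext_iff]
      rw [h1]
      have := J.ne_of_adj (a := x) (b := y)
      have := hac.symm
      have := hcd.symm
      grind
    · intro y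
      rw [tog_adj, sub_v, sub_v]
      have hc : C4 a.1 v d.1 c.1 v y.1 ↔ (y = a ∨ y = d) := by
        unfold C4
        simp only [Subtype.ext_iff]
        have := a.2; have := c.2; have := d.2; have := y.2
        grind
      rw [hc]
      have := y.2
      grind
  refine ⟨?_, (eul_sub hac).2 hJ, (eul_sub hcd).2 hJ⟩
  rw [e]
  apply mv_of_cnt dst
  apply cnt_alt
  · exact ((sub_v a).2 (Or.inl rfl)).symm
  · rw [sub_v]; rintro (h | h)
    · exact had h.symm
    · exact ncd h.symm
  · rw [sub_adj]; refine ⟨hcd.symm, ?_⟩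
    rintro (h | h)
    · exact had h.1.symm
    · exact ncd h.1.symm
  · rw [sub_adj]; tauto

lemma sub_r2 {J : SimpleGraph {x : V // x ≠ v}} {a c : {x : V // x ≠ v}} (hJ : Eul J)
    (hac : J.Adj a c) : ∀ x y, J.Adj x y → Reach (Sub J a c) (Sub J x y) := by
  have ha : ∀ y, J.Adj a y → Reach (Sub J a c) (Sub J a y) := by
    intro y hy
    by_cases e : y = c
    · subst e; exact Reach.refl _
    · rw [sub_comm J a c]
      exact (sub_r1 hJ hac.symm hy (fun h => e h.symm)).reach
  intro x
  by_contra hx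
  obtain ⟨p, q, hp, hq, hpq⟩ := hJ.1 (fun x => ∀ y, J.Adj x y → Reach (Sub J a c) (Sub J x y))
    ⟨a, ha⟩ ⟨x, hx⟩
  apply hq
  intro y hy
  by_cases e : y = p
  · subst e; rw [sub_comm J q y]; exact hp q hpq
  · exact (hp q hpq).trans (sub_r1 hJ hpq hy (fun h => e h.symm)).reach

lemma sub_r3 {J J' : SimpleGraph {x : V // x ≠ v}} (h : Step J J') :
    ∃ a c, J.Adj a c ∧ J'.Adj a c ∧ Step (Sub J a c) (Sub J' a c) := by
  obtain ⟨m, hJ, hJ'⟩ := h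
  obtain ⟨p, q, r, s, hd, rfl, hh⟩ := m
  have hpq : J.Adj p q := by tauto
  have hsp : ¬ J.Adj s p := by tauto
  have hcnt : cnt J p q r s = 2 := by
    rcases hh with h | h
    · exact cnt_path h.1 h.2.1 h.2.2.1 h.2.2.2
    · exact cnt_alt h.1 h.2.2.1 h.2.1 h.2.2.2
  obtain ⟨t, htq, hpt⟩ := even_other (hJ.2 p) hpq
  have hts : t ≠ s := by rintro rfl; exact hsp hpt.symm
  have hpt' := J.ne_of_adj hpt
  have hd' := hd
  obtain ⟨d1, d2, d3, d4, d5, d6⟩ := hd'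
  have nC : ¬ C4 p q r s p t := C4_not (by grind) (by grind) (by grind) (by grind)
  have hptJ : (tog J p q r s).Adj p t := (tog_of_not nC).2 hpt
  have inj : ∀ z w : {x : V // x ≠ v}, z ≠ w → z.1 ≠ w.1 := fun z w h h' => h (Subtype.ext h')
  have dst : Dst p.1 q.1 r.1 s.1 := ⟨inj _ _ d1, inj _ _ d2, inj _ _ d3, inj _ _ d4, inj _ _ d5,
    inj _ _ d6⟩
  refine ⟨p, t, hpt, hptJ, ?_, (eul_sub hpt).2 hJ, (eul_sub hptJ).2 hJ'⟩
  have e : Sub (tog J p q r s) p t = tog (Sub J p t) p.1 q.1 r.1 s.1 := by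
    apply ext_v v
    · intro x y
      rw [tog_adj, sub_adj, sub_adj, tog_adj]
      have hc : C4 p.1 q.1 r.1 s.1 x.1 y.1 ↔ C4 p q r s x y := by
        unfold C4
        simp only [Subtype.ext_iff]
      rw [hc]
      have h1 : x.1 ≠ y.1 ↔ x ≠ y := by rw [Ne, Ne, Subtype.ext_iff]
      rw [h1]
      have nC2 : ¬ C4 p q r s t p := C4_not (by grind) (by grind) (by grind) (by grind)
      by_cases e1 : x = p ∧ y = t
      · obtain ⟨rfl, rfl⟩ := e1; simp [nC]
      · by_cases e2 : x = t ∧ y = p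
        · obtain ⟨rfl, rfl⟩ := e2; simp [nC2]
        · simp [e1, e2]
    · intro y
      rw [tog_adj, sub_v, sub_v]
      have hc : ¬ C4 p.1 q.1 r.1 s.1 v y.1 := by
        have := p.2; have := q.2; have := r.2; have := s.2
        unfold C4
        grind
      have := y.2.symm
      simp only [hc]
      tauto
  rw [e]
  apply mv_of_cnt dst
  rw [← hcnt]
  unfold cnt
  have f1 : (Sub J p t).Adj p.1 q.1 ↔ J.Adj p q := by rw [sub_adj]; grind
  have f2 : (Sub J p t).Adj q.1 r.1 ↔ J.Adj q r := by rw [sub_adj]; grind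
  have f3 : (Sub J p t).Adj r.1 s.1 ↔ J.Adj r s := by rw [sub_adj]; grind
  have f4 : (Sub J p t).Adj s.1 p.1 ↔ J.Adj s p := by rw [sub_adj]; grind
  rw [f1, f2, f3, f4]

lemma sub_reach {J J' : SimpleGraph {x : V // x ≠ v}} (hJ : Eul J) (h : Reach J J') :
    ∀ a c a' c', J.Adj a c → J'.Adj a' c' → Reach (Sub J a c) (Sub J' a' c') := by
  induction h with
  | refl => exact fun a c a' c' h h' => sub_r2 hJ h _ _ h'
  | @tail K L h1 h2 ih =>
    intro a c a' c' h h'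
    obtain ⟨p, q, hpq, hpq', hs⟩ := sub_r3 h2
    exact (ih a c p q h hpq).trans (hs.reach.trans (sub_r2 h2.2.2 hpq' _ _ h'))

def Vgood (G : SimpleGraph V) (v : V) : Prop :=
  ∃ a c, a ≠ c ∧ ¬ G.Adj a c ∧ G.Adj v a ∧ G.Adj v c ∧ ∀ y, G.Adj v y → y = a ∨ y = c

lemma vgood_sub {G : SimpleGraph V} (h : Vgood G v) :
    ∃ (J : SimpleGraph {x : V // x ≠ v}) (a c : {x : V // x ≠ v}), J.Adj a c ∧ G = Sub J a c := by
  obtain ⟨a, c, hac, nac, hva, hvc, hy⟩ := h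
  have av := (G.ne_of_adj hva).symm
  have cv := (G.ne_of_adj hvc).symm
  let a' : {x : V // x ≠ v} := ⟨a, av⟩
  let c' : {x : V // x ≠ v} := ⟨c, cv⟩
  have hac' : a' ≠ c' := fun h => hac (congrArg Subtype.val h)
  let J : SimpleGraph {x : V // x ≠ v} :=
    { Adj := fun x y => G.Adj x.1 y.1 ∨ (x = a' ∧ y = c') ∨ (x = c' ∧ y = a')
      symm := ⟨by
        rintro x y (h | h | h)
        · exact Or.inl h.symm
        · exact Or.inr (Or.inr ⟨h.2, h.1⟩)
        · exact Or.inr (Or.inl ⟨h.2, h.1⟩)⟩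
      loopless := ⟨by
        rintro x (h | h | h)
        · exact G.ne_of_adj h rfl
        · exact hac' (h.1.symm.trans h.2)
        · exact hac' (h.2.symm.trans h.1)⟩ }
  have hJ : ∀ x y, J.Adj x y ↔ G.Adj x.1 y.1 ∨ (x = a' ∧ y = c') ∨ (x = c' ∧ y = a') :=
    fun x y => Iff.rfl
  refine ⟨J, a', c', Or.inr (Or.inl ⟨rfl, rfl⟩), ?_⟩
  apply ext_v v
  · intro x y
    rw [sub_adj, hJ]
    have n1 : x = a' ∧ y = c' → ¬ G.Adj x.1 y.1 := by rintro ⟨rfl, rfl⟩; exact nac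
    have n2 : x = c' ∧ y = a' → ¬ G.Adj x.1 y.1 := by
      rintro ⟨rfl, rfl⟩; exact fun h => nac h.symm
    tauto
  · intro y
    rw [sub_v]
    constructor
    · intro h
      exact (hy y.1 h).imp (fun h => Subtype.ext h) (fun h => Subtype.ext h)
    · rintro (rfl | rfl)
      · exact hva
      · exact hvc

lemma reach_of_vgood {G H : SimpleGraph V}
    (ih : ∀ J J' : SimpleGraph {x : V // x ≠ v}, Eul J → Eul J' → tot J = tot J' → Reach J J')
    (hG : Eul G) (hH : Eul H) (ht : tot G = tot H) (h1 : Vgood G v) (h2 : Vgood H v) :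
    Reach G H := by
  obtain ⟨J, a, c, hac, rfl⟩ := vgood_sub h1
  obtain ⟨J', a', c', hac', rfl⟩ := vgood_sub h2
  rw [tot_sub hac, tot_sub hac'] at ht
  exact sub_reach ((eul_sub hac).1 hG) (ih J J' ((eul_sub hac).1 hG) ((eul_sub hac').1 hH)
    (by omega)) _ _ _ _ hac hac'

end EulSw

namespace EulSw

variable {V : Type*} [Fintype V]

open Relation

/-- the neighbours of `v` are exactly `a` and `c` -/
def NV (G : SimpleGraph V) (v a c : V) : Prop :=
  a ≠ c ∧ G.Adj v a ∧ G.Adj v c ∧ ∀ y, G.Adj v y → y = a ∨ y = c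

/-- no graph reachable from `G` is good at `v` -/
def Stuck (G : SimpleGraph V) (v : V) : Prop := Eul G ∧ ∀ G', Reach G G' → ¬ Vgood G' v

lemma NV.symm {G : SimpleGraph V} {v a c : V} (h : NV G v a c) : NV G v c a :=
  ⟨h.1.symm, h.2.2.1, h.2.1, fun y hy => (h.2.2.2 y hy).symm⟩

lemma Stuck.reach {G G' : SimpleGraph V} {v : V} (h : Stuck G v) (r : Reach G G') : Stuck G' v :=
  ⟨r.eul h.1, fun G'' r' => h.2 G'' (r.trans r')⟩

lemma NV.tog {G : SimpleGraph V} {v a c p q r s : V} (h : NV G v a c) (hp : v ≠ p) (hq : v ≠ q)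
    (hr : v ≠ r) (hs : v ≠ s) : NV (tog G p q r s) v a c := by
  have k : ∀ y, (EulSw.tog G p q r s).Adj v y ↔ G.Adj v y := by
    intro y
    apply tog_of_not
    unfold C4; grind
  refine ⟨h.1, (k a).2 h.2.1, (k c).2 h.2.2.1, fun y hy => h.2.2.2 y ((k y).1 hy)⟩

lemma Stuck.adj {G : SimpleGraph V} {v a c : V} (h : Stuck G v) (hn : NV G v a c) : G.Adj a c := by
  by_contra hc
  exact h.2 G (Reach.refl G) ⟨a, c, hn.1, hc, hn.2.1, hn.2.2.1, hn.2.2.2⟩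

lemma rt2 {K : SimpleGraph V} {x y z : V} (h1 : K.Adj x y) (h2 : K.Adj y z) :
    ReflTransGen K.Adj x z := (ReflTransGen.single h1).tail h2

lemma rt4 {K : SimpleGraph V} {x y z u w : V} (h1 : K.Adj x y) (h2 : K.Adj y z) (h3 : K.Adj z u)
    (h4 : K.Adj u w) : ReflTransGen K.Adj x w := ((rt2 h1 h2).tail h3).tail h4

lemma Stuck.i {G : SimpleGraph V} {v a c x y : V} (h : Stuck G v) (hn : NV G v a c)
    (hx : x ≠ v ∧ x ≠ a ∧ x ≠ c) (hy : y ≠ v ∧ y ≠ a ∧ y ≠ c) (hxy : G.Adj x y)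
    (hax : ¬ G.Adj a x) (hcy : ¬ G.Adj c y) : False := by
  have hac := h.adj hn
  have nxy := G.ne_of_adj hxy
  have nva := G.ne_of_adj hn.2.1
  have nvc := G.ne_of_adj hn.2.2.1
  have nac := hn.1
  have dst : Dst a c y x := by unfold Dst; grind
  have hn' : NV (tog G a c y x) v a c := hn.tog nva nvc (by grind) (by grind)
  have k1 : (tog G a c y x).Adj c y := (tog_of (by grind) (by simp [C4])).2 hcy
  have k2 : (tog G a c y x).Adj x a :=
    (tog_of (by grind) (by simp [C4])).2 (fun h => hax h.symm)
  have k3 : ¬ (tog G a c y x).Adj a c := by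
    rw [tog_of nac (by simp [C4])]; exact not_not.2 hac
  have st : Step G (tog G a c y x) := stepA h.1 dst hac hcy hxy.symm (fun h => hax h.symm)
    (rt2 hn'.2.1.symm hn'.2.2.1) (rt4 k1.symm hn'.2.2.1.symm hn'.2.1 k2.symm)
  exact k3 ((h.reach st.reach).adj hn')

lemma Stuck.ii {G : SimpleGraph V} {v a c x y : V} (h : Stuck G v) (hn : NV G v a c)
    (hy : y ≠ v ∧ y ≠ a ∧ y ≠ c) (hya : ¬ G.Adj y a) (hx : x ≠ v ∧ x ≠ a) (hcx : G.Adj c x)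
    (hxy : x ≠ y) : G.Adj x y := by
  by_contra hc
  have hac := h.adj hn
  have nva := G.ne_of_adj hn.2.1
  have nvc := G.ne_of_adj hn.2.2.1
  have ncx := G.ne_of_adj hcx
  have nac := hn.1
  have dst : Dst a c x y := by unfold Dst; grind
  have hn' : NV (tog G a c x y) v a c := hn.tog nva nvc (by grind) (by grind)
  have k1 : (tog G a c x y).Adj x y := (tog_of (by grind) (by simp [C4])).2 hc
  have k2 : (tog G a c x y).Adj y a := (tog_of (by grind) (by simp [C4])).2 hya
  have k3 : ¬ (tog G a c x y).Adj a c := by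
    rw [tog_of nac (by simp [C4])]; exact not_not.2 hac
  have st : Step G (tog G a c x y) := stepP h.1 dst hac hcx hc hya
    (rt2 hn'.2.1.symm hn'.2.2.1) (rt4 hn'.2.2.1.symm hn'.2.1 k2.symm k1.symm)
  exact k3 ((h.reach st.reach).adj hn')

lemma exists_max {α : Type*} (P : α → Prop) (f : α → ℕ) (N : ℕ) (hb : ∀ x, f x ≤ N)
    (h : ∃ x, P x) : ∃ x, P x ∧ ∀ y, P y → f y ≤ f x := by
  have key : ∀ k, ∀ x, P x → N - f x = k → ∃ x, P x ∧ ∀ y, P y → f y ≤ f x := by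
    intro k
    induction k using Nat.strong_induction_on with
    | _ k ih =>
      intro x hx hk
      by_cases hc : ∀ y, P y → f y ≤ f x
      · exact ⟨x, hx, hc⟩
      · push Not at hc
        obtain ⟨y, hy, hlt⟩ := hc
        have := hb y
        exact ih (N - f y) (by omega) y hy rfl
  obtain ⟨x, hx⟩ := h
  exact key _ x hx rfl

lemma exists_min {α : Type*} (P : α → Prop) (f : α → ℕ)
    (h : ∃ x, P x) : ∃ x, P x ∧ ∀ y, P y → f x ≤ f y := by
  have key : ∀ k, ∀ x, P x → f x = k → ∃ x, P x ∧ ∀ y, P y → f x ≤ f y := by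
    intro k
    induction k using Nat.strong_induction_on with
    | _ k ih =>
      intro x hx hk
      by_cases hc : ∀ y, P y → f x ≤ f y
      · exact ⟨x, hx, hc⟩
      · push Not at hc
        obtain ⟨y, hy, hlt⟩ := hc
        exact ih (f y) (by omega) y hy rfl
  obtain ⟨x, hx⟩ := h
  exact key _ x hx rfl

lemma dg_le_card (G : SimpleGraph V) (x : V) : dg G x ≤ Fintype.card V := by
  unfold dg; exact Finset.card_le_univ _

/-- nonneighbours -/
noncomputable def nn (G : SimpleGraph V) (x : V) : Finset V :=
  univ.filter (fun y => y ≠ x ∧ ¬ G.Adj x y)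

lemma mem_nn {G : SimpleGraph V} {x y : V} : y ∈ nn G x ↔ y ≠ x ∧ ¬ G.Adj x y := by simp [nn]

lemma nn_card (G : SimpleGraph V) (x : V) : (nn G x).card + dg G x + 1 = Fintype.card V := by
  have h1 : nn G x = (univ.filter (fun y => ¬ G.Adj x y)).erase x := by
    ext y; simp [nn]
  have h2 := Finset.card_filter_add_card_filter_not (s := (univ : Finset V)) (fun y => G.Adj x y)
  have h3 : (nn G x).card + 1 = (univ.filter (fun y => ¬ G.Adj x y)).card := by
    rw [h1]; exact Finset.card_erase_add_one (by simp)
  unfold dg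
  rw [Finset.card_univ] at h2
  omega

/-- number of complementary darts -/
noncomputable def sK (G : SimpleGraph V) : ℕ := ∑ x, (nn G x).card

lemma sK_eq (G : SimpleGraph V) :
    sK G + tot G + Fintype.card V = Fintype.card V * Fintype.card V := by
  have := Finset.sum_congr (rfl : (univ : Finset V) = univ) (fun x _ => nn_card G x)
  simp only [Finset.sum_add_distrib, Finset.sum_const, Finset.card_univ, smul_eq_mul, mul_one] at this
  exact this

lemma Reach.sK {G G' : SimpleGraph V} (r : Reach G G') : sK G' = sK G := by
  have h1 := sK_eq G
  have h2 := sK_eq G'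
  rw [r.tot] at h2
  omega

lemma four_le_dg {G : SimpleGraph V} {x p q r s : V} (hd : Dst p q r s) (hp : G.Adj x p)
    (hq : G.Adj x q) (hr : G.Adj x r) (hs : G.Adj x s) : 4 ≤ dg G x := by
  obtain ⟨d1, d2, d3, d4, d5, d6⟩ := hd
  have := le_dg (K := G) (x := x) (S := {p, q, r, s}) (by
    intro y hy
    simp only [Finset.mem_insert, Finset.mem_singleton] at hy
    rcases hy with rfl | rfl | rfl | rfl <;> assumption)
  have e : ({p, q, r, s} : Finset V).card = 4 := by
    rw [Finset.card_insert_of_notMem (by simp [d1, d2, d3]),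
      Finset.card_insert_of_notMem (by simp [d4, d5]), Finset.card_pair d6]
  omega

/-- after maximizing the degree of `a` it has at most one non-neighbour -/
lemma Stuck.max {G0 : SimpleGraph V} {v : V} (h0 : Stuck G0 v) (h2 : dg G0 v = 2) :
    ∃ G a c, Reach G0 G ∧ NV G v a c ∧
      ∀ s s', s ≠ a → s' ≠ a → ¬ G.Adj s a → ¬ G.Adj s' a → s = s' := by
  have ex : ∃ t : SimpleGraph V × V × V, Reach G0 t.1 ∧ NV t.1 v t.2.1 t.2.2 := by
    unfold dg at h2
    obtain ⟨a, c, hac, he⟩ := Finset.card_eq_two.1 h2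
    have k : ∀ y, G0.Adj v y ↔ y = a ∨ y = c := by
      intro y
      have : y ∈ univ.filter (fun y => G0.Adj v y) ↔ y = a ∨ y = c := by rw [he]; simp
      simpa using this
    exact ⟨(G0, a, c), Reach.refl _, hac, (k a).2 (Or.inl rfl), (k c).2 (Or.inr rfl),
      fun y hy => (k y).1 hy⟩
  obtain ⟨⟨G, a, c⟩, ⟨r, hn⟩, hmax⟩ := exists_max _ (fun t => dg t.1 t.2.1) (Fintype.card V)
    (fun t => dg_le_card _ _) ex
  simp only at r hn hmax
  refine ⟨G, a, c, r, hn, ?_⟩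
  have h := h0.reach r
  have hac := h.adj hn
  have nva := G.ne_of_adj hn.2.1
  have nvc := G.ne_of_adj hn.2.2.1
  have nac := hn.1
  have st2 : ∀ b, b ≠ a → b ≠ v → 4 ≤ dg G b → ∀ p q, p ≠ q → G.Adj b p → G.Adj b q → p ≠ a →
      q ≠ a → ¬ G.Adj p a → ¬ G.Adj q a → False := by
    intro b hba hbv hdeg p q hpq hp hq hpa hqa hp' hq'
    obtain ⟨p, q, hpq, hp, hq, hpa, hqa, hp', hq', dst, st⟩ :=
      shift h.1 hba hdeg hpq hp hq hpa hqa hp' hq'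
    have hvp : v ≠ p := by rintro rfl; exact hp' hn.2.1
    have hvq : v ≠ q := by rintro rfl; exact hq' hn.2.1
    have hn' := hn.tog hvp hbv.symm hvq nva
    have := hmax (tog G p b q a, a, c) ⟨r.trans st.reach, hn'⟩
    simp only at this
    have e := dg_tog G dst.rot.rot.rot
    rw [← tog_rot, ← tog_rot, ← tog_rot] at e
    unfold io at e
    rw [if_neg (fun h => hp' h.symm), if_neg (fun h => hq' h.symm)] at e
    omega
  intro s s' hsa hsa' hs hs'
  by_contra hss
  have hsv : s ≠ v := by rintro rfl; exact hs hn.2.1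
  have hsv' : s' ≠ v := by rintro rfl; exact hs' hn.2.1
  have hsc : s ≠ c := by rintro rfl; exact hs hac.symm
  have hsc' : s' ≠ c := by rintro rfl; exact hs' hac.symm
  have hcp := dg_pos h.1 nac.symm
  have hce := h.1.2 c
  rw [Nat.even_iff] at hce
  by_cases hc2 : dg G c = 2
  · -- N(c) = {v, a}
    have nc : ∀ y, G.Adj c y → y = v ∨ y = a := by
      intro y hy
      by_contra hc
      push Not at hc
      have := le_dg (K := G) (x := c) (S := {y, v, a}) (by
        intro z hz
        simp only [Finset.mem_insert, Finset.mem_singleton] at hz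
        rcases hz with rfl | rfl | rfl
        exacts [hy, hn.2.2.1.symm, hac.symm])
      rw [Finset.card_insert_of_notMem (by simp [hc.1, hc.2]), Finset.card_pair nva] at this
      omega
    have hsp := dg_pos h.1 hsa
    obtain ⟨t, ht⟩ : ∃ t, G.Adj s t := by
      by_contra hc
      push Not at hc
      have := dg_le (K := G) (x := s) (S := ∅) (fun y hy => (hc y hy).elim)
      simp at this
      omega
    have hta : t ≠ a := by rintro rfl; exact hs ht
    have htv : t ≠ v := by
      rintro rfl
      rcases hn.2.2.2 s ht.symm with h | h
      · exact hsa h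
      · exact hsc h
    have htc : t ≠ c := by
      rintro rfl
      rcases nc s ht.symm with h | h
      · exact hsv h
      · exact hsa h
    refine h.i hn ⟨hsv, hsa, hsc⟩ ⟨htv, hta, htc⟩ ht (fun h => hs h.symm) ?_
    intro hct
    rcases nc t hct with h | h
    · exact htv h
    · exact hta h
  · have hc4 : 4 ≤ dg G c := by omega
    have : ∃ p, G.Adj c p ∧ p ≠ v ∧ p ≠ a ∧ G.Adj p a := by
      by_contra hcon
      push Not at hcon
      have hcard : 1 < (((univ.filter (fun z => G.Adj c z)).erase v).erase a).card := by
        have e1 := Finset.pred_card_le_card_erase (s := univ.filter (fun z => G.Adj c z)) (a := v)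
        have e2 := Finset.pred_card_le_card_erase
          (s := (univ.filter (fun z => G.Adj c z)).erase v) (a := a)
        unfold dg at hc4
        omega
      obtain ⟨p, hp, q, hq, hpq⟩ := Finset.one_lt_card.1 hcard
      simp only [Finset.mem_erase, Finset.mem_filter, Finset.mem_univ, true_and] at hp hq
      exact st2 c nac.symm nvc.symm hc4 p q hpq hp.2.2 hq.2.2 hp.1 hq.1
        (hcon p hp.2.2 hp.2.1 hp.1) (hcon q hq.2.2 hq.2.1 hq.1)
    obtain ⟨p, hcp, hpv, hpa, hpa'⟩ := this
    have hps : p ≠ s := by rintro rfl; exact hs hpa'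
    have hps' : p ≠ s' := by rintro rfl; exact hs' hpa'
    have k1 := h.ii hn ⟨hsv, hsa, hsc⟩ hs ⟨hpv, hpa⟩ hcp hps
    have k2 := h.ii hn ⟨hsv', hsa', hsc'⟩ hs' ⟨hpv, hpa⟩ hcp hps'
    have h4 : 4 ≤ dg G p := four_le_dg (p := a) (q := c) (r := s) (s := s')
      (by unfold Dst; grind) hpa' hcp.symm k1 k2
    exact st2 p hpa hpv h4 s s' hss k1 k2 hsa hsa' hs hs'

end EulSw

namespace EulSw

variable {V : Type*} [Fintype V]

open Relation

lemma nadj {G : SimpleGraph V} {x y : V} (h : ¬ G.Adj x y) : ¬ G.Adj y x := fun h' => h h'.symm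

lemma Stuck.tog2 {G : SimpleGraph V} {v a c y y' : V} (h : Stuck G v) (hn : NV G v a c)
    (hy : y ≠ v ∧ y ≠ a ∧ y ≠ c) (hy' : y' ≠ v ∧ y' ≠ a ∧ y' ≠ c) (hyy : y ≠ y')
    (h1 : G.Adj y a) (h2 : G.Adj y' a) (h3 : ¬ G.Adj y c) (h4 : ¬ G.Adj y' c) :
    Step G (tog G y a y' c) ∧ NV (tog G y a y' c) v a c ∧ (tog G y a y' c).Adj y c ∧
      ¬ (tog G y a y' c).Adj y a ∧
      ∀ p q, ¬ C4 y a y' c p q → ((tog G y a y' c).Adj p q ↔ G.Adj p q) := by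
  have hac := h.adj hn
  have nva := G.ne_of_adj hn.2.1
  have nvc := G.ne_of_adj hn.2.2.1
  have nac := hn.1
  have dst : Dst y a y' c := by unfold Dst; grind
  have k1 : (tog G y a y' c).Adj y c := (tog_of (by grind) (by simp [C4])).2 h3
  have k2 : (tog G y a y' c).Adj y' c := (tog_of (by grind) (by simp [C4])).2 h4
  have k3 : (tog G y a y' c).Adj c a := (tog_of_not (by unfold C4; grind)).2 hac.symm
  have k4 : ¬ (tog G y a y' c).Adj y a := by
    rw [tog_of (by grind) (by simp [C4])]; exact not_not.2 h1
  exact ⟨stepP h.1 dst h1 h2.symm h4 (nadj h3) (rt2 k1 k3) (rt2 k3.symm k2.symm),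
    hn.tog hy.1.symm nva hy'.1.symm nvc, k1, k4, fun p q hpq => tog_of_not hpq⟩

lemma Stuck.odd {G0 : SimpleGraph V} {v : V} (h0 : Stuck G0 v) (h2 : dg G0 v = 2)
    (hodd : ¬ Even (Fintype.card V)) (hs : 3 * Fintype.card V ≤ sK G0 + 3) : False := by
  have ex : ∃ t : SimpleGraph V × V × V, Reach G0 t.1 ∧ NV t.1 v t.2.1 t.2.2 ∧
      ∀ x, x ≠ t.2.1 → t.1.Adj x t.2.1 := by
    obtain ⟨G, a, c, r, hn, hu⟩ := h0.max h2
    refine ⟨(G, a, c), r, hn, ?_⟩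
    intro x hx
    by_contra hxa
    have h := h0.reach r
    have e1 := nn_card G a
    have e2 := h.1.2 a
    have e3 : nn G a = {x} := by
      ext z
      rw [mem_nn, Finset.mem_singleton]
      constructor
      · intro hz; exact hu z x hz.1 hx (nadj hz.2) hxa
      · rintro rfl; exact ⟨hx, nadj hxa⟩
    rw [e3, Finset.card_singleton] at e1
    rw [Nat.even_iff] at e2 hodd
    omega
  obtain ⟨⟨G, a, c⟩, ⟨r, hn, hu⟩, hmin⟩ := exists_min _ (fun t => dg t.1 t.2.2) ex
  simp only at r hn hmin hu
  have h := h0.reach r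
  have hac := h.adj hn
  have nva := G.ne_of_adj hn.2.1
  have nvc := G.ne_of_adj hn.2.2.1
  have nac := hn.1
  have ad : ∀ y, y ≠ v ∧ y ≠ c → ¬ G.Adj y c → ∀ x, x ≠ v → x ≠ c → x ≠ y → G.Adj x y := by
    intro y hy hyc x hxv hxc hxy
    have hya : y ≠ a := by rintro rfl; exact hyc hac
    by_cases hxa : x = a
    · subst hxa; exact (hu y hya).symm
    · exact h.ii hn.symm ⟨hy.1, hy.2, hya⟩ hyc ⟨hxv, hxc⟩ (hu x hxa).symm hxy
  have nnc : ∀ y, y ∈ nn G c → y ≠ v ∧ y ≠ a ∧ y ≠ c ∧ ¬ G.Adj y c := by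
    intro y hy
    rw [mem_nn] at hy
    refine ⟨?_, ?_, hy.1, nadj hy.2⟩
    · rintro rfl; exact hy.2 hn.2.2.1.symm
    · rintro rfl; exact hy.2 hac.symm
  have hY : (nn G c).card ≤ 2 := by
    by_contra hc
    push Not at hc
    obtain ⟨y, hy, -, -⟩ := exists_third hc a a
    obtain ⟨y', hy', hyy, -⟩ := exists_third hc y y
    obtain ⟨y'', hy'', hyy1, hyy2⟩ := exists_third hc y y'
    have e := nnc y hy
    have e' := nnc y' hy'
    have e'' := nnc y'' hy''
    obtain ⟨st, hn', k1, k2, k3⟩ := h.tog2 hn ⟨e.1, e.2.1, e.2.2.1⟩ ⟨e'.1, e'.2.1, e'.2.2.1⟩ hyy.symm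
      (hu y e.2.1) (hu y' e'.2.1) e.2.2.2 e'.2.2.2
    have hh := h.reach st.reach
    have ed : G.Adj y y'' := ad y'' ⟨e''.1, e''.2.2.1⟩ e''.2.2.2 y e.1 e.2.2.1 hyy1.symm
    refine hh.i hn' (x := y) (y := y'') ⟨e.1, e.2.1, e.2.2.1⟩ ⟨e''.1, e''.2.1, e''.2.2.1⟩ ?_ (nadj k2) ?_
    · rw [k3 _ _ (by unfold C4; grind)]; exact ed
    · rw [k3 _ _ (by unfold C4; grind)]; exact nadj e''.2.2.2
  by_cases hall : ∀ x, x ≠ v → x ≠ a → (nn G x).card ≤ 2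
  · have hv : (nn G v).card + 3 = Fintype.card V := by
      have e1 := nn_card G v
      have e2 : 2 ≤ dg G v := dg_pos h.1 nva
      have e3 : dg G v ≤ ({a, c} : Finset V).card :=
        dg_le (fun y hy => by simpa using hn.2.2.2 y hy)
      rw [Finset.card_pair nac] at e3
      omega
    have ha : (nn G a).card = 0 := by
      rw [Finset.card_eq_zero, Finset.eq_empty_iff_forall_notMem]
      intro x hx
      rw [mem_nn] at hx
      exact hx.2 (hu x hx.1).symm
    have pw : ∀ x ∈ (univ : Finset V), (nn G x).card + (if x = a then 2 else 0) ≤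
        2 + (if x = v then Fintype.card V else 0) := by
      intro x _
      by_cases hxv : x = v
      · subst hxv; rw [if_neg nva, if_pos rfl]; omega
      · by_cases hxa : x = a
        · subst hxa; rw [if_pos rfl]; omega
        · rw [if_neg hxa]; have := hall x hxv hxa; omega
    have := Finset.sum_le_sum pw
    simp only [Finset.sum_add_distrib, Finset.sum_ite_eq', Finset.mem_univ, if_true,
      Finset.sum_const, Finset.card_univ, smul_eq_mul] at this
    have e := r.sK
    change sK G + 2 ≤ _ at this
    -- sharpen: use nn v exactly
    have pw2 : ∀ x ∈ (univ : Finset V), (nn G x).card + (if x = a then 2 else 0) +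
        (if x = v then 5 else 0) ≤
        2 + (if x = v then Fintype.card V else 0) := by
      intro x _
      by_cases hxv : x = v
      · subst hxv; rw [if_neg nva, if_pos rfl, if_pos rfl]; omega
      · by_cases hxa : x = a
        · subst hxa; rw [if_pos rfl, if_neg hxv]; omega
        · rw [if_neg hxa, if_neg hxv]; have := hall x hxv hxa; omega
    have := Finset.sum_le_sum pw2
    simp only [Finset.sum_add_distrib, Finset.sum_ite_eq', Finset.mem_univ, if_true,
      Finset.sum_const, Finset.card_univ, smul_eq_mul] at this
    change sK G + 2 + 5 ≤ _ at this
    omega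
  · push Not at hall
    obtain ⟨p, hpv, hpa, hp⟩ := hall
    have hpc : p ≠ c := by rintro rfl; omega
    have hpc' : G.Adj p c := by
      by_contra hc
      have : nn G p ⊆ {v, c} := by
        intro x hx
        rw [mem_nn] at hx
        by_contra hxx
        simp only [Finset.mem_insert, Finset.mem_singleton, not_or] at hxx
        exact hx.2 (ad p ⟨hpv, hpc⟩ hc x hxx.1 hxx.2 hx.1).symm
      have := Finset.card_le_card this
      rw [Finset.card_pair nvc] at this
      omega
    have nnp : ∀ q ∈ nn G p, q ≠ v → q ≠ a ∧ q ≠ c ∧ q ≠ p ∧ ¬ G.Adj q p ∧ G.Adj q c := by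
      intro q hq hqv
      rw [mem_nn] at hq
      have hqc : q ≠ c := by rintro rfl; exact hq.2 hpc'
      refine ⟨?_, hqc, hq.1, nadj hq.2, ?_⟩
      · rintro rfl; exact hq.2 (hu p hpa)
      · by_contra hc
        exact hq.2 (ad q ⟨hqv, hqc⟩ hc p hpv hpc hq.1.symm)
    obtain ⟨q1, hq1, hq1v, -⟩ := exists_third hp v v
    obtain ⟨q2, hq2, hq2v, hqq⟩ := exists_third hp v q1
    have e1 := nnp q1 hq1 hq1v
    have e2 := nnp q2 hq2 hq2v
    have dst : Dst q1 c q2 p := by unfold Dst; grind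
    have k1 : (tog G q1 c q2 p).Adj q1 a := (tog_of_not (by unfold C4; grind)).2 (hu q1 e1.1)
    have k2 : (tog G q1 c q2 p).Adj q2 a := (tog_of_not (by unfold C4; grind)).2 (hu q2 e2.1)
    have k3 : (tog G q1 c q2 p).Adj a c := (tog_of_not (by unfold C4; grind)).2 hac
    have st : Step G (tog G q1 c q2 p) := stepP h.1 dst e1.2.2.2.2 e2.2.2.2.2.symm e2.2.2.2.1
      (nadj e1.2.2.2.1) (rt2 k1 k3) (rt2 k3.symm k2.symm)
    have := hmin (tog G q1 c q2 p, a, c) ⟨r.trans st.reach,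
      hn.tog hq1v.symm nvc hq2v.symm hpv.symm, fun x hx =>
        (tog_of_not (by unfold C4; grind)).2 (hu x hx)⟩
    simp only at this
    have e := dg_tog G dst.rot
    rw [← tog_rot] at e
    unfold io at e
    rw [if_pos e2.2.2.2.2.symm, if_pos e1.2.2.2.2.symm] at e
    omega

end EulSw

namespace EulSw

variable {V : Type*} [Fintype V]

open Relation

/-- complete graph on `V - v` minus `sa`, `sc`, plus `va`, `vc` -/
def Fg (v s a c : V) : SimpleGraph V where
  Adj x y := x ≠ y ∧ (x = v → y = a ∨ y = c) ∧ (y = v → x = a ∨ x = c) ∧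
    ¬ (x = s ∧ (y = a ∨ y = c)) ∧ ¬ (y = s ∧ (x = a ∨ x = c))
  symm := ⟨fun x y h => ⟨h.1.symm, h.2.2.1, h.2.1, h.2.2.2.2, h.2.2.2.1⟩⟩
  loopless := ⟨fun x h => h.1 rfl⟩

lemma fg_adj {v s a c : V} (x y : V) : (Fg v s a c).Adj x y ↔
    x ≠ y ∧ (x = v → y = a ∨ y = c) ∧ (y = v → x = a ∨ x = c) ∧
    ¬ (x = s ∧ (y = a ∨ y = c)) ∧ ¬ (y = s ∧ (x = a ∨ x = c)) := Iff.rfl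

lemma nn_odd {G : SimpleGraph V} (hG : Ev G) (hev : Even (Fintype.card V)) (x : V) :
    (nn G x).card % 2 = 1 := by
  have e1 := nn_card G x
  have e2 := hG x
  rw [Nat.even_iff] at e2 hev
  omega

lemma nn_third {G : SimpleGraph V} (hG : Ev G) (hev : Even (Fintype.card V)) {x y y' : V}
    (h : y ∈ nn G x) (h' : y' ∈ nn G x) (hy : y ≠ y') : ∃ z ∈ nn G x, z ≠ y ∧ z ≠ y' := by
  apply exists_third
  have := nn_odd hG hev x
  have e : ({y, y'} : Finset V).card ≤ (nn G x).card := by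
    apply Finset.card_le_card
    intro z hz
    simp only [Finset.mem_insert, Finset.mem_singleton] at hz
    rcases hz with rfl | rfl <;> assumption
  rw [Finset.card_pair hy] at e
  omega

lemma nn_ex {G : SimpleGraph V} (hG : Ev G) (hev : Even (Fintype.card V)) (x : V) :
    ∃ z, z ≠ x ∧ ¬ G.Adj x z := by
  have := nn_odd hG hev x
  have : (nn G x).Nonempty := by
    rw [← Finset.card_pos]; omega
  obtain ⟨z, hz⟩ := this
  exact ⟨z, mem_nn.1 hz⟩

lemma nn_v {G : SimpleGraph V} {v a c : V} (hn : NV G v a c) (hG : Eul G) :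
    (nn G v).card + 3 = Fintype.card V := by
  have e1 := nn_card G v
  have e2 : 2 ≤ dg G v := dg_pos hG (G.ne_of_adj hn.2.1)
  have e3 : dg G v ≤ ({a, c} : Finset V).card :=
    dg_le (fun y hy => by simpa using hn.2.2.2 y hy)
  rw [Finset.card_pair hn.1] at e3
  omega

lemma Stuck.even {G0 : SimpleGraph V} {v : V} (h0 : Stuck G0 v) (h2 : dg G0 v = 2)
    (hev : Even (Fintype.card V)) (hs : sK G0 ≠ 2 * Fintype.card V) :
    ∃ s a c, Dst v s a c ∧ Reach G0 (Fg v s a c) := by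
  obtain ⟨G, a, c, r, hn, hu⟩ := h0.max h2
  have h := h0.reach r
  have hac := h.adj hn
  have nva := G.ne_of_adj hn.2.1
  have nvc := G.ne_of_adj hn.2.2.1
  have nac := hn.1
  have ev := h.1.2
  obtain ⟨s, hsa, hs'⟩ := nn_ex ev hev a
  have hsv : s ≠ v := by rintro rfl; exact hs' hn.2.1.symm
  have hsc : s ≠ c := by rintro rfl; exact hs' hac
  have ua : ∀ x, x ≠ a → x ≠ s → G.Adj x a := by
    intro x hx hxs
    by_contra hc
    exact hxs (hu x s hx hsa hc (nadj hs'))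
  have e1 : ∀ y y', y ≠ y' → (y ≠ v ∧ y ≠ a ∧ y ≠ c) → (y' ≠ v ∧ y' ≠ a ∧ y' ≠ c) →
      y ≠ s → y' ≠ s → ¬ G.Adj y c → ¬ G.Adj y' c → False := by
    intro y y' hyy hy hy' hys hys' h3 h4
    obtain ⟨st, hn', k1, k2, k3⟩ := h.tog2 hn hy hy' hyy
      (ua y hy.2.1 hys) (ua y' hy'.2.1 hys') h3 h4
    have hh := h.reach st.reach
    have ed := hh.ii hn' (y := s) (x := y) ⟨hsv, hsa, hsc⟩ (by
      rw [k3 _ _ (by unfold C4; grind)]; exact nadj hs') ⟨hy.1, hy.2.1⟩ k1.symm hys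
    rw [k3 _ _ (by unfold C4; grind)] at ed
    exact h.i hn (x := s) (y := y) ⟨hsv, hsa, hsc⟩ hy ed.symm hs' (nadj h3)
  have hv : ∀ x, G.Adj v x ↔ x = a ∨ x = c := by
    intro x
    constructor
    · exact hn.2.2.2 x
    · rintro (rfl | rfl)
      exacts [hn.2.1, hn.2.2.1]
  by_cases hcs : G.Adj s c
  · exfalso
    obtain ⟨w, hwc, hw⟩ := nn_ex ev hev c
    have hwv : w ≠ v := by rintro rfl; exact hw hn.2.2.1.symm
    have hwa : w ≠ a := by rintro rfl; exact hw hac.symm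
    have hws : w ≠ s := by rintro rfl; exact hw hcs.symm
    have uc : ∀ x, x ≠ c → x ≠ w → G.Adj x c := by
      intro y hy hyw
      by_contra hc
      exact e1 y w hyw ⟨by rintro rfl; exact hc hn.2.2.1, by rintro rfl; exact hc hac, hy⟩
        ⟨hwv, hwa, hwc⟩ (by rintro rfl; exact hc hcs) hws hc (nadj hw)
    have hsw : ¬ G.Adj s w := fun hc =>
      h.i hn (x := s) (y := w) ⟨hsv, hsa, hsc⟩ ⟨hwv, hwa, hwc⟩ hc hs' hw
    have uw : ∀ x, x ≠ v → x ≠ c → x ≠ s → x ≠ w → G.Adj x w := by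
      intro x hxv hxc hxs hxw
      by_cases hxa : x = a
      · subst hxa; exact (ua w hwa hws).symm
      · exact h.ii hn.symm ⟨hwv, hwc, hwa⟩ (nadj hw) ⟨hxv, hxc⟩ (ua x hxa hxs).symm hxw
    have us : ∀ x, x ≠ v → x ≠ a → x ≠ w → x ≠ s → G.Adj x s := by
      intro x hxv hxa hxw hxs
      by_cases hxc : x = c
      · subst hxc; exact hcs.symm
      · exact h.ii hn ⟨hsv, hsa, hsc⟩ (nadj hs') ⟨hxv, hxa⟩ (uc x hxc hxw).symm hxs
    have up : ∀ p p', (p ≠ v ∧ p ≠ a ∧ p ≠ c ∧ p ≠ s ∧ p ≠ w) →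
        (p' ≠ v ∧ p' ≠ a ∧ p' ≠ c ∧ p' ≠ s ∧ p' ≠ w) → p ≠ p' → G.Adj p p' := by
      intro p p' hp hp' hpp
      by_contra hc
      have dst : Dst w p p' s := by unfold Dst; grind
      have k1 : (tog G w p p' s).Adj w a := (tog_of_not (by unfold C4; grind)).2 (ua w hwa hws)
      have k2 : (tog G w p p' s).Adj p a := (tog_of_not (by unfold C4; grind)).2
        (ua p hp.2.1 hp.2.2.2.1)
      have k3 : (tog G w p p' s).Adj p' c := (tog_of_not (by unfold C4; grind)).2
        (uc p' hp'.2.2.1 hp'.2.2.2.2)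
      have k4 : (tog G w p p' s).Adj s c := (tog_of_not (by unfold C4; grind)).2 hcs
      have k5 : (tog G w p p' s).Adj s w := (tog_of (by grind) (by simp [C4])).2 hsw
      have st : Step G (tog G w p p' s) := stepA h.1 dst
        (uw p hp.1 hp.2.2.1 hp.2.2.2.1 hp.2.2.2.2).symm hc
        (us p' hp'.1 hp'.2.1 hp'.2.2.2.2 hp'.2.2.2.1) hsw (rt2 k1 k2.symm) (rt2 k3 k4.symm)
      refine (h.reach st.reach).i (hn.tog hwv.symm hp.1.symm hp'.1.symm hsv.symm)
        (x := s) (y := w) ⟨hsv, hsa, hsc⟩ ⟨hwv, hwa, hwc⟩ k5 ?_ ?_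
      · rw [tog_of_not (by unfold C4; grind)]; exact hs'
      · rw [tog_of_not (by unfold C4; grind)]; exact hw
    apply hs
    rw [← r.sK]
    have sy := fun x y => G.adj_comm x y
    have pw : ∀ x ∈ (univ : Finset V), (nn G x).card + (if x = v then 4 else 0) =
        1 + (if x = v then Fintype.card V else 0) + (if x = s then 2 else 0) +
          (if x = w then 2 else 0) := by
      intro x _
      by_cases hxv : x = v
      · subst hxv
        have := nn_v hn h.1
        simp only [hsv.symm, hwv.symm, if_true, if_false]
        omega
      by_cases hxs : x = s
      · subst hxs
        have : nn G x = {v, a, w} := by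
          ext y
          simp only [mem_nn, Finset.mem_insert, Finset.mem_singleton]
          grind
        rw [this, Finset.card_insert_of_notMem (by simp [nva, hwv.symm]), Finset.card_pair hwa.symm]
        simp [hsv, hws.symm]
      by_cases hxw : x = w
      · subst hxw
        have : nn G x = {v, c, s} := by
          ext y
          simp only [mem_nn, Finset.mem_insert, Finset.mem_singleton]
          grind
        rw [this, Finset.card_insert_of_notMem (by simp [nvc, hsv.symm]), Finset.card_pair hsc.symm]
        simp [hwv, hws]
      have : ∃ z, nn G x = {z} := by
        by_cases hxa : x = a
        · refine ⟨s, ?_⟩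
          subst hxa
          ext y
          simp only [mem_nn, Finset.mem_singleton]
          grind
        by_cases hxc : x = c
        · refine ⟨w, ?_⟩
          subst hxc
          ext y
          simp only [mem_nn, Finset.mem_singleton]
          grind
        refine ⟨v, ?_⟩
        ext y
        simp only [mem_nn, Finset.mem_singleton]
        grind
      obtain ⟨z, hz⟩ := this
      rw [hz, Finset.card_singleton]
      simp [hxv, hxs, hxw]
    have := Finset.sum_congr rfl pw
    simp only [Finset.sum_add_distrib, Finset.sum_ite_eq', Finset.mem_univ, if_true,
      Finset.sum_const, Finset.card_univ, smul_eq_mul] at this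
    change sK G + 4 = _ at this
    omega
  · refine ⟨s, a, c, by unfold Dst; grind, ?_⟩
    have uc : ∀ x, x ≠ c → x ≠ s → G.Adj x c := by
      intro y hy hys
      by_contra hc
      obtain ⟨z, hz, hzs, hzy⟩ := nn_third ev hev (x := c) (y := s) (y' := y)
        (mem_nn.2 ⟨hsc, nadj hcs⟩) (mem_nn.2 ⟨hy, nadj hc⟩) hys.symm
      rw [mem_nn] at hz
      exact e1 y z hzy.symm ⟨by rintro rfl; exact hc hn.2.2.1, by rintro rfl; exact hc hac, hy⟩
        ⟨by rintro rfl; exact hz.2 hn.2.2.1.symm, by rintro rfl; exact hz.2 hac.symm, hz.1⟩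
        hys hzs hc (nadj hz.2)
    have us : ∀ x, x ≠ v → x ≠ a → x ≠ c → x ≠ s → G.Adj x s := by
      intro x hxv hxa hxc hxs
      exact h.ii hn ⟨hsv, hsa, hsc⟩ (nadj hs') ⟨hxv, hxa⟩ (uc x hxc hxs).symm hxs
    have up : ∀ p p', (p ≠ v ∧ p ≠ a ∧ p ≠ c ∧ p ≠ s) →
        (p' ≠ v ∧ p' ≠ a ∧ p' ≠ c ∧ p' ≠ s) → p ≠ p' → G.Adj p p' := by
      intro p p' hp hp' hpp
      by_contra hc
      have hpv' : ¬ G.Adj v p' := by rw [hv]; grind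
      obtain ⟨q, hq, hqp, hqv⟩ := nn_third ev hev (x := p') (y := p) (y' := v)
        (mem_nn.2 ⟨hpp, nadj hc⟩) (mem_nn.2 ⟨hp'.1.symm, nadj hpv'⟩) hp.1
      rw [mem_nn] at hq
      have hqa : q ≠ a := by rintro rfl; exact hq.2 (ua p' hp'.2.1 hp'.2.2.2)
      have hqc : q ≠ c := by rintro rfl; exact hq.2 (uc p' hp'.2.2.1 hp'.2.2.2)
      have hqs : q ≠ s := by rintro rfl; exact hq.2 (us p' hp'.1 hp'.2.1 hp'.2.2.1 hp'.2.2.2)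
      have eps := us p hp.1 hp.2.1 hp.2.2.1 hp.2.2.2
      have eqs := us q hqv hqa hqc hqs
      have dst : Dst p s q p' := by unfold Dst; grind
      have k1 : (tog G p s q p').Adj p p' := (tog_of (by grind) (by simp [C4])).2 hc
      have k2 : (tog G p s q p').Adj q p' := (tog_of (by grind) (by simp [C4])).2 (nadj hq.2)
      have k3 : (tog G p s q p').Adj p' s := (tog_of_not (by unfold C4; grind)).2
        (us p' hp'.1 hp'.2.1 hp'.2.2.1 hp'.2.2.2)
      have k4 : ¬ (tog G p s q p').Adj p s := by
        rw [tog_of (by grind) (by simp [C4])]; exact not_not.2 eps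
      have st : Step G (tog G p s q p') := stepP h.1 dst eps eqs.symm (nadj hq.2) (nadj hc)
        (rt2 k1 k3) (rt2 k3.symm k2.symm)
      refine k4 ((h.reach st.reach).ii (hn.tog hp.1.symm hsv.symm hqv.symm hp'.1.symm)
        ⟨hsv, hsa, hsc⟩ ?_ ⟨hp.1, hp.2.1⟩ ?_ hp.2.2.2)
      · rw [tog_of_not (by unfold C4; grind)]; exact nadj hs'
      · rw [tog_of_not (by unfold C4; grind)]; exact (uc p hp.2.2.1 hp.2.2.2).symm
    have : G = Fg v s a c := by
      ext x y
      rw [fg_adj]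
      have sy := G.adj_comm x y
      have ne := G.ne_of_adj (a := x) (b := y)
      by_cases hxy : x = y
      · subst hxy; simp
      have c1 := hv x
      have c2 := hv y
      have c3 := up x y
      have c4 := us x
      have c5 := us y
      have c6 := ua x
      have c7 := ua y
      have c8 := uc x
      have c9 := uc y
      clear up us ua uc e1 hu h0 h2 hn hv ev
      by_cases x = v <;> by_cases y = v <;> by_cases x = s <;> by_cases y = s <;> grind
    rw [← this]
    exact r

end EulSw

namespace EulSw

variable {V : Type*} [Fintype V]

open Relation

universe uu

lemma fg_swap (v s a c : V) : Fg v s a c = Fg v s c a := by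
  ext x y; rw [fg_adj, fg_adj]; grind

lemma fg_A {v s a c p : V} (hd : Dst v s a c) (hp : p ≠ v ∧ p ≠ s ∧ p ≠ a ∧ p ≠ c)
    (hE : Eul (Fg v s a c)) : Reach (Fg v s a c) (Fg v s p c) := by
  obtain ⟨d1, d2, d3, d4, d5, d6⟩ := hd
  have e : tog (Fg v s a c) s p v a = Fg v s p c := by
    ext x y
    rw [tog_adj]
    by_cases hxy : x = y
    · subst hxy; simp
    by_cases h1 : x = v
    · subst h1
      simp only [fg_adj, C4]; grind
    by_cases h2 : y = v
    · subst h2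
      simp only [fg_adj, C4]; grind
    by_cases h3 : x = s
    · subst h3
      simp only [fg_adj, C4]; grind
    by_cases h4 : y = s
    · subst h4
      simp only [fg_adj, C4]; grind
    simp only [fg_adj, C4]; grind
  have st : Step (Fg v s a c) (tog (Fg v s a c) s p v a) := by
    refine stepA hE (by unfold Dst; grind) ?_ ?_ ?_ ?_ ?_ ?_
    · rw [fg_adj]; grind
    · rw [fg_adj]; grind
    · rw [fg_adj]; grind
    · rw [fg_adj]; grind
    · rw [e]
      exact rt2 (y := a) (by rw [fg_adj]; grind) (by rw [fg_adj]; grind)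
    · rw [e]
      exact rt2 (y := c) (by rw [fg_adj]; grind) (by rw [fg_adj]; grind)
  rw [e] at st
  exact st.reach

lemma fg_B {v s a c p : V} (hd : Dst v s a c) (hp : p ≠ v ∧ p ≠ s ∧ p ≠ a ∧ p ≠ c)
    (hE : Eul (Fg v s a c)) : Reach (Fg v s a c) (Fg v p a c) := by
  obtain ⟨d1, d2, d3, d4, d5, d6⟩ := hd
  have e : tog (Fg v s a c) a p c s = Fg v p a c := by
    ext x y
    rw [tog_adj]
    by_cases hxy : x = y
    · subst hxy; simp
    by_cases h1 : x = v
    · subst h1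
      simp only [fg_adj, C4]; grind
    by_cases h2 : y = v
    · subst h2
      simp only [fg_adj, C4]; grind
    by_cases h3 : x = s
    · subst h3
      simp only [fg_adj, C4]; grind
    by_cases h4 : y = s
    · subst h4
      simp only [fg_adj, C4]; grind
    simp only [fg_adj, C4]; grind
  have st : Step (Fg v s a c) (tog (Fg v s a c) a p c s) := by
    refine stepP hE (by unfold Dst; grind) ?_ ?_ ?_ ?_ ?_ ?_
    · rw [fg_adj]; grind
    · rw [fg_adj]; grind
    · rw [fg_adj]; grind
    · rw [fg_adj]; grind
    · rw [e]
      exact rt2 (y := s) (by rw [fg_adj]; grind) (by rw [fg_adj]; grind)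
    · rw [e]
      exact rt2 (y := s) (by rw [fg_adj]; grind) (by rw [fg_adj]; grind)
  rw [e] at st
  exact st.reach

lemma fg_reach {v s a c s' a' c' : V} (hd : Dst v s a c) (hd' : Dst v s' a' c')
    (hE : Eul (Fg v s a c)) (h5 : 5 ≤ Fintype.card V) : Reach (Fg v s a c) (Fg v s' a' c') := by
  have h1 : ∃ x y, Dst v s' x y ∧ Reach (Fg v s a c) (Fg v s' x y) := by
    by_cases hs : s = s'
    · subst hs; exact ⟨a, c, hd, Reach.refl _⟩
    · have key : ∀ a c, Dst v s a c → s' ≠ c → Eul (Fg v s a c) →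
          ∃ x y, Dst v s' x y ∧ Reach (Fg v s a c) (Fg v s' x y) := by
        intro a c hd hc hE
        by_cases ha : s' = a
        · obtain ⟨p, hp⟩ : ∃ p, p ∉ ({v, s, a, c} : Finset V) := by
            by_contra hc
            push Not at hc
            have e1 : (univ : Finset V).card ≤ ({v, s, a, c} : Finset V).card :=
              Finset.card_le_card (fun x _ => hc x)
            have e2 := Finset.card_le_four (a := v) (b := s) (c := a) (d := c)
            rw [Finset.card_univ] at e1
            omega
          simp only [Finset.mem_insert, Finset.mem_singleton, not_or] at hp
          have r1 := fg_A hd hp hE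
          have r2 := fg_B (v := v) (s := s) (a := p) (c := c) (p := s')
            (by unfold Dst at *; grind) (by unfold Dst at *; grind) (r1.eul hE)
          exact ⟨p, c, by unfold Dst at *; grind, r1.trans r2⟩
        · exact ⟨a, c, by unfold Dst at *; grind,
            fg_B hd (by unfold Dst at *; grind) hE⟩
      by_cases hc : s' = c
      · obtain ⟨x, y, h, r⟩ := key c a (by unfold Dst at *; grind) (by unfold Dst at *; grind)
          (by rw [← fg_swap]; exact hE)
        exact ⟨x, y, h, by rw [fg_swap v s a c]; exact r⟩
      · exact key a c hd hc hE
  obtain ⟨x, y, hxy, r⟩ := h1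
  have h2 : ∃ y, Dst v s' a' y ∧ Reach (Fg v s a c) (Fg v s' a' y) := by
    by_cases hx : a' = x
    · subst hx; exact ⟨y, hxy, r⟩
    by_cases hy : a' = y
    · subst hy
      refine ⟨x, by unfold Dst at *; grind, ?_⟩
      rw [fg_swap v s' a' x]; exact r
    · exact ⟨y, by unfold Dst at *; grind,
        r.trans (fg_A hxy (by unfold Dst at *; grind) (r.eul hE))⟩
  obtain ⟨y, hy, r⟩ := h2
  by_cases hc : c' = y
  · subst hc; exact r
  · refine r.trans ?_
    have hE' := r.eul hE
    rw [fg_swap] at hE'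
    rw [fg_swap v s' a' y, fg_swap v s' a' c']
    exact fg_A (by unfold Dst at *; grind) (by unfold Dst at *; grind) hE'

lemma sum_lb {f : V → ℕ} {z q q' : V} {M : ℕ} (h1 : ∀ x, 1 ≤ f x) (hz : M ≤ f z)
    (hq : 3 ≤ f q) (hq' : 3 ≤ f q') (d1 : z ≠ q) (d2 : z ≠ q') (d3 : q ≠ q') :
    Fintype.card V + M + 4 ≤ (∑ x, f x) + 1 := by
  have pw : ∀ x ∈ (univ : Finset V), 1 + (if x = z then M else 0) + (if x = q then 2 else 0) +
      (if x = q' then 2 else 0) ≤ f x + (if x = z then 1 else 0) := by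
    intro x _
    have := h1 x
    by_cases e1 : x = z
    · subst e1; simp only [d1, d2, if_true, if_false]; omega
    by_cases e2 : x = q
    · subst e2; simp only [e1, d3, if_true, if_false]; omega
    by_cases e3 : x = q'
    · subst e3; simp only [e1, e2, if_true, if_false]; omega
    simp only [e1, e2, e3, if_false]; omega
  have := Finset.sum_le_sum pw
  simp only [Finset.sum_add_distrib, Finset.sum_ite_eq', Finset.mem_univ, if_true,
    Finset.sum_const, Finset.card_univ, smul_eq_mul] at this
  omega

lemma sum_one {f : V → ℕ} {z : V} (h1 : ∀ x, x ≠ z → f x = 1) :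
    (∑ x, f x) + 1 = Fintype.card V + f z := by
  have pw : ∀ x ∈ (univ : Finset V), f x + (if x = z then 1 else 0) =
      1 + (if x = z then f z else 0) := by
    intro x _
    by_cases e1 : x = z
    · subst e1; simp only [if_true]; omega
    · simp only [e1, if_false]; rw [h1 x e1]
  have := Finset.sum_congr rfl pw
  simp only [Finset.sum_add_distrib, Finset.sum_ite_eq', Finset.mem_univ, if_true,
    Finset.sum_const, Finset.card_univ, smul_eq_mul] at this
  omega

lemma sK_fg {v s a c : V} (hd : Dst v s a c) (hE : Eul (Fg v s a c)) :
    sK (Fg v s a c) + 2 = 2 * Fintype.card V := by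
  obtain ⟨d1, d2, d3, d4, d5, d6⟩ := hd
  have hn : NV (Fg v s a c) v a c := by
    refine ⟨d6, ?_, ?_, ?_⟩
    · rw [fg_adj]; grind
    · rw [fg_adj]; grind
    · intro y hy; rw [fg_adj] at hy; grind
  have pw : ∀ x ∈ (univ : Finset V), (nn (Fg v s a c) x).card + (if x = v then 4 else 0) =
      1 + (if x = v then Fintype.card V else 0) + (if x = s then 2 else 0) := by
    intro x _
    by_cases hxv : x = v
    · subst hxv
      have := nn_v hn hE
      simp only [d1, if_true, if_false]
      omega
    by_cases hxs : x = s
    · subst hxs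
      have : nn (Fg v x a c) x = {v, a, c} := by
        ext y
        simp only [mem_nn, Finset.mem_insert, Finset.mem_singleton, fg_adj]
        grind
      rw [this, Finset.card_insert_of_notMem (by simp [d2, d3]), Finset.card_pair d6]
      simp [d1.symm]
    have : ∃ z, nn (Fg v s a c) x = {z} := by
      by_cases hxa : x = a
      · refine ⟨s, ?_⟩
        subst hxa
        ext y
        simp only [mem_nn, Finset.mem_singleton, fg_adj]
        grind
      by_cases hxc : x = c
      · refine ⟨s, ?_⟩
        subst hxc
        ext y
        simp only [mem_nn, Finset.mem_singleton, fg_adj]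
        grind
      refine ⟨v, ?_⟩
      ext y
      simp only [mem_nn, Finset.mem_singleton, fg_adj]
      grind
    obtain ⟨z, hz⟩ := this
    rw [hz, Finset.card_singleton]
    simp [hxv, hxs]
  have := Finset.sum_congr rfl pw
  simp only [Finset.sum_add_distrib, Finset.sum_ite_eq', Finset.mem_univ, if_true,
    Finset.sum_const, Finset.card_univ, smul_eq_mul] at this
  change sK (Fg v s a c) + 4 = _ at this
  omega

lemma nn_ge3 {G : SimpleGraph V} (hG : Ev G) (hev : Even (Fintype.card V)) {x y y' : V}
    (hy : y ≠ y') (h : y ≠ x) (h' : y' ≠ x) (k : ¬ G.Adj x y) (k' : ¬ G.Adj x y') :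
    3 ≤ (nn G x).card := by
  have := nn_odd hG hev x
  have e : ({y, y'} : Finset V).card ≤ (nn G x).card := by
    apply Finset.card_le_card
    intro z hz
    simp only [Finset.mem_insert, Finset.mem_singleton] at hz
    rw [mem_nn]
    rcases hz with rfl | rfl
    exacts [⟨h, k⟩, ⟨h', k'⟩]
  rw [Finset.card_pair hy] at e
  omega

lemma mixed {G : SimpleGraph V} {v : V} (hG : Eul G) (hv : Vgood G v)
    (hev : Even (Fintype.card V)) (hs : sK G + 2 = 2 * Fintype.card V) : False := by
  obtain ⟨a, c, hac, nac, hva, hvc, hy⟩ := hv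
  have hn : NV G v a c := ⟨hac, hva, hvc, hy⟩
  have nva := G.ne_of_adj hva
  have nvc := G.ne_of_adj hvc
  have hnv := nn_v hn hG
  have o := nn_odd hG.2 hev
  have key : ∃ q q', v ≠ q ∧ v ≠ q' ∧ q ≠ q' ∧ 3 ≤ (nn G q).card ∧ 3 ≤ (nn G q').card := by
    by_cases hall : ∀ x, x ≠ v → (nn G x).card = 1
    · have := sum_one (f := fun x => (nn G x).card) hall
      change sK G + 1 = _ at this
      omega
    push Not at hall
    obtain ⟨q, hqv, hq⟩ := hall
    have hq3 : 3 ≤ (nn G q).card := by have := o q; omega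
    have nv : ∀ x, x ≠ a → x ≠ c → ¬ G.Adj x v := by
      intro x h1 h2 h
      rcases hy x h.symm with h | h
      exacts [h1 h, h2 h]
    have tk : ∀ q', q' ≠ v → q' ≠ q → ¬ G.Adj q' q → (q' = a → q ≠ c) → (q' = c → q ≠ a) →
        3 ≤ (nn G q').card := by
      intro r hrv hrq hrq' h1 h2
      by_cases hra : r = a
      · subst hra
        exact nn_ge3 hG.2 hev (y := c) (y' := q) (h1 rfl).symm hac.symm hrq.symm nac hrq'
      by_cases hrc : r = c
      · subst hrc
        exact nn_ge3 hG.2 hev (y := a) (y' := q) (h2 rfl).symm hac hrq.symm (nadj nac) hrq'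
      exact nn_ge3 hG.2 hev (y := v) (y' := q) hqv.symm hrv.symm hrq.symm (nv r hra hrc) hrq'
    by_cases hqa : q = a
    · obtain ⟨r, hr, h1, h2⟩ := exists_third hq3 c v
      rw [mem_nn] at hr
      exact ⟨q, r, hqv.symm, h2.symm, hr.1.symm, hq3, tk r h2 hr.1 (nadj hr.2) (by grind) (by grind)⟩
    by_cases hqc : q = c
    · obtain ⟨r, hr, h1, h2⟩ := exists_third hq3 a v
      rw [mem_nn] at hr
      exact ⟨q, r, hqv.symm, h2.symm, hr.1.symm, hq3, tk r h2 hr.1 (nadj hr.2) (by grind) (by grind)⟩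
    obtain ⟨r, hr, h1, h2⟩ := exists_third hq3 v v
    rw [mem_nn] at hr
    exact ⟨q, r, hqv.symm, h2.symm, hr.1.symm, hq3, tk r h2 hr.1 (nadj hr.2) (by grind) (by grind)⟩
  obtain ⟨q, q', k1, k2, k3, k4, k5⟩ := key
  have := sum_lb (f := fun x => (nn G x).card) (z := v) (q := q) (q' := q') (M := (nn G v).card)
    (fun x => by have := o x; omega) le_rfl k4 k5 k1 k2 k3
  change _ ≤ sK G + 1 at this
  omega

/-- counting for a disconnected even graph -/
lemma disc {J : SimpleGraph V} (hE : Ev J) (hC : ¬ Cn J) :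
    2 ≤ Fintype.card V ∧ 2 * Fintype.card V ≤ sK J + 2 ∧
    (5 ≤ Fintype.card V → ¬ Even (Fintype.card V) → 3 * Fintype.card V ≤ sK J + 3) ∧
    (5 ≤ Fintype.card V → Even (Fintype.card V) → sK J ≠ 2 * Fintype.card V) := by
  unfold Cn at hC
  push Not at hC
  obtain ⟨X, ⟨x0, hx0⟩, ⟨y0, hy0⟩, hX⟩ := hC
  set k := (univ.filter (fun x => X x)).card with hk
  set l := (univ.filter (fun x => ¬ X x)).card with hl
  have hkl : k + l = Fintype.card V := by
    rw [hk, hl, Finset.card_filter_add_card_filter_not, Finset.card_univ]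
  have hk1 : 1 ≤ k := Finset.card_pos.2 ⟨x0, by simpa using hx0⟩
  have hl1 : 1 ≤ l := Finset.card_pos.2 ⟨y0, by simpa using hy0⟩
  have pw : ∀ x ∈ (univ : Finset V), (if X x then l else k) ≤ (nn J x).card := by
    intro x _
    by_cases hx : X x
    · rw [if_pos hx]
      apply Finset.card_le_card
      intro y hy
      simp only [Finset.mem_filter, Finset.mem_univ, true_and] at hy
      rw [mem_nn]
      exact ⟨by rintro rfl; exact hy hx, hX x y hx hy⟩
    · rw [if_neg hx]
      apply Finset.card_le_card
      intro y hy
      simp only [Finset.mem_filter, Finset.mem_univ, true_and] at hy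
      rw [mem_nn]
      exact ⟨by rintro rfl; exact hx hy, nadj (hX y x hy hx)⟩
  have s1 := Finset.sum_le_sum pw
  rw [Finset.sum_ite, Finset.sum_const, Finset.sum_const, smul_eq_mul, smul_eq_mul, ← hk, ← hl] at s1
  change _ ≤ sK J at s1
  have b1 : 2 * (k + l) ≤ sK J + 2 := by nlinarith
  refine ⟨by omega, by omega, ?_⟩
  by_cases hbig : 2 ≤ k ∧ 2 ≤ l
  · have b2 : 4 * (k + l) ≤ sK J + 8 := by
      obtain ⟨k', hk'⟩ : ∃ k', k = k' + 2 := ⟨k - 2, by omega⟩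
      obtain ⟨l', hl'⟩ : ∃ l', l = l' + 2 := ⟨l - 2, by omega⟩
      rw [hk', hl'] at s1 ⊢
      nlinarith
    exact ⟨fun _ _ => by omega, fun _ _ => by omega⟩
  · have hz : ∃ z, ∀ y, ¬ J.Adj z y := by
      by_cases h1 : k = 1
      · obtain ⟨z, hz⟩ := Finset.card_eq_one.1 (hk.symm.trans h1)
        have hz' : ∀ x, X x ↔ x = z := by
          intro x
          have : x ∈ univ.filter (fun x => X x) ↔ x = z := by rw [hz]; simp
          simpa using this
        refine ⟨z, fun y hy => ?_⟩
        refine hX z y ((hz' z).2 rfl) ?_ hy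
        rw [hz']; exact (J.ne_of_adj hy).symm
      · have h2 : l = 1 := by omega
        obtain ⟨z, hz⟩ := Finset.card_eq_one.1 (hl.symm.trans h2)
        have hz' : ∀ x, ¬ X x ↔ x = z := by
          intro x
          have : x ∈ univ.filter (fun x => ¬ X x) ↔ x = z := by rw [hz]; simp
          simpa using this
        refine ⟨z, fun y hy => ?_⟩
        refine hX y z ?_ ((hz' z).2 rfl) hy.symm
        by_contra hc
        rw [hz'] at hc
        exact J.ne_of_adj hy hc.symm
    obtain ⟨z, hz⟩ := hz
    have hnz : (nn J z).card + 1 = Fintype.card V := by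
      have e1 := nn_card J z
      have e2 : dg J z ≤ (∅ : Finset V).card := dg_le (fun y hy => (hz y hy).elim)
      rw [Finset.card_empty] at e2
      omega
    have hpos : ∀ x, x ≠ z → 1 ≤ (nn J x).card := fun x hx =>
      Finset.card_pos.2 ⟨z, mem_nn.2 ⟨hx.symm, nadj (hz x)⟩⟩
    constructor
    · intro h5 hodd
      have pw : ∀ x ∈ (univ : Finset V), 2 + (if x = z then Fintype.card V else 0) ≤
          (nn J x).card + (if x = z then 3 else 0) := by
        intro x _
        by_cases hx : x = z
        · subst hx; simp only [if_true]; omega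
        · simp only [hx, if_false]
          have e1 := nn_card J x
          have e2 := hE x
          have e3 := hpos x hx
          rw [Nat.even_iff] at e2 hodd
          omega
      have := Finset.sum_le_sum pw
      simp only [Finset.sum_add_distrib, Finset.sum_ite_eq', Finset.mem_univ, if_true,
        Finset.sum_const, Finset.card_univ, smul_eq_mul] at this
      change _ ≤ sK J + 3 at this
      omega
    · intro h5 hev hs
      have o := nn_odd hE hev
      by_cases hall : ∀ x, x ≠ z → (nn J x).card = 1
      · have := sum_one (f := fun x => (nn J x).card) hall
        change sK J + 1 = _ at this
        omega
      push Not at hall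
      obtain ⟨q, hqz, hq⟩ := hall
      have hq3 : 3 ≤ (nn J q).card := by have := o q; omega
      obtain ⟨r, hr, h1, -⟩ := exists_third hq3 z z
      rw [mem_nn] at hr
      have hr3 := nn_ge3 hE hev (x := r) (y := z) (y' := q) hqz.symm h1.symm hr.1.symm
        (nadj (hz r)) (nadj hr.2)
      have := sum_lb (f := fun x => (nn J x).card) (z := z) (q := q) (q' := r)
        (M := (nn J z).card) (fun x => by have := o x; omega) le_rfl hq3 hr3
        hqz.symm h1.symm hr.1.symm
      change _ ≤ sK J + 1 at this
      omega

lemma main_ind : ∀ (n : ℕ) (V : Type uu) [Fintype V], Fintype.card V = n →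
    ∀ G H : SimpleGraph V, Eul G → Eul H → tot G = tot H → Reach G H := by
  intro n
  induction n with
  | zero =>
    intro V _ hV G H hG hH ht
    have : IsEmpty V := Fintype.card_eq_zero_iff.1 hV
    have : G = H := by ext x; exact this.elim x
    rw [this]; exact Reach.refl _
  | succ n ih =>
    intro V _ hV G H hG hH ht
    by_contra hn
    obtain ⟨v⟩ : Nonempty V := Fintype.card_pos_iff.1 (by omega)
    obtain ⟨J, hJe, hJc, hJt⟩ := reach_of_all_cn hG hH ht hn
    obtain ⟨j2, j3, j4, j5⟩ := disc hJe hJc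
    obtain ⟨w, hw⟩ := Fintype.exists_ne_of_one_lt_card (show 1 < Fintype.card V by omega)  v
    have hsJ : sK J = sK G := by
      have e1 := sK_eq G
      have e2 := sK_eq J
      omega
    have hsH : sK H = sK G := by
      have e1 := sK_eq G
      have e2 := sK_eq H
      omega
    have h5 : 5 ≤ Fintype.card V := by
      have e1 := sK_eq G
      have e2 : ∑ x : V, 2 ≤ tot G := by
        apply Finset.sum_le_sum
        intro x _
        by_cases hx : x = v
        · subst hx; exact dg_pos hG hw.symm
        · exact dg_pos hG hx
      rw [Finset.sum_const, Finset.card_univ, smul_eq_mul] at e2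
      by_contra hc
      have : Fintype.card V = 2 ∨ Fintype.card V = 3 ∨ Fintype.card V = 4 := by omega
      rcases this with h | h | h <;> rw [h] at e1 e2 j3 <;> omega
    have hcard : Fintype.card {x : V // x ≠ v} = n := by
      rw [Fintype.card_subtype_compl]
      simp [hV]
    have alt : ∀ K L : SimpleGraph V, Eul K → Eul L → tot K = tot L → ¬ Reach K L → sK K = sK G →
        (∃ K', Reach K K' ∧ Vgood K' v) ∨ (Even (Fintype.card V) ∧
          ∃ s a c, Dst v s a c ∧ Reach K (Fg v s a c)) := by
      intro K L hK hL hKL hnr hsK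
      by_cases hg : ∃ K', Reach K K' ∧ Vgood K' v
      · exact Or.inl hg
      right
      push Not at hg
      obtain ⟨K1, r1, hd⟩ := nonrigid hK hL hKL hnr v
      have st : Stuck K1 v := ⟨r1.eul hK, fun G' r' => hg G' (r1.trans r')⟩
      have e := r1.sK
      by_cases hev : Even (Fintype.card V)
      · refine ⟨hev, ?_⟩
        obtain ⟨s, a, c, h1, h2⟩ := st.even hd hev (by
          have := j5 h5 hev
          omega)
        exact ⟨s, a, c, h1, r1.trans h2⟩
      · exact (st.odd hd hev (by have := j4 h5 hev; omega)).elim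
    have mix : ∀ K L : SimpleGraph V, Eul K → Eul L → sK K = sK L →
        (∃ K', Reach K K' ∧ Vgood K' v) → (Even (Fintype.card V) ∧
          ∃ s a c, Dst v s a c ∧ Reach L (Fg v s a c)) → False := by
      rintro K L hK hL hs ⟨K', r1, hg⟩ ⟨hev, s, a, c, hd, r2⟩
      apply mixed (r1.eul hK) hg hev
      have := sK_fg hd (r2.eul hL)
      rw [r2.sK] at this
      rw [r1.sK]; omega
    rcases alt G H hG hH ht hn rfl with h1 | h1
    · rcases alt H G hH hG ht.symm (fun r => hn r.symm) hsH with h2 | h2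
      · obtain ⟨G', r1, g1⟩ := h1
        obtain ⟨H', r2, g2⟩ := h2
        have := reach_of_vgood (v := v) (fun J J' a b c => ih _ hcard J J' a b c) (r1.eul hG)
          (r2.eul hH) (by rw [r1.tot, r2.tot]; exact ht) g1 g2
        exact hn ((r1.trans this).trans r2.symm)
      · exact mix G H hG hH hsH.symm h1 h2
    · rcases alt H G hH hG ht.symm (fun r => hn r.symm) hsH with h2 | h2
      · exact mix H G hH hG hsH h2 h1
      · obtain ⟨_, s, a, c, hd, r1⟩ := h1
        obtain ⟨_, s', a', c', hd', r2⟩ := h2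
        exact hn ((r1.trans (fg_reach hd hd' (r1.eul hG) h5)).trans r2.symm)

end EulSw

namespace EulSw

variable {V : Type*} [Fintype V]

open Relation

lemma even_deg (G : SimpleGraph V) (x : V) : G.degree x = dg G x := by
  unfold dg
  rw [← SimpleGraph.card_neighborFinset_eq_degree]
  congr 1
  ext y
  simp

lemma eul_iff [Nonempty V] (G : SimpleGraph V) : IsEulerianGraph G ↔ Eul G := by
  unfold IsEulerianGraph Eul Ev
  have h1 : (∀ v, Even (G.degree v)) ↔ ∀ x, Even (dg G x) := by
    refine forall_congr' fun x => ?_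
    rw [even_deg]
  rw [h1]
  have h2 : G.Connected ↔ Cn G := by
    rw [SimpleGraph.connected_iff]
    constructor
    · rintro ⟨h, -⟩ X ⟨x, hx⟩ ⟨y, hy⟩
      have := (SimpleGraph.reachable_iff_reflTransGen x y).1 (h x y)
      exact rtg_cross this hx hy
    · intro h
      refine ⟨fun x y => ?_, inferInstance⟩
      rw [SimpleGraph.reachable_iff_reflTransGen]
      by_contra hc
      obtain ⟨p, q, hp, hq, hpq⟩ := h (fun z => ReflTransGen G.Adj x z) ⟨x, ReflTransGen.refl⟩
        ⟨y, hc⟩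
      exact hq (hp.tail hpq)
  rw [h2]

lemma mv_switch {G G' : SimpleGraph V} (h : Mv G G') : IsKSwitch 2 G G' := by
  have ht : G'.edgeFinset.card = G.edgeFinset.card := by
    have e1 := tot_eq G
    have e2 := tot_eq G'
    have e3 := h.tot
    omega
  obtain ⟨a, b, c, d, hd, rfl, h1⟩ := h
  obtain ⟨d1, d2, d3, d4, d5, d6⟩ := hd
  rcases h1 with ⟨k1, k2, k3, k4⟩ | ⟨k1, k2, k3, k4⟩
  · refine ⟨{s(a, b), s(b, c)}, {s(c, d), s(d, a)}, ?_, ?_, ?_, ?_, ht⟩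
    · rw [Finset.card_pair]; rw [Ne, Sym2.eq_iff]; grind
    · rw [Finset.card_pair]; rw [Ne, Sym2.eq_iff]; grind
    · intro e he
      simp only [Finset.mem_insert, Finset.mem_singleton] at he
      rcases he with rfl | rfl <;> simpa
    · ext e
      induction e using Sym2.ind with
      | _ x y =>
        simp only [SimpleGraph.mem_edgeFinset, SimpleGraph.mem_edgeSet, Finset.mem_union,
          Finset.mem_sdiff, Finset.mem_insert, Finset.mem_singleton, Sym2.eq_iff, tog_adj, C4]
        have := G.adj_comm
        have := G.ne_of_adj (a := x) (b := y)
        grind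
  · refine ⟨{s(a, b), s(c, d)}, {s(b, c), s(d, a)}, ?_, ?_, ?_, ?_, ht⟩
    · rw [Finset.card_pair]; rw [Ne, Sym2.eq_iff]; grind
    · rw [Finset.card_pair]; rw [Ne, Sym2.eq_iff]; grind
    · intro e he
      simp only [Finset.mem_insert, Finset.mem_singleton] at he
      rcases he with rfl | rfl <;> simpa
    · ext e
      induction e using Sym2.ind with
      | _ x y =>
        simp only [SimpleGraph.mem_edgeFinset, SimpleGraph.mem_edgeSet, Finset.mem_union,
          Finset.mem_sdiff, Finset.mem_insert, Finset.mem_singleton, Sym2.eq_iff, tog_adj, C4]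
        have := G.adj_comm
        have := G.ne_of_adj (a := x) (b := y)
        grind

lemma reach_seq [Nonempty V] {G H : SimpleGraph V} (hG : Eul G) (h : Reach G H) :
    ∃ (ℓ : ℕ) (f : ℕ → SimpleGraph V), f 0 = G ∧ f ℓ = H ∧
      (∀ i ≤ ℓ, IsEulerianGraph (f i)) ∧ (∀ i < ℓ, IsKSwitch 2 (f i) (f (i + 1))) := by
  induction h with
  | refl => exact ⟨0, fun _ => G, rfl, rfl, fun _ _ => (eul_iff G).2 hG, fun i hi => by omega⟩
  | @tail K L _ h2 ih =>
    obtain ⟨l, f, f0, fl, h3, h4⟩ := ih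
    refine ⟨l + 1, fun i => if i ≤ l then f i else L, ?_, ?_, ?_, ?_⟩
    · simp [f0]
    · simp
    · intro i hi
      by_cases hil : i ≤ l
      · simp only [hil, if_true]; exact h3 i hil
      · simp only [hil, if_false]; exact (eul_iff L).2 h2.2.2
    · intro i hi
      by_cases hil : i = l
      · subst hil
        simp only [le_refl, if_true, Nat.not_succ_le_self, if_false, fl]
        exact mv_switch h2.1
      · have e1 : i ≤ l := by omega
        have e2 : i + 1 ≤ l := by omega
        simp only [e1, e2, if_true]
        exact h4 i (by omega)

end EulSw

theorem eulerian_two_switch_connected {V : Type*} [Fintype V]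
    (G H : SimpleGraph V) (m : ℕ)
    (hG : IsEulerianGraph G) (hH : IsEulerianGraph H)
    (hGm : G.edgeFinset.card = m) (hHm : H.edgeFinset.card = m) :
    ∃ (ℓ : ℕ) (f : ℕ → SimpleGraph V),
      f 0 = G ∧ f ℓ = H ∧
      (∀ i ≤ ℓ, IsEulerianGraph (f i)) ∧
      (∀ i < ℓ, IsKSwitch 2 (f i) (f (i + 1))) := by
  have : Nonempty V := hG.1.nonempty
  have eG := (EulSw.eul_iff G).1 hG
  have eH := (EulSw.eul_iff H).1 hH
  refine EulSw.reach_seq eG (EulSw.main_ind _ V rfl G H eG eH ?_)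
  rw [EulSw.tot_eq, EulSw.tot_eq, hGm, hHm]
end

section
/- Let P ⊂ ℕ² be the set of all pairs of integers (n, m) such that (1) 3 ≤ n ≤ m ≤ n(n−1)/2, (2) it is not the case that n is odd and m = n(n−1)/2 − i for some i ∈ {1, 2}, and (3) it is not the case that n is even and m = n(n−1)/2 − i for some i ∈ {0, 1, ..., n/2 − 1}. If (n, m) ∈ P and m ≥ n(n−1)/2 − n + 1, then there exists a simple Eulerian graph with n vertices and m edges. -/
open SimpleGraph Finset
open scoped Classical

/-- The set of pairs `(n, m)` for which an Eulerian graph with `n` vertices and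
`m` edges should exist. -/
def EulerianPairs : Set (ℕ × ℕ) :=
  {p | 3 ≤ p.1 ∧ p.1 ≤ p.2 ∧ p.2 ≤ p.1 * (p.1 - 1) / 2 ∧
    ¬ (Odd p.1 ∧ ∃ i ∈ ({1, 2} : Set ℕ), p.2 = p.1 * (p.1 - 1) / 2 - i) ∧
    ¬ (Even p.1 ∧ ∃ i, i ≤ p.1 / 2 - 1 ∧ p.2 = p.1 * (p.1 - 1) / 2 - i)}

theorem aux_deg {n : ℕ} (H : SimpleGraph (Fin n)) (v : Fin n) (s : Finset (Fin n))
    (h : ∀ w, H.Adj v w ↔ w ∈ s) : H.degree v = s.card := by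
  rw [← SimpleGraph.card_neighborFinset_eq_degree]
  congr 1
  ext w
  simp [h]

theorem aux_main {n m k : ℕ} (hk : m + k = n * (n - 1) / 2) (H : SimpleGraph (Fin n))
    (d : Fin n → ℕ) (hd : ∀ v, H.degree v = d v) (hpar : ∀ v, Even (n - 1 - d v))
    (hsum : ∑ v, d v = 2 * k) (c : Fin n) (hc : ∀ v, Hᶜ.Reachable v c) :
    ∃ G : SimpleGraph (Fin n), IsEulerianGraph G ∧ G.edgeFinset.card = m := by
  obtain ⟨G, hG⟩ : ∃ G, G = Hᶜ := ⟨_, rfl⟩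
  rw [← hG] at hc
  have hdeg : ∀ v, G.degree v = n - 1 - d v := by
    intro v
    have := SimpleGraph.degree_compl H v
    rw [hd v, Fintype.card_fin] at this
    rw [← this]
    subst hG
    congr!
  refine ⟨G, ⟨?_, ?_⟩, ?_⟩
  · have : Nonempty (Fin n) := ⟨c⟩
    exact SimpleGraph.Connected.mk (fun u v => (hc u).trans (hc v).symm)
  · intro v
    rw [hdeg]; exact hpar v
  · have h1 := SimpleGraph.sum_degrees_eq_twice_card_edges G
    simp only [hdeg] at h1
    have h2 : ∑ v, (n - 1 - d v) + ∑ v, d v = n * (n - 1) := by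
      rw [← Finset.sum_add_distrib]
      rw [Finset.sum_congr rfl (g := fun _ => n - 1)]
      · simp
      · intro v _
        have := H.degree_lt_card_verts v
        rw [hd v, Fintype.card_fin] at this
        omega
    have h3 : 2 ∣ n * (n - 1) := (Nat.even_mul_pred_self n).two_dvd
    have h4 : 2 * G.edgeFinset.card = 2 * m := by
      rw [← h1]; omega
    omega

theorem aux_odd {n m k : ℕ} (hk : m + k = n * (n - 1) / 2) (hn : Odd n) (h3 : 3 ≤ n)
    (hk0 : k = 0 ∨ 3 ≤ k) (hkn : k ≤ n - 1) :
    ∃ G : SimpleGraph (Fin n), IsEulerianGraph G ∧ G.edgeFinset.card = m := by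
  let H : SimpleGraph (Fin n) :=
    { Adj := fun u v => u.1 < k ∧ v.1 < k ∧ (v.1 = u.1 + 1 ∨ u.1 = v.1 + 1 ∨
        (u.1 = 0 ∧ v.1 + 1 = k) ∨ (v.1 = 0 ∧ u.1 + 1 = k)) ∧ u.1 ≠ v.1
      symm := ⟨fun u v h => by omega⟩
      loopless := ⟨fun u h => h.2.2.2 rfl⟩ }
  refine aux_main hk H (fun v => if v.1 < k then 2 else 0) ?_ ?_ ?_ ⟨n - 1, by omega⟩ ?_
  · intro v
    by_cases hv : v.1 < k
    · rw [if_pos hv, aux_deg H v {⟨if v.1 = 0 then k - 1 else v.1 - 1, by split_ifs <;> omega⟩,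
        ⟨if v.1 + 1 = k then 0 else v.1 + 1, by split_ifs <;> omega⟩}]
      · rw [Finset.card_pair]
        intro h
        rw [Fin.mk.injEq] at h
        split_ifs at h <;> omega
      · intro w
        simp only [H, Finset.mem_insert, Finset.mem_singleton, Fin.ext_iff]
        split_ifs <;> omega
    · rw [if_neg hv, aux_deg H v ∅]
      · simp
      · intro w
        simp [H, hv]
  · intro v
    obtain ⟨t, rfl⟩ := hn
    split_ifs
    · exact ⟨t - 1, by omega⟩
    · exact ⟨t, by omega⟩
  · rw [Fin.sum_univ_eq_sum_range (fun i => if i < k then 2 else 0) n, ← Finset.sum_filter]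
    have : (Finset.range n).filter (fun i => i < k) = Finset.range k := by
      ext i; simp; omega
    rw [this]; simp [mul_comm]
  · intro v
    by_cases hv : v.1 = n - 1
    · have : v = ⟨n - 1, by omega⟩ := Fin.ext hv
      rw [this]
    · apply SimpleGraph.Adj.reachable
      rw [SimpleGraph.compl_adj]
      simp only [H, ne_eq, Fin.ext_iff]
      omega

theorem aux_even1 {n m k j : ℕ} (hk : m + k = n * (n - 1) / 2) (hn : Even n)
    (hj : 2 * j + 4 ≤ n) (hkj : 2 * k = n + 2 * j) :
    ∃ G : SimpleGraph (Fin n), IsEulerianGraph G ∧ G.edgeFinset.card = m := by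
  obtain ⟨t, rfl⟩ := hn
  let H : SimpleGraph (Fin (t + t)) :=
    { Adj := fun u v => (u.1 = 0 ∧ 1 ≤ v.1 ∧ v.1 ≤ 2 * j + 1) ∨
        (v.1 = 0 ∧ 1 ≤ u.1 ∧ u.1 ≤ 2 * j + 1) ∨
        (2 * j + 2 ≤ u.1 ∧ 2 * j + 2 ≤ v.1 ∧ u.1 / 2 = v.1 / 2 ∧ u.1 ≠ v.1)
      symm := ⟨fun u v h => by omega⟩
      loopless := ⟨fun u h => by omega⟩ }
  refine aux_main hk H (fun v => 1 + if v = ⟨0, by omega⟩ then 2 * j else 0) ?_ ?_ ?_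
    ⟨t + t - 1, by omega⟩ ?_
  · intro v
    by_cases h0 : v.1 = 0
    · rw [if_pos (Fin.ext h0), aux_deg H v (Finset.Icc ⟨1, by omega⟩ ⟨2 * j + 1, by omega⟩)]
      · rw [Fin.card_Icc]; dsimp only; omega
      · intro w
        simp only [H, Finset.mem_Icc, Fin.le_def]
        omega
    · rw [if_neg (fun h => h0 (Fin.ext_iff.1 h))]
      rw [aux_deg H v {⟨if v.1 ≤ 2 * j + 1 then 0 else if v.1 % 2 = 0 then v.1 + 1 else v.1 - 1,
        by split_ifs <;> omega⟩}]
      · simp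
      · intro w
        simp only [H, Finset.mem_singleton, Fin.ext_iff]
        split_ifs <;> omega
  · intro v
    split_ifs
    · exact ⟨t - 1 - j, by omega⟩
    · exact ⟨t - 1, by omega⟩
  · rw [Finset.sum_add_distrib, Finset.sum_ite_eq']
    simp; omega
  · have key : ∀ v : Fin (t + t), v.1 + 2 ≠ t + t →
        Hᶜ.Reachable v ⟨t + t - 1, by omega⟩ := by
      intro v h2
      by_cases hv : v.1 = t + t - 1
      · have : v = ⟨t + t - 1, by omega⟩ := Fin.ext hv
        rw [this]
      · apply SimpleGraph.Adj.reachable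
        rw [SimpleGraph.compl_adj]
        simp only [H, ne_eq, Fin.ext_iff]
        omega
    intro v
    by_cases h2 : v.1 + 2 = t + t
    · refine SimpleGraph.Reachable.trans (v := ⟨0, by omega⟩) ?_ (key _ (by dsimp only; omega))
      apply SimpleGraph.Adj.reachable
      rw [SimpleGraph.compl_adj]
      simp only [H, ne_eq, Fin.ext_iff]
      omega
    · exact key v h2

theorem aux_even2 {n m k : ℕ} (hk : m + k = n * (n - 1) / 2) (hn : Even n)
    (hj : 6 ≤ n) (hkj : k = n - 1) :
    ∃ G : SimpleGraph (Fin n), IsEulerianGraph G ∧ G.edgeFinset.card = m := by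
  obtain ⟨t, rfl⟩ := hn
  let H : SimpleGraph (Fin (t + t)) :=
    { Adj := fun u v => (u.1 = 0 ∧ 1 ≤ v.1 ∧ v.1 ≤ 3) ∨
        (v.1 = 0 ∧ 1 ≤ u.1 ∧ u.1 ≤ 3) ∨
        (u.1 = 1 ∧ 4 ≤ v.1) ∨ (v.1 = 1 ∧ 4 ≤ u.1)
      symm := ⟨fun u v h => by omega⟩
      loopless := ⟨fun u h => by omega⟩ }
  refine aux_main hk H (fun v => 1 + ((if v = ⟨0, by omega⟩ then 2 else 0) +
    if v = ⟨1, by omega⟩ then t + t - 4 else 0)) ?_ ?_ ?_ ⟨4, by omega⟩ ?_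
  · intro v
    by_cases h0 : v.1 = 0
    · rw [if_pos (Fin.ext h0), if_neg (fun h => by have := Fin.ext_iff.1 h; simp at this; omega),
        aux_deg H v (Finset.Icc ⟨1, by omega⟩ ⟨3, by omega⟩)]
      · rw [Fin.card_Icc]; dsimp only
      · intro w
        simp only [H, Finset.mem_Icc, Fin.le_def]
        omega
    · rw [if_neg (fun h => h0 (Fin.ext_iff.1 h))]
      by_cases h1 : v.1 = 1
      · rw [if_pos (Fin.ext h1), aux_deg H v
          (insert ⟨0, by omega⟩ (Finset.Icc ⟨4, by omega⟩ ⟨t + t - 1, by omega⟩))]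
        · rw [Finset.card_insert_of_notMem (by simp), Fin.card_Icc]; dsimp only; omega
        · intro w
          simp only [H, Finset.mem_insert, Finset.mem_Icc, Fin.le_def, Fin.ext_iff]
          omega
      · rw [if_neg (fun h => h1 (Fin.ext_iff.1 h))]
        rw [aux_deg H v {⟨if v.1 ≤ 3 then 0 else 1, by split_ifs <;> omega⟩}]
        · simp
        · intro w
          simp only [H, Finset.mem_singleton, Fin.ext_iff]
          split_ifs <;> omega
  · intro v
    rw [Nat.even_iff]
    simp only [Fin.ext_iff]
    split_ifs <;> omega
  · rw [Finset.sum_add_distrib, Finset.sum_add_distrib, Finset.sum_ite_eq', Finset.sum_ite_eq']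
    simp; omega
  · have key : ∀ v : Fin (t + t), v.1 ≠ 1 → Hᶜ.Reachable v ⟨4, by omega⟩ := by
      intro v h2
      by_cases hv : v.1 = 4
      · have : v = ⟨4, by omega⟩ := Fin.ext hv
        rw [this]
      · apply SimpleGraph.Adj.reachable
        rw [SimpleGraph.compl_adj]
        simp only [H, ne_eq, Fin.ext_iff]
        omega
    intro v
    by_cases h2 : v.1 = 1
    · refine SimpleGraph.Reachable.trans (v := ⟨2, by omega⟩) ?_ (key _ (by dsimp only; omega))
      apply SimpleGraph.Adj.reachable
      rw [SimpleGraph.compl_adj]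
      simp only [H, ne_eq, Fin.ext_iff]
      omega
    · exact key v h2

theorem exists_eulerian_of_large_m (n m : ℕ) (hP : (n, m) ∈ EulerianPairs)
    (hm : n * (n - 1) / 2 - n + 1 ≤ m) :
    ∃ G : SimpleGraph (Fin n), IsEulerianGraph G ∧ G.edgeFinset.card = m := by
  obtain ⟨h3, hnm, hmu, ho, he⟩ := hP
  dsimp only at h3 hnm hmu ho he
  obtain ⟨k, hk⟩ := Nat.exists_eq_add_of_le hmu
  have hkn : k ≤ n - 1 := by omega
  rcases Nat.even_or_odd n with hn | hn
  · have hkl : n / 2 ≤ k := by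
      by_contra hlt
      exact he ⟨hn, k, by omega, by omega⟩
    have hn2 := Nat.even_iff.1 hn
    by_cases hkt : k = n - 1
    · by_cases h6 : 6 ≤ n
      · exact aux_even2 hk.symm hn h6 hkt
      · have : n = 4 := by omega
        subst this
        omega
    · exact aux_even1 (j := k - n / 2) hk.symm hn (by omega) (by omega)
  · refine aux_odd hk.symm hn h3 ?_ hkn
    by_contra hlt
    refine ho ⟨hn, k, ?_, by omega⟩
    have : k = 1 ∨ k = 2 := by omega
    simpa using this
end

section
/- Let G be an Eulerian simple graph with n vertices and m edges. Then there is a finite sequence of 2-switches, with every intermediate graph Eulerian, transforming G into an Eulerian graph H on the same vertex set in which there is an even integer d such that every vertex of H has degree equal to d or to d + 2. -/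
open SimpleGraph Finset
open scoped Classical

def sw {V : Type*} (G : SimpleGraph V) (u v a b : V) : SimpleGraph V :=
  SimpleGraph.fromEdgeSet ((G.edgeSet \ {s(u, a), s(u, b)}) ∪ {s(v, a), s(v, b)})

set_option maxHeartbeats 4000000 in
theorem sw_step {V : Type*} [Fintype V] (G : SimpleGraph V) (hG : IsEulerianGraph G)
    (u v : V) (huv : G.degree v + 4 ≤ G.degree u) :
    ∃ G' : SimpleGraph V, IsEulerianGraph G' ∧ IsKSwitch 2 G G' ∧
      ∑ x, (G'.degree x) ^ 2 < ∑ x, (G.degree x) ^ 2 := by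
  have hne : u ≠ v := by rintro rfl; omega
  obtain ⟨p, hp⟩ := (hG.1.preconnected u v).exists_isPath
  cases p with
  | nil => exact absurd rfl hne
  | @cons _ w _ h q =>
  rw [SimpleGraph.Walk.cons_isPath_iff] at hp
  have hcard : 1 < (G.neighborFinset u \ (insert v (insert w (G.neighborFinset v)))).card := by
    have h1 := Finset.le_card_sdiff (insert v (insert w (G.neighborFinset v)))
      (G.neighborFinset u)
    have h2 := Finset.card_insert_le v (insert w (G.neighborFinset v))
    have h3 := Finset.card_insert_le w (G.neighborFinset v)
    rw [SimpleGraph.card_neighborFinset_eq_degree] at h1 h3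
    omega
  obtain ⟨a, ha, b, hb, hab⟩ := Finset.one_lt_card.1 hcard
  simp only [Finset.mem_sdiff, Finset.mem_insert, SimpleGraph.mem_neighborFinset, not_or] at ha hb
  obtain ⟨hua, hav, haw, hva⟩ := ha
  obtain ⟨hub, hbv, hbw, hvb⟩ := hb
  have hadj : ∀ x y, (sw G u v a b).Adj x y ↔
      (G.Adj x y ∧ s(x, y) ≠ s(u, a) ∧ s(x, y) ≠ s(u, b)) ∨ s(x, y) = s(v, a) ∨
        s(x, y) = s(v, b) := by
    intro x y
    simp only [sw, SimpleGraph.fromEdgeSet_adj, Set.mem_union, Set.mem_sdiff,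
      SimpleGraph.mem_edgeSet, Set.mem_insert_iff, Set.mem_singleton_iff, not_or]
    constructor
    · tauto
    · intro hh
      refine ⟨hh, ?_⟩
      rintro rfl
      rcases hh with hh | hh | hh
      · exact G.irrefl hh.1
      · simp only [Sym2.eq_iff] at hh; grind
      · simp only [Sym2.eq_iff] at hh; grind
  have hua' := hua.ne
  have hub' := hub.ne
  have hnu : (sw G u v a b).neighborFinset u = G.neighborFinset u \ {a, b} := by
    ext x
    simp only [SimpleGraph.mem_neighborFinset, hadj, ne_eq, Sym2.eq_iff, Finset.mem_sdiff,
      Finset.mem_insert, Finset.mem_singleton]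
    clear hadj hcard hp huv hG
    grind
  have hnv : (sw G u v a b).neighborFinset v = G.neighborFinset v ∪ {a, b} := by
    ext x
    simp only [SimpleGraph.mem_neighborFinset, hadj, ne_eq, Sym2.eq_iff, Finset.mem_union,
      Finset.mem_insert, Finset.mem_singleton]
    clear hadj hcard hp huv hG
    grind
  have hdu : (sw G u v a b).degree u + 2 = G.degree u := by
    rw [← SimpleGraph.card_neighborFinset_eq_degree, ← SimpleGraph.card_neighborFinset_eq_degree,
      hnu, ← Finset.card_pair hab]
    apply Finset.card_sdiff_add_card_eq_card
    intro x
    simp only [Finset.mem_insert, Finset.mem_singleton, SimpleGraph.mem_neighborFinset]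
    rintro (rfl | rfl) <;> assumption
  have hdv : (sw G u v a b).degree v = G.degree v + 2 := by
    rw [← SimpleGraph.card_neighborFinset_eq_degree, ← SimpleGraph.card_neighborFinset_eq_degree,
      hnv, ← Finset.card_pair hab]
    apply Finset.card_union_of_disjoint
    rw [Finset.disjoint_right]
    intro x
    simp only [Finset.mem_insert, Finset.mem_singleton, SimpleGraph.mem_neighborFinset]
    rintro (rfl | rfl) <;> assumption
  have hdx : ∀ x, x ≠ u → x ≠ v → (sw G u v a b).degree x = G.degree x := by
    intro x hxu hxv
    rw [← SimpleGraph.card_neighborFinset_eq_degree, ← SimpleGraph.card_neighborFinset_eq_degree]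
    by_cases hx : x = a ∨ x = b
    · have hxu' : G.Adj x u := by rcases hx with rfl | rfl <;> exact SimpleGraph.Adj.symm ‹_›
      have hxv' : ¬ G.Adj x v := by
        rw [SimpleGraph.adj_comm]; rcases hx with rfl | rfl <;> assumption
      have : (sw G u v a b).neighborFinset x = insert v ((G.neighborFinset x).erase u) := by
        ext y
        simp only [SimpleGraph.mem_neighborFinset, hadj, ne_eq, Sym2.eq_iff, Finset.mem_insert,
          Finset.mem_erase]
        clear hadj hcard hp huv hG
        grind
      rw [this, Finset.card_insert_of_notMem (by simp [hxv']),
        Finset.card_erase_add_one (by simpa using hxu')]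
    · congr 1
      ext y
      simp only [SimpleGraph.mem_neighborFinset, hadj, ne_eq, Sym2.eq_iff]
      clear hadj hcard hp huv hG
      grind
  refine ⟨sw G u v a b, ⟨?_, ?_⟩, ?_, ?_⟩
  ·
    have huw : (sw G u v a b).Adj u w := by
      rw [hadj]; left; refine ⟨h, ?_, ?_⟩ <;> simp only [ne_eq, Sym2.eq_iff] <;> grind
    have hwv : (sw G u v a b).Reachable w v := by
      refine ⟨q.transfer _ ?_⟩
      intro e he
      have hu : u ∉ e := fun hue => hp.2 (q.mem_support_of_mem_edges he hue)
      have hE := q.edges_subset_edgeSet he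
      induction e with
      | _ x y =>
      rw [SimpleGraph.mem_edgeSet, hadj]
      left
      simp only [Sym2.mem_iff, not_or] at hu
      refine ⟨hE, ?_, ?_⟩ <;> simp only [ne_eq, Sym2.eq_iff] <;> grind
    have huvr : (sw G u v a b).Reachable u v := huw.reachable.trans hwv
    have hra : (sw G u v a b).Reachable u a :=
      huvr.trans (SimpleGraph.Adj.reachable (by rw [hadj]; simp))
    have hrb : (sw G u v a b).Reachable u b :=
      huvr.trans (SimpleGraph.Adj.reachable (by rw [hadj]; simp))
    have hstep : ∀ x y, G.Adj x y → (sw G u v a b).Reachable x y := by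
      intro x y hxy
      by_cases h1 : s(x, y) = s(u, a)
      · rcases Sym2.eq_iff.1 h1 with ⟨rfl, rfl⟩ | ⟨rfl, rfl⟩
        exacts [hra, hra.symm]
      by_cases h2 : s(x, y) = s(u, b)
      · rcases Sym2.eq_iff.1 h2 with ⟨rfl, rfl⟩ | ⟨rfl, rfl⟩
        exacts [hrb, hrb.symm]
      exact SimpleGraph.Adj.reachable ((hadj x y).2 (Or.inl ⟨hxy, h1, h2⟩))
    have := hG.1.nonempty
    refine SimpleGraph.Connected.mk ?_
    intro x y
    obtain ⟨r⟩ := hG.1.preconnected x y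
    induction r with
    | nil => exact SimpleGraph.Reachable.refl _
    | cons hh _ ih => exact (hstep _ _ hh).trans (ih)
  · intro x
    have hx := hG.2 x
    by_cases h1 : x = u
    · subst h1; rw [← hdu] at hx; grind
    by_cases h2 : x = v
    · subst h2; rw [hdv]; grind
    rw [hdx x h1 h2]; exact hx
  · have hR : ({s(u, a), s(u, b)} : Finset (Sym2 V)).card = 2 :=
      Finset.card_pair (by simp only [ne_eq, Sym2.eq_iff]; grind)
    have hA : ({s(v, a), s(v, b)} : Finset (Sym2 V)).card = 2 :=
      Finset.card_pair (by simp only [ne_eq, Sym2.eq_iff]; grind)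
    have hRG : ({s(u, a), s(u, b)} : Finset (Sym2 V)) ⊆ G.edgeFinset := by
      intro e
      simp only [Finset.mem_insert, Finset.mem_singleton]
      rintro (rfl | rfl) <;> simpa
    have hE : (sw G u v a b).edgeFinset =
        (G.edgeFinset \ {s(u, a), s(u, b)}) ∪ {s(v, a), s(v, b)} := by
      ext e
      induction e with
      | _ x y =>
      simp only [SimpleGraph.mem_edgeFinset, SimpleGraph.mem_edgeSet, hadj, Finset.mem_union,
        Finset.mem_sdiff, Finset.mem_insert, Finset.mem_singleton, not_or, ne_eq]
    refine ⟨_, _, hR, hA, hRG, hE, ?_⟩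
    rw [hE, Finset.card_union_of_disjoint, hA, ← hR]
    · exact Finset.card_sdiff_add_card_eq_card hRG
    · rw [Finset.disjoint_right]
      intro e
      simp only [Finset.mem_insert, Finset.mem_singleton]
      rintro (rfl | rfl) <;> simp [hva, hvb]
  · have key : ∀ x, (((sw G u v a b).degree x : ℤ)) ^ 2 = (G.degree x : ℤ) ^ 2
        + (if x = u then (-4 * (G.degree u : ℤ) + 4) else 0)
        + (if x = v then (4 * (G.degree v : ℤ) + 4) else 0) := by
      intro x
      by_cases h1 : x = u
      · subst h1
        rw [← hdu]; simp only [if_true, if_neg hne]; push_cast; ring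
      by_cases h2 : x = v
      · subst h2
        rw [hdv]; simp only [if_true, if_neg h1]; push_cast; ring
      rw [hdx x h1 h2]; simp [h1, h2]
    zify
    rw [Finset.sum_congr rfl (fun x _ => key x)]
    simp only [Finset.sum_add_distrib, Finset.sum_ite_eq', Finset.mem_univ, if_true]
    zify at huv
    linarith

theorem eulerian_to_near_regular {V : Type*} [Fintype V]
    (G : SimpleGraph V) (hG : IsEulerianGraph G) :
    ∃ (ℓ : ℕ) (f : ℕ → SimpleGraph V),
      f 0 = G ∧
      (∀ i ≤ ℓ, IsEulerianGraph (f i)) ∧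
      (∀ i < ℓ, IsKSwitch 2 (f i) (f (i + 1))) ∧
      ∃ d : ℕ, Even d ∧ ∀ v : V, (f ℓ).degree v = d ∨ (f ℓ).degree v = d + 2 := by
  induction hn : ∑ x, (G.degree x) ^ 2 using Nat.strong_induction_on generalizing G with
  | _ n ih =>
  subst hn
  by_cases hex : ∃ u v, G.degree v + 4 ≤ G.degree u
  · obtain ⟨u, v, huv⟩ := hex
    obtain ⟨G', hG', hs, hlt⟩ := sw_step G hG u v huv
    obtain ⟨l, f, h0, h1, h2, h3⟩ := ih _ hlt G' hG' rfl
    refine ⟨l + 1, fun i => Nat.casesOn i G f, rfl, ?_, ?_, h3⟩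
    · rintro (_ | i) hi
      · exact hG
      · exact h1 i (by omega)
    · rintro (_ | i) hi
      · show IsKSwitch 2 G (f 0)
        rw [h0]; exact hs
      · exact h2 i (by omega)
  · push Not at hex
    have := hG.1.nonempty
    obtain ⟨v, hv⟩ := Finite.exists_min (fun x => G.degree x)
    refine ⟨0, fun _ => G, rfl, fun _ _ => hG, fun i hi => absurd hi (by omega), G.degree v,
      hG.2 v, ?_⟩
    intro x
    have h1 := hv x
    have h2 := hex x v
    obtain ⟨c, hc⟩ := hG.2 v
    obtain ⟨e, he⟩ := hG.2 x
    show G.degree x = _ ∨ G.degree x = _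
    omega
end
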